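/- Let G = (V,E) be a finite graph. Then the set C(G) := {χ_C : C a circuit of G} of characteristic vectors of circuits of G is a dyadic generating set for a cone: every integral vector in cone(C(G)) can be written as a conic combination of vectors of C(G) all of whose coefficients are dyadic rationals. -/

import Mathlib

open Finset

attribute [local instance] Classical.propDecidable

/-- A real number is `p`-adic if it has the form `a / p^k` for integers `a, k`, `k ≥ 0`;
for `p = 2` these are the dyadic rationals. -/
def IsPadic (p : ℕ) (r : ℝ) : Prop := ∃ (a : ℤ) (k : ℕ), r = (a : ℝ) / (p : ℝ) ^ k

/-- A finite family of integral vectors is a `p`-adic generating set for a cone if every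
integral vector in its conic hull is a conic combination of the vectors with `p`-adic
coefficients; for `p = 2` this is a dyadic generating set for a cone (DGSC). -/
def IsPGSC (p : ℕ) {ι d : Type} [Fintype ι] [Fintype d] (a : ι → d → ℤ) : Prop :=
  ∀ w : d → ℤ,
    (∃ lam : ι → ℝ, (∀ i, 0 ≤ lam i) ∧ ∀ j, ∑ i, lam i * (a i j : ℝ) = (w j : ℝ)) →
    ∃ lam : ι → ℝ, (∀ i, 0 ≤ lam i) ∧ (∀ i, IsPadic p (lam i)) ∧
      ∀ j, ∑ i, lam i * (a i j : ℝ) = (w j : ℝ)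

/-- In the multigraph with edge set `E` and endpoint map `ends`, `C` is a cycle if every
vertex is incident with an even number of edges of `C`. -/
def IsCycleSet {V E : Type} [Fintype V] [Fintype E] (ends : E → Sym2 V)
    (C : Finset E) : Prop :=
  ∀ v : V, Even ((Finset.univ.filter (fun e => e ∈ C ∧ v ∈ ends e)).card)

/-- A circuit is a nonempty cycle not properly containing another nonempty cycle. -/
def IsCircuit {V E : Type} [Fintype V] [Fintype E] (ends : E → Sym2 V)
    (C : Finset E) : Prop :=
  C.Nonempty ∧ IsCycleSet ends C ∧
    ∀ C' : Finset E, C' ⊆ C → C'.Nonempty → IsCycleSet ends C' → C' = C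

set_option linter.unusedSectionVars false
set_option linter.unusedVariables false
set_option linter.unusedSimpArgs false
set_option linter.style.longLine false


/-- perfect matchings as fixed point free involutions -/
def IsPM {V : Type} (σ : V → V) : Prop := (∀ v, σ (σ v) = v) ∧ ∀ v, σ v ≠ v

section Counting
variable {V : Type} [Fintype V]

/-- number of vertices of `A` matched into `B` -/
noncomputable def cnt (σ : V → V) (A B : Finset V) : ℤ := ((A.filter (fun v => σ v ∈ B)).card : ℤ)

/-- number of matching edges crossing `U` -/
noncomputable def cr (U : Finset V) (σ : V → V) : ℤ := cnt σ U Uᶜ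

/-- nontrivial odd sets -/
def NTr (U : Finset V) : Prop := Odd U.card ∧ 3 ≤ U.card ∧ 3 ≤ (Uᶜ).card

theorem cnt_nonneg (σ : V → V) (A B : Finset V) : 0 ≤ cnt σ A B := by
  unfold cnt; positivity

theorem cnt_comm {σ : V → V} (h : IsPM σ) (A B : Finset V) : cnt σ A B = cnt σ B A := by
  unfold cnt
  congr 1
  apply Finset.card_bij (fun v _ => σ v)
  · intro v hv
    simp only [mem_filter] at hv ⊢
    rw [h.1]; exact ⟨hv.2, hv.1⟩
  · intro a _ b _ hab
    have := congrArg σ hab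
    rwa [h.1, h.1] at this
  · intro b hb
    simp only [mem_filter] at hb
    exact ⟨σ b, by simp only [mem_filter]; rw [h.1]; exact ⟨hb.2, hb.1⟩, h.1 b⟩

theorem cnt_union_left (σ : V → V) {A A' : Finset V} (B : Finset V) (h : Disjoint A A') :
    cnt σ (A ∪ A') B = cnt σ A B + cnt σ A' B := by
  unfold cnt
  rw [filter_union, card_union_of_disjoint (disjoint_filter_filter h)]
  push_cast; rfl

theorem cnt_union_right (σ : V → V) (A : Finset V) {B B' : Finset V} (h : Disjoint B B') :
    cnt σ A (B ∪ B') = cnt σ A B + cnt σ A B' := by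
  unfold cnt
  rw [← Nat.cast_add, ← card_union_of_disjoint]
  · congr 2
    ext v; simp only [mem_filter, mem_union]; tauto
  · rw [Finset.disjoint_left]
    intro v hv hv'
    simp only [mem_filter] at hv hv'
    exact Finset.disjoint_left.1 h hv.2 hv'.2

theorem cnt_univ (σ : V → V) (A : Finset V) : cnt σ A univ = A.card := by
  unfold cnt; simp

theorem cnt_compl (σ : V → V) (A B : Finset V) : cnt σ A B + cnt σ A Bᶜ = A.card := by
  rw [← cnt_union_right _ _ disjoint_compl_right, union_compl, cnt_univ]

theorem cnt_zero_iff (σ : V → V) (A B : Finset V) : cnt σ A B = 0 ↔ ∀ v ∈ A, σ v ∉ B := by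
  unfold cnt
  simp [filter_eq_empty_iff]

theorem cnt_pos_iff (σ : V → V) (A B : Finset V) : 0 < cnt σ A B ↔ ∃ v ∈ A, σ v ∈ B := by
  have := cnt_zero_iff σ A B
  have := cnt_nonneg σ A B
  constructor
  · intro h
    by_contra hc
    push Not at hc
    have := (cnt_zero_iff σ A B).2 hc
    omega
  · rintro ⟨v, hv, hv'⟩
    rcases (this).lt_or_eq with h | h
    · exact h
    · exact absurd hv' ((cnt_zero_iff σ A B).1 h.symm v hv)

theorem even_card_invol {α : Type} (s : Finset α) (g : α → α) (h1 : ∀ a ∈ s, g a ∈ s)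
    (h2 : ∀ a ∈ s, g (g a) = a) (h3 : ∀ a ∈ s, g a ≠ a) : Even s.card := by
  have : ∑ a ∈ s, (1 : ZMod 2) = 0 := by
    apply Finset.sum_involution (fun a _ => g a)
    · intro a ha; decide +revert
    · intro a ha _; exact h3 a ha
    · intro a ha; exact h1 a ha
    · intro a ha; exact h2 a ha
  rw [sum_const, nsmul_eq_mul, mul_one] at this
  exact (ZMod.natCast_eq_zero_iff_even).1 this

theorem cnt_self_even {σ : V → V} (h : IsPM σ) (A : Finset V) : Even (cnt σ A A) := by
  unfold cnt
  have : Even ((A.filter (fun v => σ v ∈ A)).card) := by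
    apply even_card_invol _ σ
    · intro a ha
      simp only [mem_filter] at ha ⊢
      rw [h.1]; exact ⟨ha.2, ha.1⟩
    · intro a _; exact h.1 a
    · intro a _; exact h.2 a
  exact_mod_cast this

theorem cr_nonneg (U : Finset V) (σ : V → V) : 0 ≤ cr U σ := cnt_nonneg _ _ _

theorem cr_compl {σ : V → V} (h : IsPM σ) (U : Finset V) : cr Uᶜ σ = cr U σ := by
  unfold cr; rw [compl_compl, cnt_comm h]

theorem cr_card {σ : V → V} (U : Finset V) : cnt σ U U + cr U σ = U.card :=
  cnt_compl σ U U

theorem cr_odd {σ : V → V} (h : IsPM σ) {U : Finset V} (hU : Odd U.card) : Odd (cr U σ) := by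
  have h1 := cr_card (σ := σ) U
  have h2 := cnt_self_even h U
  have h3 : Odd (U.card : ℤ) := by exact_mod_cast hU
  have : cr U σ = U.card - cnt σ U U := by omega
  rw [this]
  exact h3.sub_even h2

theorem cr_even {σ : V → V} (h : IsPM σ) {U : Finset V} (hU : Even U.card) : Even (cr U σ) := by
  have h1 := cr_card (σ := σ) U
  have h2 := cnt_self_even h U
  have h3 : Even (U.card : ℤ) := by exact_mod_cast hU
  have : cr U σ = U.card - cnt σ U U := by omega
  rw [this]
  exact h3.sub h2

theorem one_le_cr {σ : V → V} (h : IsPM σ) {U : Finset V} (hU : Odd U.card) : 1 ≤ cr U σ := by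
  obtain ⟨k, hk⟩ := cr_odd h hU
  have := cr_nonneg U σ
  omega

theorem pm_card_even {σ : V → V} (h : IsPM σ) : Even (Fintype.card V) := by
  rw [← Finset.card_univ]
  apply even_card_invol _ σ
  · intro a ha; simp
  · intro a _; exact h.1 a
  · intro a _; exact h.2 a

theorem NTr_compl {σ : V → V} (h : IsPM σ) {U : Finset V} (hU : NTr U) : NTr Uᶜ := by
  refine ⟨?_, hU.2.2, by rw [compl_compl]; exact hU.2.1⟩
  have := pm_card_even h
  have h2 := Finset.card_compl_add_card U
  have h3 := hU.1
  rw [← h2] at this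
  grind

end Counting


/-- a set of perfect matchings with the properties of the matchings of a brick -/
structure PMSys (V : Type) [Fintype V] where
  M : Finset (V → V)
  pm : ∀ σ ∈ M, IsPM σ
  f2 : ∀ U : Finset V, NTr U → ∃ σ ∈ M, cr U σ ≠ 1
  f3 : ∀ (f : V → V → ℚ) (C : ℚ), (∀ σ ∈ M, ∑ v, f v (σ v) = C) →
    ∃ y : V → ℚ, ∀ σ ∈ M, ∀ a, f a (σ a) + f (σ a) a = y a + y (σ a)
  f4 : ∀ (f : V → V → ℚ), (∀ σ ∈ M, 0 ≤ ∑ v, f v (σ v)) →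
    ∃ (μ : V → V → ℚ) (l : Finset V → ℚ), (∀ a b, 0 ≤ μ a b) ∧ (∀ U, 0 ≤ l U) ∧
      (∀ U, l U ≠ 0 → NTr U) ∧
      ∀ σ ∈ M, ∑ v, f v (σ v) = ∑ v, μ v (σ v) + ∑ U, l U * ((cr U σ : ℚ) - 1)

/-- a set of matchings `P` covering all edges but possibly the exceptional edge `e1 e2` -/
structure PFace {V : Type} [Fintype V] (K : PMSys V) where
  P : Finset (V → V)
  sub : ∀ σ ∈ P, σ ∈ K.M
  ne : P.Nonempty
  fl : Prop
  e1 : V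
  e2 : V
  n6 : 6 ≤ Fintype.card V
  cover : ∀ σ ∈ K.M, ∀ a, ¬ (fl ∧ ((a = e1 ∧ σ a = e2) ∨ (a = e2 ∧ σ a = e1))) → ∃ τ ∈ P, τ a = σ a
  avoid : ∀ σ ∈ P, fl → σ e1 ≠ e2

namespace PFace
variable {V : Type} [Fintype V] {K : PMSys V} (F : PFace K)

def exc (a b : V) : Prop := F.fl ∧ ((a = F.e1 ∧ b = F.e2) ∨ (a = F.e2 ∧ b = F.e1))

noncomputable def xe (σ : V → V) : ℤ := if F.fl ∧ σ F.e1 = F.e2 then 1 else 0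

theorem exc_symm {a b : V} (h : F.exc a b) : F.exc b a := by
  unfold exc at *; tauto

theorem not_exc_P {σ : V → V} (hσ : σ ∈ F.P) (a : V) : ¬ F.exc a (σ a) := by
  rintro ⟨hf, ⟨h1, h2⟩ | ⟨h1, h2⟩⟩
  · exact F.avoid σ hσ hf (h1 ▸ h2)
  · apply F.avoid σ hσ hf
    rw [← h2, (K.pm σ (F.sub σ hσ)).1, h1]

theorem xe_P {σ : V → V} (hσ : σ ∈ F.P) : F.xe σ = 0 := by
  unfold xe; rw [if_neg]; rintro ⟨h1, h2⟩; exact F.avoid σ hσ h1 h2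

theorem xe_nonneg (σ : V → V) : 0 ≤ F.xe σ := by
  unfold xe; split_ifs <;> simp

/-- coefficient for exceptional counts -/
noncomputable def kk (T : V → V → Prop) : ℤ :=
  (if T F.e1 F.e2 then 1 else 0) + (if T F.e2 F.e1 then 1 else 0)

theorem exc_count (T : V → V → Prop) (hT : ∀ σ ∈ K.M, ∀ v, T v (σ v) → F.exc v (σ v))
    {σ : V → V} (hσ : σ ∈ K.M) :
    (((univ : Finset V).filter (fun v => T v (σ v))).card : ℤ) = F.kk T * F.xe σ := by
  have hpm := K.pm σ hσ
  by_cases hx : F.fl ∧ σ F.e1 = F.e2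
  · have h2 : σ F.e2 = F.e1 := by rw [← hx.2, hpm.1]
    have hne : F.e1 ≠ F.e2 := by
      intro h; exact hpm.2 F.e1 (by rw [hx.2, ← h])
    have : (univ : Finset V).filter (fun v => T v (σ v)) =
        ({F.e1, F.e2} : Finset V).filter (fun v => T v (σ v)) := by
      ext v
      simp only [mem_filter, mem_univ, true_and, mem_insert, mem_singleton]
      constructor
      · intro h
        refine ⟨?_, h⟩
        have := hT σ hσ v h
        unfold exc at this; tauto
      · tauto
    rw [this, Finset.card_filter, Finset.sum_pair hne, hx.2, h2]
    unfold kk xe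
    rw [if_pos hx]; push_cast; ring
  · have : (univ : Finset V).filter (fun v => T v (σ v)) = ∅ := by
      rw [filter_eq_empty_iff]
      intro v _ h
      obtain ⟨hf, ⟨h1, h2⟩ | ⟨h1, h2⟩⟩ := hT σ hσ v h
      · exact hx ⟨hf, h1 ▸ h2⟩
      · exact hx ⟨hf, by rw [← h2, hpm.1, h1]⟩
    rw [this]; unfold xe; rw [if_neg hx]; simp

theorem cnt_eq_filter (σ : V → V) (A B : Finset V) :
    cnt σ A B = ((univ : Finset V).filter (fun v => v ∈ A ∧ σ v ∈ B)).card := by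
  unfold cnt; congr 2; ext v; simp

theorem exc_cnt (A B : Finset V) (hT : ∀ σ ∈ K.M, ∀ v ∈ A, σ v ∈ B → F.exc v (σ v))
    {σ : V → V} (hσ : σ ∈ K.M) :
    cnt σ A B = F.kk (fun a b => a ∈ A ∧ b ∈ B) * F.xe σ := by
  rw [cnt_eq_filter]
  have := F.exc_count (fun a b => a ∈ A ∧ b ∈ B) (fun σ hσ v h => hT σ hσ v h.1 h.2) hσ
  convert this

/-- connectivity lemma -/
theorem conn (D : Finset V) (h1 : D.Nonempty) (h2 : Dᶜ.Nonempty) (h3 : Even D.card)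
    (h4 : ∀ σ ∈ K.M, ∀ v ∈ D, σ v ∉ D → F.exc v (σ v)) : False := by
  have key : ∀ σ ∈ K.M, cr D σ = 0 := by
    intro σ hσ
    have e1 := F.exc_cnt D Dᶜ (fun σ hσ v hv h => h4 σ hσ v hv (by simpa using h)) hσ
    have e2 := cr_even (K.pm σ hσ) h3
    unfold cr at *
    rw [e1] at e2 ⊢
    unfold kk xe at *
    have : ¬ (F.e1 ∈ D ∧ F.e2 ∈ Dᶜ ∧ F.e2 ∈ D ∧ F.e1 ∈ Dᶜ) := by simp; tauto
    split_ifs at * <;> simp_all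
  have hn := F.n6
  have hc := Finset.card_compl_add_card D
  have hev : Even (Fintype.card V) := by
    obtain ⟨σ, hσ⟩ := F.ne
    exact pm_card_even (K.pm σ (F.sub σ hσ))
  obtain ⟨a, ha⟩ := h1
  obtain ⟨b, hb⟩ := h2
  -- adding a vertex gives a tight set
  have tight : ∀ (A : Finset V) (c : V), c ∉ A → (∀ σ ∈ K.M, cr A σ = 0) → ∀ σ ∈ K.M,
      cr (insert c A) σ = 1 := by
    intro A c hcA hA σ hσ
    have hz := (cnt_zero_iff _ _ _).1 (hA σ hσ)
    unfold cr cnt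
    have : (insert c A).filter (fun v => σ v ∈ (insert c A)ᶜ) = {c} := by
      ext v
      simp only [mem_filter, mem_insert, mem_compl, mem_singleton] at *
      constructor
      · rintro ⟨rfl | h, h'⟩
        · rfl
        · exact absurd (not_not.1 (hz v h)) (fun h'' => h' (Or.inr h''))
      · rintro rfl
        refine ⟨Or.inl rfl, ?_⟩
        rintro (h | h)
        · exact (K.pm σ hσ).2 _ h
        · have := not_not.1 (hz _ h)
          rw [(K.pm σ hσ).1] at this
          exact hcA this
    rw [this]; simp
  have hcompl : ∀ σ ∈ K.M, cr Dᶜ σ = 0 := fun σ hσ => by rw [cr_compl (K.pm σ hσ)]; exact key σ hσ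
  rw [mem_compl] at hb
  have hapos : 0 < D.card := card_pos.2 ⟨a, ha⟩
  have hbpos : 0 < Dᶜ.card := card_pos.2 ⟨b, by simpa⟩
  by_cases hD : D.card = 2
  · obtain ⟨σ, hσ, h⟩ := K.f2 (insert b D) (by
      have e1 := card_insert_of_notMem hb
      have e2 := Finset.card_compl_add_card (insert b D)
      refine ⟨?_, ?_, ?_⟩
      · rw [e1, hD]; exact ⟨1, rfl⟩
      · omega
      · omega)
    exact h (tight D b hb key σ hσ)
  · have haD : a ∉ Dᶜ := by simpa
    obtain ⟨σ, hσ, h⟩ := K.f2 (insert a Dᶜ) (by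
      have e1 := card_insert_of_notMem haD
      have e2 := Finset.card_compl_add_card (insert a Dᶜ)
      refine ⟨?_, ?_, ?_⟩
      · rw [e1]; grind
      · grind
      · grind)
    exact h (tight Dᶜ a haD hcompl σ hσ)

end PFace


namespace PFace
variable {V : Type} [Fintype V] {K : PMSys V} (F : PFace K)

/-- a region `R` partitioned into `N`, `Z` and the tight parts in `p` -/
structure Reg (R N Z : Finset V) (p : Finset (Finset V)) : Prop where
  disj : ∀ A ∈ p, ∀ B ∈ p, A ≠ B → Disjoint A B
  dNZ : Disjoint N Z
  dN : Disjoint N (p.biUnion id)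
  dZ : Disjoint Z (p.biUnion id)
  uni : R = N ∪ Z ∪ p.biUnion id
  tight : ∀ A ∈ p, ∀ σ ∈ F.P, cr A σ = 1
  odd : ∀ A ∈ p, Odd A.card
  eNN : ∀ σ ∈ K.M, ∀ v ∈ N, σ v ∈ N → F.exc v (σ v)
  eNZ : ∀ σ ∈ K.M, ∀ v ∈ N, σ v ∈ Z → F.exc v (σ v)
  eZI : ∀ σ ∈ K.M, ∀ v ∈ Z, ∀ A ∈ p, σ v ∈ A → F.exc v (σ v)
  ePP : ∀ σ ∈ K.M, ∀ A ∈ p, ∀ B ∈ p, A ≠ B → ∀ v ∈ A, σ v ∈ B → F.exc v (σ v)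

def btp (p : Finset (Finset V)) (a b : V) : Prop :=
  a ∈ p.biUnion id ∧ b ∈ p.biUnion id ∧ ∀ A ∈ p, a ∈ A → b ∉ A

noncomputable def bt (p : Finset (Finset V)) (σ : V → V) : ℤ :=
  ((univ : Finset V).filter (fun v => btp p v (σ v))).card

theorem bt_nonneg (p : Finset (Finset V)) (σ : V → V) : 0 ≤ bt p σ := by unfold bt; positivity

variable {F} {R N Z : Finset V} {p : Finset (Finset V)}

theorem Reg.disjR (h : F.Reg R N Z p) : Disjoint N Rᶜ ∧ Disjoint Z Rᶜ ∧ Disjoint (p.biUnion id) Rᶜ := by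
  have := h.uni
  refine ⟨?_, ?_, ?_⟩ <;> (rw [Finset.disjoint_right]; intro v hv hv'; rw [mem_compl, this] at hv; apply hv; simp only [mem_union]; tauto)

theorem Reg.split (h : F.Reg R N Z p) (σ : V → V) (A : Finset V) :
    (A.card : ℤ) = cnt σ A N + cnt σ A Z + cnt σ A (p.biUnion id) + cnt σ A Rᶜ := by
  have h1 : (univ : Finset V) = R ∪ Rᶜ := by rw [union_compl]
  rw [← cnt_univ σ A, h1, cnt_union_right _ _ disjoint_compl_right]
  rw [show cnt σ A R = cnt σ A (N ∪ Z ∪ p.biUnion id) by rw [← h.uni]]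
  rw [cnt_union_right, cnt_union_right _ _ h.dNZ]
  rw [Finset.disjoint_union_left]; exact ⟨h.dN, h.dZ⟩

theorem Reg.crR (h : F.Reg R N Z p) (σ : V → V) :
    cr R σ = cnt σ N Rᶜ + cnt σ Z Rᶜ + cnt σ (p.biUnion id) Rᶜ := by
  unfold cr
  rw [show cnt σ R Rᶜ = cnt σ (N ∪ Z ∪ p.biUnion id) Rᶜ by rw [← h.uni]]
  rw [cnt_union_left, cnt_union_left _ _ h.dNZ]
  rw [Finset.disjoint_union_left]; exact ⟨h.dN, h.dZ⟩

theorem Reg.sum_cr (h : F.Reg R N Z p) (σ : V → V) :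
    ∑ A ∈ p, cr A σ = bt p σ + cnt σ (p.biUnion id) N + cnt σ (p.biUnion id) Z
      + cnt σ (p.biUnion id) Rᶜ := by
  have e1 : ∑ A ∈ p, cr A σ =
      (((p.biUnion id).filter (fun v => ∀ A ∈ p, v ∈ A → σ v ∉ A)).card : ℤ) := by
    have : (p.biUnion id).filter (fun v => ∀ A ∈ p, v ∈ A → σ v ∉ A) =
        p.biUnion (fun A => A.filter (fun v => σ v ∈ Aᶜ)) := by
      ext v
      simp only [mem_filter, mem_biUnion, id, mem_compl]
      constructor
      · rintro ⟨⟨A, hA, hv⟩, h'⟩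
        exact ⟨A, hA, hv, h' A hA hv⟩
      · rintro ⟨A, hA, hv, hv'⟩
        refine ⟨⟨A, hA, hv⟩, ?_⟩
        intro B hB hvB
        by_cases hAB : A = B
        · exact hAB ▸ hv'
        · exact absurd hvB (Finset.disjoint_left.1 (h.disj A hA B hB hAB) hv)
    rw [this, card_biUnion]
    · push_cast; rfl
    · intro A hA B hB hAB
      exact disjoint_filter_filter (h.disj A hA B hB hAB)
  rw [e1, show (p.biUnion id).filter (fun v => ∀ A ∈ p, v ∈ A → σ v ∉ A) =
      (univ.filter (fun v => btp p v (σ v))) ∪ (p.biUnion id).filter (fun v => σ v ∈ N)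
      ∪ (p.biUnion id).filter (fun v => σ v ∈ Z) ∪ (p.biUnion id).filter (fun v => σ v ∈ Rᶜ) from ?_]
  · unfold bt cnt
    obtain ⟨d1, d2, d3⟩ := h.disjR
    rw [card_union_of_disjoint, card_union_of_disjoint, card_union_of_disjoint]
    · push_cast; rfl
    · rw [Finset.disjoint_left]
      intro v hv hv'
      simp only [mem_filter] at hv hv'
      exact Finset.disjoint_left.1 h.dN hv'.2 hv.2.2.1
    · rw [Finset.disjoint_left]
      intro v hv hv'
      simp only [mem_filter, mem_union] at hv hv'
      rcases hv with hv | hv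
      · exact Finset.disjoint_left.1 h.dZ hv'.2 hv.2.2.1
      · exact Finset.disjoint_left.1 h.dNZ hv.2 hv'.2
    · rw [Finset.disjoint_left]
      intro v hv hv'
      simp only [mem_filter, mem_union] at hv hv'
      rcases hv with (hv | hv) | hv
      · exact Finset.disjoint_left.1 d3 hv.2.2.1 hv'.2
      · exact Finset.disjoint_left.1 d1 hv.2 hv'.2
      · exact Finset.disjoint_left.1 d2 hv.2 hv'.2
  · obtain ⟨d1, d2, d3⟩ := h.disjR
    ext v
    have hb : btp p v (σ v) ↔ (v ∈ p.biUnion id ∧ σ v ∈ p.biUnion id ∧ ∀ A ∈ p, v ∈ A → σ v ∉ A) := Iff.rfl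
    simp only [mem_filter, mem_union, mem_univ, true_and]
    rw [hb]
    have hu : σ v ∈ R ↔ (σ v ∈ N ∨ σ v ∈ Z) ∨ σ v ∈ p.biUnion id := by
      conv_lhs => rw [h.uni]
      simp only [mem_union]
    have hc : σ v ∈ Rᶜ ↔ σ v ∉ R := mem_compl
    have hni : σ v ∉ p.biUnion id → ∀ A ∈ p, v ∈ A → σ v ∉ A := by
      intro h A hA _ h'
      exact h (mem_biUnion.2 ⟨A, hA, h'⟩)
    have a1 : σ v ∈ N → σ v ∉ p.biUnion id := fun q => Finset.disjoint_left.1 h.dN q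
    have a2 : σ v ∈ Z → σ v ∉ p.biUnion id := fun q => Finset.disjoint_left.1 h.dZ q
    tauto

/-- exceptional counts -/
theorem Reg.cNN (h : F.Reg R N Z p) {σ : V → V} (hσ : σ ∈ K.M) :
    cnt σ N N = F.kk (fun a b => a ∈ N ∧ b ∈ N) * F.xe σ := F.exc_cnt N N h.eNN hσ

theorem Reg.cbt (h : F.Reg R N Z p) {σ : V → V} (hσ : σ ∈ K.M) :
    bt p σ = F.kk (btp p) * F.xe σ := by
  apply F.exc_count (btp p) _ hσ
  rintro σ hσ v ⟨h1, h2, h3⟩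
  simp only [mem_biUnion, id] at h1 h2
  obtain ⟨A, hA, hvA⟩ := h1
  obtain ⟨B, hB, hvB⟩ := h2
  apply h.ePP σ hσ A hA B hB _ v hvA hvB
  rintro rfl
  exact h3 A hA hvA hvB

theorem Reg.tz (h : F.Reg R N Z p) {σ : V → V} (hσ : σ ∈ F.P) :
    cnt σ N N = 0 ∧ cnt σ N Z = 0 ∧ cnt σ (p.biUnion id) Z = 0 ∧ bt p σ = 0 := by
  have hM := F.sub σ hσ
  have hx := F.xe_P hσ
  refine ⟨by rw [h.cNN hM, hx, mul_zero], ?_, ?_, by rw [h.cbt hM, hx, mul_zero]⟩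
  · rw [cnt_zero_iff]
    intro v hv hv'
    exact F.not_exc_P hσ v (h.eNZ σ hM v hv hv')
  · rw [cnt_comm (K.pm σ hM), cnt_zero_iff]
    intro v hv hv'
    simp only [mem_biUnion, id] at hv'
    obtain ⟨A, hA, hvA⟩ := hv'
    exact F.not_exc_P hσ v (h.eZI σ hM v hv A hA hvA)

/-- the basic count for tight matchings -/
theorem Reg.tight_count (h : F.Reg R N Z p) {σ : V → V} (hσ : σ ∈ F.P) :
    (N.card : ℤ) - p.card = cnt σ N Rᶜ - cnt σ (p.biUnion id) Rᶜ := by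
  obtain ⟨t1, t2, t3, t4⟩ := h.tz hσ
  have e1 := h.split σ N
  have e2 := h.sum_cr σ
  have e3 : ∑ A ∈ p, cr A σ = p.card := by
    rw [sum_congr rfl (fun A hA => h.tight A hA σ hσ)]; simp
  have e4 := cnt_comm (K.pm σ (F.sub σ hσ)) N (p.biUnion id)
  omega

/-- all `Z` edges not leaving `R` stay inside; if no exits from `Z` then `Z` is empty -/
theorem Reg.Zempty (h : F.Reg R N Z p) (hz : ∀ σ ∈ F.P, cnt σ Z Rᶜ = 0) (hne : Zᶜ.Nonempty) :
    Z = ∅ := by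
  by_contra hZ
  have hZ' : Z.Nonempty := Finset.nonempty_iff_ne_empty.2 hZ
  have hP : ∀ σ ∈ F.P, ∀ v ∈ Z, σ v ∈ Z := by
    intro σ hσ v hv
    obtain ⟨t1, t2, t3, t4⟩ := h.tz hσ
    have hpm := K.pm σ (F.sub σ hσ)
    rw [cnt_comm hpm, cnt_zero_iff] at t2 t3
    have := (cnt_zero_iff _ _ _).1 (hz σ hσ) v hv
    have a1 := t2 v hv
    have a2 := t3 v hv
    by_contra hc
    apply this
    rw [mem_compl, h.uni]
    simp only [mem_union]; tauto
  apply F.conn Z hZ' hne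
  · obtain ⟨σ, hσ⟩ := F.ne
    have hpm := K.pm σ (F.sub σ hσ)
    apply even_card_invol Z σ (fun a ha => hP σ hσ a ha) (fun a _ => hpm.1 a) (fun a _ => hpm.2 a)
  · intro σ hσ v hv hv'
    by_contra hex
    obtain ⟨τ, hτ, e⟩ := F.cover σ hσ v hex
    exact hv' (e ▸ hP τ hτ v hv)

end PFace


namespace PFace
variable {V : Type} [Fintype V] {K : PMSys V} {F : PFace K}
variable {R N Z : Finset V} {p : Finset (Finset V)}

theorem kk_nonneg (T : V → V → Prop) : 0 ≤ F.kk T := by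
  unfold kk; split_ifs <;> simp

theorem sum_sub_one (p : Finset (Finset V)) (σ : V → V) :
    ∑ A ∈ p, (cr A σ - 1) = ∑ A ∈ p, cr A σ - p.card := by
  rw [sum_sub_distrib]; simp

theorem exc_of_tight (A B : Finset V) (h : ∀ σ ∈ F.P, cnt σ A B = 0) :
    ∀ σ ∈ K.M, ∀ v ∈ A, σ v ∈ B → F.exc v (σ v) := by
  intro σ hσ v hv hv'
  by_contra hex
  obtain ⟨τ, hτ, e⟩ := F.cover σ hσ v hex
  exact (cnt_zero_iff _ _ _).1 (h τ hτ) v hv (e ▸ hv')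

theorem kk_bound (hIR : ∀ w, w ∈ p.biUnion id → w ∈ R) :
    F.kk (btp p) + 2 * F.kk (fun a b => a ∈ p.biUnion id ∧ b ∈ Rᶜ) ≤ 2 := by
  have h1 : F.kk (btp p) ≤ 2 := by unfold kk; split_ifs <;> norm_num
  by_cases q : F.e1 ∈ p.biUnion id ∧ F.e2 ∈ p.biUnion id
  · have : F.kk (fun a b => a ∈ p.biUnion id ∧ b ∈ Rᶜ) = 0 := by
      unfold kk
      rw [if_neg (fun t => mem_compl.1 t.2 (hIR _ q.2)), if_neg (fun t => mem_compl.1 t.2 (hIR _ q.1))]; rfl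
    omega
  · have : F.kk (btp p) = 0 := by
      unfold kk
      rw [if_neg (fun t => q ⟨t.1, t.2.1⟩), if_neg (fun t => q ⟨t.2.1, t.1⟩)]; rfl
    have : F.kk (fun a b => a ∈ p.biUnion id ∧ b ∈ Rᶜ) ≤ 1 := by
      unfold kk
      by_cases q' : F.e1 ∈ p.biUnion id
      · rw [if_neg (c := F.e2 ∈ p.biUnion id ∧ F.e1 ∈ Rᶜ) (fun t => mem_compl.1 t.2 (hIR _ q'))]
        split_ifs <;> norm_num
      · rw [if_neg (fun t => q' t.1)]
        split_ifs <;> norm_num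
    omega

theorem Reg.exitN (h : F.Reg R N Z p) (hR : ∀ σ ∈ F.P, cr R σ = 1)
    {τ : V → V} (hτ : τ ∈ F.P) {v : V} (hv : v ∈ N) (hv' : τ v ∉ R) :
    ∃ k : ℤ, k ≤ 2 ∧ (0 < k → F.e1 ∈ R ∨ F.e2 ∈ R) ∧
      ∀ σ ∈ K.M, ∑ A ∈ p, (cr A σ - 1) + (cr R σ - 1) = k * F.xe σ := by
  have c1 : 0 < cnt τ N Rᶜ := (cnt_pos_iff _ _ _).2 ⟨v, hv, by simpa⟩
  have hcard : (N.card : ℤ) - p.card = 1 := by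
    have e1 := h.tight_count hτ
    have e2 := h.crR τ
    have e3 := hR τ hτ
    have := cnt_nonneg τ N Rᶜ
    have := cnt_nonneg τ Z Rᶜ
    have := cnt_nonneg τ (p.biUnion id) Rᶜ
    omega
  have hall : ∀ σ ∈ F.P, cnt σ Z Rᶜ = 0 ∧ cnt σ (p.biUnion id) Rᶜ = 0 := by
    intro σ hσ
    have e1 := h.tight_count hσ
    have e2 := h.crR σ
    have e3 := hR σ hσ
    have := cnt_nonneg σ N Rᶜ
    have := cnt_nonneg σ Z Rᶜ
    have := cnt_nonneg σ (p.biUnion id) Rᶜ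
    omega
  have hZ : Z = ∅ := h.Zempty (fun σ hσ => (hall σ hσ).1)
    ⟨v, by rw [mem_compl]; exact fun q => Finset.disjoint_left.1 h.dNZ hv q⟩
  subst hZ
  obtain ⟨d1, d2, d3⟩ := h.disjR
  have hIR : ∀ w, w ∈ p.biUnion id → w ∈ R := fun w hw => by
    by_contra hc; exact Finset.disjoint_left.1 d3 hw (mem_compl.2 hc)
  have hNR : ∀ w, w ∈ N → w ∈ R := fun w hw => by
    by_contra hc; exact Finset.disjoint_left.1 d1 hw (mem_compl.2 hc)
  refine ⟨- F.kk (fun a b => a ∈ N ∧ b ∈ N) + F.kk (btp p) +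
    2 * F.kk (fun a b => a ∈ p.biUnion id ∧ b ∈ Rᶜ), ?_, ?_, ?_⟩
  · have h0 := kk_nonneg (F := F) (fun a b => a ∈ N ∧ b ∈ N)
    have : F.kk (btp p) + 2 * F.kk (fun a b => a ∈ p.biUnion id ∧ b ∈ Rᶜ) ≤ 2 := kk_bound hIR
    linarith
  · intro hk
    by_contra hc
    push Not at hc
    have h0 := kk_nonneg (F := F) (fun a b => a ∈ N ∧ b ∈ N)
    have i1 := mt (hIR F.e1) hc.1
    have i2 := mt (hIR F.e2) hc.2
    have : F.kk (btp p) = 0 := by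
      unfold kk; rw [if_neg (fun q => i1 q.1), if_neg (fun q => i2 q.1)]; rfl
    have : F.kk (fun a b => a ∈ p.biUnion id ∧ b ∈ Rᶜ) = 0 := by
      unfold kk; rw [if_neg (fun q => i1 q.1), if_neg (fun q => i2 q.1)]; rfl
    omega
  · intro σ hσ
    have e1 := h.split σ N
    have e2 := h.sum_cr σ
    have e4 := cnt_comm (K.pm σ hσ) N (p.biUnion id)
    have e5 := h.crR σ
    have e6 := h.cNN hσ
    have e7 := h.cbt hσ
    have e8 := F.exc_cnt _ _ (exc_of_tight (p.biUnion id) Rᶜ (fun σ hσ => (hall σ hσ).2)) hσ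
    have z1 : cnt σ N ∅ = 0 := by simp [cnt]
    have z2 : cnt σ (p.biUnion id) ∅ = 0 := by simp [cnt]
    have z3 : cnt σ ∅ Rᶜ = 0 := by simp [cnt]
    rw [sum_sub_one]
    linarith

theorem Reg.exitP (h : F.Reg R N Z p) (hfl : ¬ F.fl) (hR : ∀ σ ∈ F.P, cr R σ = 1)
    {τ : V → V} (hτ : τ ∈ F.P) {v : V} (hv : v ∈ p.biUnion id) (hv' : τ v ∉ R) :
      ∀ σ ∈ K.M, ∑ A ∈ p, (cr A σ - 1) = (cr R σ - 1) := by
  have c1 : 0 < cnt τ (p.biUnion id) Rᶜ := (cnt_pos_iff _ _ _).2 ⟨v, hv, by simpa⟩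
  have hcard : (N.card : ℤ) - p.card = -1 := by
    have e1 := h.tight_count hτ
    have e2 := h.crR τ
    have e3 := hR τ hτ
    have := cnt_nonneg τ N Rᶜ
    have := cnt_nonneg τ Z Rᶜ
    omega
  have hall : ∀ σ ∈ F.P, cnt σ Z Rᶜ = 0 ∧ cnt σ N Rᶜ = 0 := by
    intro σ hσ
    have e1 := h.tight_count hσ
    have e2 := h.crR σ
    have e3 := hR σ hσ
    have := cnt_nonneg σ N Rᶜ
    have := cnt_nonneg σ Z Rᶜ
    have := cnt_nonneg σ (p.biUnion id) Rᶜ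
    omega
  have hZ : Z = ∅ := h.Zempty (fun σ hσ => (hall σ hσ).1)
    ⟨v, by rw [mem_compl]; exact fun q => Finset.disjoint_left.1 h.dZ q hv⟩
  subst hZ
  intro σ hσ
  have e1 := h.split σ N
  have e2 := h.sum_cr σ
  have e4 := cnt_comm (K.pm σ hσ) N (p.biUnion id)
  have e5 := h.crR σ
  have e6 := h.cNN hσ
  have e7 := h.cbt hσ
  have e8 := F.exc_cnt _ _ (exc_of_tight N Rᶜ (fun σ hσ => (hall σ hσ).2)) hσ
  have z1 : cnt σ N ∅ = 0 := by simp [cnt]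
  have z2 : cnt σ (p.biUnion id) ∅ = 0 := by simp [cnt]
  have z3 : cnt σ ∅ Rᶜ = 0 := by simp [cnt]
  have hx : F.xe σ = 0 := by unfold xe; rw [if_neg (by tauto)]
  rw [hx, mul_zero] at e6 e7 e8
  rw [sum_sub_one]
  linarith

theorem Reg.exitZ (h : F.Reg R N Z p) (hR : ∀ σ ∈ F.P, cr R σ = 1)
    {τ : V → V} (hτ : τ ∈ F.P) {v : V} (hv : v ∈ Z) (hv' : τ v ∉ R) :
    p.biUnion id = ∅ := by
  have c1 : 0 < cnt τ Z Rᶜ := (cnt_pos_iff _ _ _).2 ⟨v, hv, by simpa⟩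
  have hcard : (N.card : ℤ) - p.card = 0 := by
    have e1 := h.tight_count hτ
    have e2 := h.crR τ
    have e3 := hR τ hτ
    have := cnt_nonneg τ N Rᶜ
    have := cnt_nonneg τ (p.biUnion id) Rᶜ
    omega
  have hall : ∀ σ ∈ F.P, cnt σ (p.biUnion id) Rᶜ = 0 ∧ cnt σ N Rᶜ = 0 := by
    intro σ hσ
    have e1 := h.tight_count hσ
    have e2 := h.crR σ
    have e3 := hR σ hσ
    have := cnt_nonneg σ N Rᶜ
    have := cnt_nonneg σ Z Rᶜ
    have := cnt_nonneg σ (p.biUnion id) Rᶜ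
    omega
  by_contra hI
  have hI' := Finset.nonempty_iff_ne_empty.2 hI
  have hP : ∀ σ ∈ F.P, ∀ w ∈ N ∪ p.biUnion id, σ w ∈ N ∪ p.biUnion id := by
    intro σ hσ w hw
    obtain ⟨t1, t2, t3, t4⟩ := h.tz hσ
    obtain ⟨b1, b2⟩ := hall σ hσ
    rw [cnt_zero_iff] at t2 t3 b1 b2
    have q1 := t2 w
    have q2 := t3 w
    have q3 := b1 w
    have q4 := b2 w
    have hu : σ w ∈ R ↔ (σ w ∈ N ∨ σ w ∈ Z) ∨ σ w ∈ p.biUnion id := by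
      conv_lhs => rw [h.uni]
      simp only [mem_union]
    rw [mem_compl] at q3 q4
    rw [mem_union] at hw ⊢
    tauto
  apply F.conn (N ∪ p.biUnion id) (hI'.mono subset_union_right)
  · refine ⟨v, ?_⟩
    rw [mem_compl, mem_union]
    rintro (q | q)
    · exact Finset.disjoint_left.1 h.dNZ q hv
    · exact Finset.disjoint_left.1 h.dZ hv q
  · have hpm := K.pm τ (F.sub τ hτ)
    exact even_card_invol _ τ (fun a ha => hP τ hτ a ha) (fun a _ => hpm.1 a) (fun a _ => hpm.2 a)
  · intro σ hσ w hw hw'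
    by_contra hex
    obtain ⟨τ, hτ, e⟩ := F.cover σ hσ w hex
    exact hw' (e ▸ hP τ hτ w hw)

theorem Reg.top (h : F.Reg univ N Z p) (hI : (p.biUnion id).Nonempty) :
    ∃ k : ℤ, k ≤ 2 ∧ ∀ σ ∈ K.M, ∑ A ∈ p, (cr A σ - 1) = k * F.xe σ := by
  have z0 : ∀ σ A, cnt σ A (univ : Finset V)ᶜ = 0 := by intro σ A; simp [cnt]
  obtain ⟨τ, hτ⟩ := F.ne
  have hcard := h.tight_count hτ
  rw [z0, z0] at hcard
  have hZ : Z = ∅ := h.Zempty (fun σ hσ => z0 _ _) (by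
    obtain ⟨v, hv⟩ := hI
    exact ⟨v, by rw [mem_compl]; exact fun q => Finset.disjoint_left.1 h.dZ q hv⟩)
  subst hZ
  refine ⟨- F.kk (fun a b => a ∈ N ∧ b ∈ N) + F.kk (btp p), ?_, ?_⟩
  · have h0 := kk_nonneg (F := F) (fun a b => a ∈ N ∧ b ∈ N)
    have : F.kk (btp p) ≤ 2 := by
      unfold kk; split_ifs <;> norm_num
    linarith
  · intro σ hσ
    have e1 := h.split σ N
    have e2 := h.sum_cr σ
    have e4 := cnt_comm (K.pm σ hσ) N (p.biUnion id)
    have e6 := h.cNN hσ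
    have e7 := h.cbt hσ
    have z1 : cnt σ N ∅ = 0 := by simp [cnt]
    have z2 : cnt σ (p.biUnion id) ∅ = 0 := by simp [cnt]
    rw [z0] at e1 e2
    rw [sum_sub_one]
    linarith

end PFace


namespace PFace
variable {V : Type} [Fintype V] {K : PMSys V} {F : PFace K}

/-- a laminar weighted family of tight sets with a potential, valid inside `S` -/
structure Lam (F : PFace K) (r : Finset (Finset V)) (l : Finset V → ℚ) (y : V → ℚ) (S : Finset V) : Prop where
  lam : ∀ A ∈ r, ∀ B ∈ r, A ⊆ B ∨ B ⊆ A ∨ Disjoint A B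
  sub : ∀ A ∈ r, A ⊆ S
  pos : ∀ A ∈ r, 0 < l A
  odd : ∀ A ∈ r, Odd A.card
  tight : ∀ A ∈ r, ∀ σ ∈ F.P, cr A σ = 1
  pot : ∀ τ ∈ F.P, ∀ a ∈ S, τ a ∈ S → y a + y (τ a)
    + ∑ A ∈ r.filter (fun A => a ∈ A ∧ τ a ∉ A), l A
    + ∑ A ∈ r.filter (fun A => τ a ∈ A ∧ a ∉ A), l A = 0

/-- maximal members strictly inside `R` -/
noncomputable def kids (r : Finset (Finset V)) (R : Finset V) : Finset (Finset V) :=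
  r.filter (fun A => A ⊂ R ∧ ∀ B ∈ r, B ⊂ R → A ⊆ B → B = A)

noncomputable def sng (r : Finset (Finset V)) (R : Finset V) : Finset V := R \ (kids r R).biUnion id

noncomputable def gg (r : Finset (Finset V)) (l : Finset V → ℚ) (y : V → ℚ) (R : Finset V) (a : V) : ℚ :=
  y a + ∑ A ∈ r.filter (fun A => a ∈ A ∧ A ⊂ R), l A

/-- exit positivity -/
def EX (F : PFace K) (r : Finset (Finset V)) (l : Finset V → ℚ) (y : V → ℚ) (R : Finset V) : Prop :=
  ∀ τ ∈ F.P, ∀ a ∈ R, τ a ∉ R → 0 < y a + ∑ A ∈ r.filter (fun A => a ∈ A ∧ A ⊆ R), l A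

noncomputable def pp (r : Finset (Finset V)) (y : V → ℚ) (R : Finset V) : Finset (Finset V) :=
  kids r R ∪ ((sng r R).filter (fun v => 0 < y v)).image (fun v => {v})

theorem exists_kid (r : Finset (Finset V)) (R : Finset V) {A : Finset V} (hA : A ∈ r) (hAR : A ⊂ R) :
    ∃ B ∈ kids r R, A ⊆ B := by
  obtain ⟨B, hB, hmax⟩ := Finset.exists_max_image (r.filter (fun B => B ⊂ R ∧ A ⊆ B)) Finset.card
    ⟨A, by simp only [mem_filter]; exact ⟨hA, hAR, Subset.refl _⟩⟩
  simp only [mem_filter] at hB hmax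
  refine ⟨B, ?_, hB.2.2⟩
  simp only [kids, mem_filter]
  refine ⟨hB.1, hB.2.1, ?_⟩
  intro C hC hCR hBC
  exact (Finset.eq_of_subset_of_card_le hBC (hmax C ⟨hC, hCR, hB.2.2.trans hBC⟩)).symm

variable {r : Finset (Finset V)} {l : Finset V → ℚ} {y : V → ℚ} {S : Finset V}

theorem kid_mem {R A : Finset V} (h : A ∈ kids r R) : A ∈ r ∧ A ⊂ R := by
  simp only [kids, mem_filter] at h; exact ⟨h.1, h.2.1⟩

theorem Lam.kid_disj (h : Lam F r l y S) {R A B : Finset V} (hA : A ∈ kids r R) (hB : B ∈ kids r R)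
    (hAB : A ≠ B) : Disjoint A B := by
  simp only [kids, mem_filter] at hA hB
  rcases h.lam A hA.1 B hB.1 with q | q | q
  · exact absurd (hA.2.2 B hB.1 hB.2.1 q) (fun e => hAB e.symm)
  · exact absurd (hB.2.2 A hA.1 hA.2.1 q) hAB
  · exact q

theorem mem_sng {R : Finset V} {a : V} : a ∈ sng r R ↔ a ∈ R ∧ ∀ A ∈ r, A ⊂ R → a ∉ A := by
  simp only [sng, mem_sdiff, mem_biUnion, id, not_exists, not_and]
  constructor
  · rintro ⟨h1, h2⟩
    refine ⟨h1, fun A hA hAR haA => ?_⟩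
    obtain ⟨B, hB, hAB⟩ := exists_kid r R hA hAR
    exact h2 B hB (hAB haA)
  · rintro ⟨h1, h2⟩
    exact ⟨h1, fun A hA => h2 A (kid_mem hA).1 (kid_mem hA).2⟩

theorem gg_sng {R : Finset V} {a : V} (h : a ∈ sng r R) : gg r l y R a = y a := by
  rw [mem_sng] at h
  unfold gg
  rw [show r.filter (fun A => a ∈ A ∧ A ⊂ R) = ∅ from ?_]
  · simp
  · rw [filter_eq_empty_iff]; rintro A hA ⟨h1, h2⟩; exact h.2 A hA h2 h1

theorem Lam.gg_kid (h : Lam F r l y S) {R L : Finset V} (hL : L ∈ kids r R) {a : V} (ha : a ∈ L) :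
    gg r l y R a = y a + ∑ A ∈ r.filter (fun A => a ∈ A ∧ A ⊆ L), l A := by
  unfold gg
  congr 2
  ext A
  simp only [mem_filter]
  obtain ⟨hLr, hLR⟩ := kid_mem hL
  constructor
  · rintro ⟨h1, h2, h3⟩
    refine ⟨h1, h2, ?_⟩
    rcases h.lam A h1 L hLr with q | q | q
    · exact q
    · simp only [kids, mem_filter] at hL
      rw [hL.2.2 A h1 h3 q]
    · exact absurd ha (Finset.disjoint_left.1 q h2)
  · rintro ⟨h1, h2, h3⟩
    exact ⟨h1, h2, lt_of_le_of_lt h3 hLR⟩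

theorem Lam.gg_pos (h : Lam F r l y S) {R : Finset V} (hE : ∀ A ∈ r, A ⊂ R → EX F r l y A)
    {τ : V → V} (hτ : τ ∈ F.P) {a : V} (ha : a ∈ (pp r y R).biUnion id)
    (hno : ∀ A ∈ kids r R, a ∈ A → τ a ∉ A) : 0 < gg r l y R a := by
  simp only [pp, mem_biUnion, mem_union, mem_image, mem_filter, id] at ha
  obtain ⟨A, hA | ⟨v, ⟨hv, hy⟩, rfl⟩, haA⟩ := ha
  · rw [h.gg_kid hA haA]
    exact hE A (kid_mem hA).1 (kid_mem hA).2 τ hτ a haA (hno A hA haA)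
  · rw [mem_singleton] at haA
    subst haA
    rw [gg_sng hv]; exact hy

theorem Lam.gg_edge (h : Lam F r l y S) {R : Finset V} (hRS : R ⊆ S)
    (hR : ∀ A ∈ r, A ⊆ R ∨ R ⊆ A ∨ Disjoint A R)
    {τ : V → V} (hτ : τ ∈ F.P) {a : V} (ha : a ∈ R) (hb : τ a ∈ R)
    (hno : ∀ A ∈ kids r R, a ∈ A → τ a ∉ A) : gg r l y R a + gg r l y R (τ a) = 0 := by
  have hno' : ∀ A ∈ r, A ⊂ R → a ∈ A → τ a ∉ A := by
    intro A hA hAR haA hb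
    obtain ⟨B, hB, hAB⟩ := exists_kid r R hA hAR
    exact hno B hB (hAB haA) (hAB hb)
  have key : ∀ u w : V, u ∈ R → w ∈ R → (∀ A ∈ r, A ⊂ R → u ∈ A → w ∉ A) →
      r.filter (fun A => u ∈ A ∧ w ∉ A) = r.filter (fun A => u ∈ A ∧ A ⊂ R) := by
    intro u w hu hw hn
    ext A
    simp only [mem_filter]
    constructor
    · rintro ⟨h1, h2, h3⟩
      refine ⟨h1, h2, ?_⟩
      rcases hR A h1 with q | q | q
      · exact lt_of_le_of_ne q (fun e => h3 (e ▸ hw))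
      · exact absurd (q hw) h3
      · exact absurd hu (Finset.disjoint_left.1 q h2)
    · rintro ⟨h1, h2, h3⟩
      exact ⟨h1, h2, hn A h1 h3 h2⟩
  have := h.pot τ hτ a (hRS ha) (hRS hb)
  rw [key a (τ a) ha hb hno', key (τ a) a hb ha (fun A hA hAR h1 h2 => hno' A hA hAR h2 h1)] at this
  unfold gg
  linarith

theorem exc_of_P (T : V → V → Prop) (h : ∀ τ ∈ F.P, ∀ v, ¬ T v (τ v)) :
    ∀ σ ∈ K.M, ∀ v, T v (σ v) → F.exc v (σ v) := by
  intro σ hσ v hv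
  by_contra hex
  obtain ⟨τ, hτ, e⟩ := F.cover σ hσ v hex
  exact h τ hτ v (e ▸ hv)

theorem cr_singleton {σ : V → V} (h : IsPM σ) (a : V) : cr {a} σ = 1 := by
  unfold cr cnt
  rw [filter_true_of_mem]
  · simp
  · intro x hx; rw [mem_singleton] at hx; subst hx; simp; exact h.2 x

theorem Lam.reg (h : Lam F r l y S) {R : Finset V} (hRS : R ⊆ S)
    (hR : ∀ A ∈ r, A ⊆ R ∨ R ⊆ A ∨ Disjoint A R) (hE : ∀ A ∈ r, A ⊂ R → EX F r l y A) :
    F.Reg R ((sng r R).filter (fun v => y v < 0)) ((sng r R).filter (fun v => y v = 0)) (pp r y R) := by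
  have hpp : ∀ a, a ∈ (pp r y R).biUnion id ↔ (∃ A ∈ kids r R, a ∈ A) ∨ (a ∈ sng r R ∧ 0 < y a) := by
    intro a
    simp only [pp, mem_biUnion, mem_union, mem_image, mem_filter, id]
    constructor
    · rintro ⟨A, hA | ⟨v, hv, rfl⟩, haA⟩
      · exact Or.inl ⟨A, hA, haA⟩
      · rw [mem_singleton] at haA; subst haA; exact Or.inr hv
    · rintro (⟨A, hA, haA⟩ | hv)
      · exact ⟨A, Or.inl hA, haA⟩
      · exact ⟨{a}, Or.inr ⟨a, hv, rfl⟩, by simp⟩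
  have hsk : ∀ a, a ∈ sng r R → ∀ A ∈ kids r R, a ∉ A := by
    intro a ha A hA
    exact (mem_sng.1 ha).2 A (kid_mem hA).1 (kid_mem hA).2
  have hdisj : ∀ A ∈ pp r y R, ∀ B ∈ pp r y R, A ≠ B → Disjoint A B := by
    intro A hA B hB hAB
    simp only [pp, mem_union, mem_image, mem_filter] at hA hB
    rcases hA with hA | ⟨v, hv, rfl⟩ <;> rcases hB with hB | ⟨w, hw, rfl⟩
    · exact h.kid_disj hA hB hAB
    · rw [disjoint_singleton_right]; exact hsk w hw.1 A hA
    · rw [disjoint_singleton_left]; exact hsk v hv.1 B hB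
    · rw [disjoint_singleton]; rintro rfl; exact hAB rfl
  have hIR : ∀ a, a ∈ (pp r y R).biUnion id → a ∈ R := by
    intro a ha
    rcases (hpp a).1 ha with ⟨A, hA, haA⟩ | ⟨hs, _⟩
    · exact (kid_mem hA).2.1 haA
    · exact (mem_sng.1 hs).1
  refine ⟨hdisj, ?_, ?_, ?_, ?_, ?_, ?_, ?_, ?_, ?_, ?_⟩
  · rw [Finset.disjoint_left]; intro a h1 h2
    simp only [mem_filter] at h1 h2; linarith [h1.2, h2.2]
  · rw [Finset.disjoint_left]; intro a h1 h2
    simp only [mem_filter] at h1; rw [hpp] at h2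
    rcases h2 with ⟨A, hA, haA⟩ | h2
    · exact hsk a h1.1 A hA haA
    · linarith [h1.2, h2.2]
  · rw [Finset.disjoint_left]; intro a h1 h2
    simp only [mem_filter] at h1; rw [hpp] at h2
    rcases h2 with ⟨A, hA, haA⟩ | h2
    · exact hsk a h1.1 A hA haA
    · linarith [h1.2, h2.2]
  · ext a
    constructor
    · intro ha
      simp only [mem_union]
      rw [hpp]
      simp only [mem_filter]
      by_cases hs : a ∈ sng r R
      · rcases lt_trichotomy (y a) 0 with q | q | q <;> tauto
      · right; left
        simp only [sng, mem_sdiff, mem_biUnion, id, not_and, not_not] at hs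
        exact hs ha
    · simp only [mem_union, mem_filter]
      rintro ((q | q) | q)
      · exact (mem_sng.1 q.1).1
      · exact (mem_sng.1 q.1).1
      · exact hIR a q
  · intro A hA σ hσ
    simp only [pp, mem_union, mem_image, mem_filter] at hA
    rcases hA with hA | ⟨v, hv, rfl⟩
    · exact h.tight A (kid_mem hA).1 σ hσ
    · exact cr_singleton (K.pm σ (F.sub σ hσ)) v
  · intro A hA
    simp only [pp, mem_union, mem_image, mem_filter] at hA
    rcases hA with hA | ⟨v, hv, rfl⟩
    · exact h.odd A (kid_mem hA).1
    · simp
  · intro σ hσ v hv hv'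
    apply exc_of_P (fun a b => a ∈ (sng r R).filter (fun v => y v < 0) ∧ b ∈ (sng r R).filter (fun v => y v < 0)) _ σ hσ v ⟨hv, hv'⟩
    rintro τ hτ a ⟨h1, h2⟩
    simp only [mem_filter] at h1 h2
    have := h.gg_edge hRS hR hτ (mem_sng.1 h1.1).1 (mem_sng.1 h2.1).1 (fun A hA ha => absurd ha (hsk _ h1.1 A hA))
    rw [gg_sng h1.1, gg_sng h2.1] at this
    linarith [h1.2, h2.2]
  · intro σ hσ v hv hv'
    apply exc_of_P (fun a b => a ∈ (sng r R).filter (fun v => y v < 0) ∧ b ∈ (sng r R).filter (fun v => y v = 0)) _ σ hσ v ⟨hv, hv'⟩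
    rintro τ hτ a ⟨h1, h2⟩
    simp only [mem_filter] at h1 h2
    have := h.gg_edge hRS hR hτ (mem_sng.1 h1.1).1 (mem_sng.1 h2.1).1 (fun A hA ha => absurd ha (hsk _ h1.1 A hA))
    rw [gg_sng h1.1, gg_sng h2.1] at this
    linarith [h1.2, h2.2]
  · intro σ hσ v hv B hB hv'
    apply exc_of_P (fun a b => a ∈ (sng r R).filter (fun v => y v = 0) ∧ b ∈ (pp r y R).biUnion id) _ σ hσ v ⟨hv, mem_biUnion.2 ⟨B, hB, hv'⟩⟩
    rintro τ hτ a ⟨h1, h2⟩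
    simp only [mem_filter] at h1
    have hpm := (K.pm τ (F.sub τ hτ)).1
    have e1 := h.gg_edge hRS hR hτ (mem_sng.1 h1.1).1 (hIR _ h2) (fun A hA ha => absurd ha (hsk _ h1.1 A hA))
    have e2 := h.gg_pos hE hτ h2 (fun A hA _ => by rw [hpm]; exact hsk _ h1.1 A hA)
    rw [gg_sng h1.1] at e1
    linarith [h1.2]
  · intro σ hσ A hA B hB hAB v hvA hvB
    apply exc_of_P (fun a b => a ∈ A ∧ b ∈ B) _ σ hσ v ⟨hvA, hvB⟩
    rintro τ hτ a ⟨h1, h2⟩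
    have m1 : a ∈ (pp r y R).biUnion id := mem_biUnion.2 ⟨A, hA, h1⟩
    have m2 : τ a ∈ (pp r y R).biUnion id := mem_biUnion.2 ⟨B, hB, h2⟩
    have hpm := (K.pm τ (F.sub τ hτ)).1
    have hno : ∀ C ∈ kids r R, a ∈ C → τ a ∉ C := by
      intro C hC h3 h4
      have hCp : C ∈ pp r y R := by simp only [pp, mem_union]; exact Or.inl hC
      have q1 : A = C := by
        by_contra q; exact Finset.disjoint_left.1 (hdisj A hA C hCp q) h1 h3
      have q2 : B = C := by
        by_contra q; exact Finset.disjoint_left.1 (hdisj B hB C hCp q) h2 h4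
      exact hAB (q1.trans q2.symm)
    have e1 := h.gg_edge hRS hR hτ (hIR _ m1) (hIR _ m2) hno
    have e2 := h.gg_pos hE hτ m1 hno
    have e3 := h.gg_pos hE hτ m2 (fun C hC h3 => by rw [hpm]; exact fun h4 => hno C hC h4 h3)
    linarith

/-- sum over the parts only sees the kids -/
theorem sum_pp {R : Finset V} {σ : V → V} (hσ : IsPM σ) :
    ∑ A ∈ pp r y R, (cr A σ - 1) = ∑ A ∈ kids r R, (cr A σ - 1) := by
  unfold pp
  symm
  apply Finset.sum_subset subset_union_left
  intro A hA hA'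
  simp only [mem_union, mem_image] at hA
  rcases hA with hA | ⟨v, _, rfl⟩
  · exact absurd hA hA'
  · rw [cr_singleton hσ]; simp

/-- outcome of a failed exit positivity -/
def Outc (F : PFace K) (r : Finset (Finset V)) (R : Finset V) : Prop :=
  ∃ k : ℤ, k ≤ 2 ∧ (0 < k → F.e1 ∈ R ∨ F.e2 ∈ R) ∧
      ∀ σ ∈ K.M, ∑ A ∈ kids r R, (cr A σ - 1) + (cr R σ - 1) = k * F.xe σ

theorem Lam.exit (h : Lam F r l y S) (hno : ∀ R ∈ r, ¬ Outc F r R) : ∀ R ∈ r, EX F r l y R := by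
  intro R
  induction R using Finset.strongInduction with
  | H R ih =>
    intro hR τ hτ a ha hb
    by_contra hneg
    have hE : ∀ A ∈ r, A ⊂ R → EX F r l y A := fun A hA hAR => ih A hAR hA
    have hreg := h.reg (h.sub R hR) (fun A hA => h.lam A hA R hR) hE
    have hgl : y a + ∑ A ∈ r.filter (fun A => a ∈ A ∧ A ⊆ R), l A = gg r l y R a + l R := by
      unfold gg
      rw [show r.filter (fun A => a ∈ A ∧ A ⊆ R) = insert R (r.filter (fun A => a ∈ A ∧ A ⊂ R)) from ?_,
        sum_insert]
      · ring
      · simp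
      · ext A
        simp only [mem_filter, mem_insert]
        constructor
        · rintro ⟨h1, h2, h3⟩
          rcases h3.eq_or_ssubset with q | q
          · exact Or.inl q
          · exact Or.inr ⟨h1, h2, q⟩
        · rintro (rfl | ⟨h1, h2, h3⟩)
          · exact ⟨hR, ha, Subset.refl _⟩
          · exact ⟨h1, h2, h3.1⟩
    rw [hgl] at hneg
    have hl := h.pos R hR
    have hgneg : gg r l y R a < 0 := by linarith
    have haN : a ∈ (sng r R).filter (fun v => y v < 0) := by
      rw [mem_filter]
      have hs : a ∈ sng r R := by
        by_contra hs
        have : a ∈ (pp r y R).biUnion id := by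
          simp only [sng, mem_sdiff, mem_biUnion, id, not_and, not_not] at hs
          obtain ⟨A, hA, haA⟩ := hs ha
          exact mem_biUnion.2 ⟨A, by simp only [pp, mem_union]; exact Or.inl hA, haA⟩
        have := h.gg_pos hE hτ this (fun A hA _ hb' => hb ((kid_mem hA).2.1 hb'))
        linarith
      rw [gg_sng hs] at hgneg
      exact ⟨hs, hgneg⟩
    obtain ⟨k, hk, hk', hs⟩ := hreg.exitN (h.tight R hR) hτ haN hb
    apply hno R hR
    refine ⟨k, hk, hk', fun σ hσ => ?_⟩
    rw [← hs σ hσ, sum_pp (K.pm σ hσ)]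

end PFace


namespace PFace
variable {V : Type} [Fintype V] {K : PMSys V} {F : PFace K}
variable {r : Finset (Finset V)} {l : Finset V → ℚ} {y : V → ℚ} {S : Finset V}

theorem s_nonneg {σ : V → V} (hσ : σ ∈ K.M) {U : Finset V} (hU : Odd U.card) : 0 ≤ cr U σ - 1 := by
  have := one_le_cr (K.pm σ hσ) hU; omega

theorem F_even (F : PFace K) : Even (Fintype.card V) := by
  obtain ⟨σ, hσ⟩ := F.ne
  exact pm_card_even (K.pm σ (F.sub σ hσ))

theorem sum_two_le {p : Finset (Finset V)} {A B : Finset V} (hA : A ∈ p) (hB : B ∈ p) (hAB : A ≠ B)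
    (g : Finset V → ℤ) (hg : ∀ C ∈ p, 0 ≤ g C) : g A + g B ≤ ∑ C ∈ p, g C := by
  rw [← Finset.sum_pair hAB]
  apply Finset.sum_le_sum_of_subset_of_nonneg
  · intro C hC; simp only [mem_insert, mem_singleton] at hC; rcases hC with rfl | rfl <;> assumption
  · intro C hC _; exact hg C hC

/-- cross free case, edge face -/
theorem Lam.cf1 (h : Lam F r l y univ) (hr : r.Nonempty) (hN : ∀ A ∈ r, NTr A) :
    (∃ A ∈ r, ∃ B ∈ r, A ≠ B ∧ ∀ σ ∈ K.M, (cr A σ - 1) + (cr B σ - 1) ≤ 2 * F.xe σ) ∨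
    (∃ A ∈ r, ∃ k : ℤ, k ≤ 2 ∧ ∀ σ ∈ K.M, cr A σ - 1 = k * F.xe σ) := by
  have hss : ∀ A ∈ r, A ⊂ univ := by
    intro A hA
    refine lt_of_le_of_ne (subset_univ _) ?_
    rintro rfl
    have h1 := h.odd _ hA
    have h2 := F_even F
    rw [card_univ] at h1
    exact (Nat.not_even_iff_odd.2 h1) h2
  have hkn : ∀ R, ∀ A ∈ kids r R, ∀ σ ∈ K.M, 0 ≤ cr A σ - 1 := fun R A hA σ hσ =>
    s_nonneg hσ (h.odd A (kid_mem hA).1)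
  by_cases hno : ∀ R ∈ r, ¬ Outc F r R
  · have hE := h.exit hno
    have hreg := h.reg (R := univ) (Subset.refl _) (fun A _ => Or.inl (subset_univ A)) (fun A hA _ => hE A hA)
    obtain ⟨A0, hA0⟩ := hr
    obtain ⟨A, hA, _⟩ := exists_kid r univ hA0 (hss _ hA0)
    have hAr := (kid_mem hA).1
    obtain ⟨k, hk, hs⟩ := hreg.top (by
      obtain ⟨v, hv⟩ : A.Nonempty := card_pos.1 (by have := (hN A hAr).2.1; omega)
      exact ⟨v, mem_biUnion.2 ⟨A, by simp only [pp, mem_union]; exact Or.inl hA, hv⟩⟩)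
    by_cases h2 : ∃ B ∈ kids r univ, A ≠ B
    · obtain ⟨B, hB, hAB⟩ := h2
      left
      refine ⟨A, hAr, B, (kid_mem hB).1, hAB, fun σ hσ => ?_⟩
      have e1 := hs σ hσ
      rw [sum_pp (K.pm σ hσ)] at e1
      have e2 := sum_two_le hA hB hAB (fun A => cr A σ - 1) (fun C hC => hkn _ C hC σ hσ)
      have e3 := F.xe_nonneg σ
      nlinarith
    · right
      push Not at h2
      have : kids r univ = {A} := by
        ext B; simp only [mem_singleton]
        exact ⟨fun q => (h2 B q).symm, fun q => q ▸ hA⟩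
      refine ⟨A, hAr, k, hk, fun σ hσ => ?_⟩
      have e1 := hs σ hσ
      rw [sum_pp (K.pm σ hσ), this, sum_singleton] at e1
      exact e1
  · push Not at hno
    obtain ⟨R, hR, k, hk, _, hs⟩ := hno
    by_cases hne : (kids r R).Nonempty
    · obtain ⟨A, hA⟩ := hne
      left
      refine ⟨A, (kid_mem hA).1, R, hR, (kid_mem hA).2.ne, fun σ hσ => ?_⟩
      have e1 := hs σ hσ
      have e2 := Finset.single_le_sum (f := fun A => cr A σ - 1) (fun C hC => hkn R C hC σ hσ) hA
      have e3 := F.xe_nonneg σ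
      nlinarith
    · right
      rw [not_nonempty_iff_eq_empty] at hne
      refine ⟨R, hR, k, hk, fun σ hσ => ?_⟩
      have e1 := hs σ hσ
      rw [hne, sum_empty, zero_add] at e1
      exact e1

/-- cross free case, cut face -/
theorem Lam.cf2 {W : Finset V} (h : Lam F r l y W) (hfl : ¬ F.fl) (hW : NTr W)
    (hWt : ∀ σ ∈ F.P, cr W σ = 1) (hr : r.Nonempty) (hN : ∀ A ∈ r, NTr A) (hss : ∀ A ∈ r, A ⊂ W) :
    (∃ A ∈ r, ∃ B ∈ r, A ≠ B ∧ ∀ σ ∈ K.M, (cr A σ - 1) + (cr B σ - 1) ≤ cr W σ - 1) ∨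
    (∃ A ∈ r, ∀ σ ∈ K.M, cr A σ - 1 = cr W σ - 1) := by
  have hx : ∀ σ, F.xe σ = 0 := by
    intro σ; unfold xe; rw [if_neg (fun t => hfl t.1)]
  have hkn : ∀ R, ∀ A ∈ kids r R, ∀ σ ∈ K.M, 0 ≤ cr A σ - 1 := fun R A hA σ hσ =>
    s_nonneg hσ (h.odd A (kid_mem hA).1)
  have hno0 : ∀ R, NTr R → ¬ Outc F r R := by
    rintro R hRN ⟨k, _, _, hs⟩
    obtain ⟨σ, hσ, hc⟩ := K.f2 R hRN
    have e1 := hs σ hσ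
    rw [hx, mul_zero] at e1
    have e2 := Finset.sum_nonneg (fun C hC => hkn R C hC σ hσ)
    have e3 := s_nonneg hσ hRN.1
    omega
  have hE := h.exit (fun R hR => hno0 R (hN R hR))
  have hreg := h.reg (R := W) (Subset.refl _) (fun A hA => Or.inl (hss A hA).1) (fun A hA _ => hE A hA)
  obtain ⟨A0, hA0⟩ := hr
  obtain ⟨A, hA, _⟩ := exists_kid r W hA0 (hss _ hA0)
  have hAr := (kid_mem hA).1
  have hIne : ((pp r y W).biUnion id).Nonempty := by
    obtain ⟨v, hv⟩ : A.Nonempty := card_pos.1 (by have := (hN A hAr).2.1; omega)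
    exact ⟨v, mem_biUnion.2 ⟨A, by simp only [pp, mem_union]; exact Or.inl hA, hv⟩⟩
  obtain ⟨τ, hτ⟩ := F.ne
  obtain ⟨a, ha, hb⟩ : ∃ a ∈ W, τ a ∉ W := by
    have := hWt τ hτ
    have : 0 < cnt τ W Wᶜ := by unfold cr at this; omega
    obtain ⟨a, ha, hb⟩ := (cnt_pos_iff _ _ _).1 this
    exact ⟨a, ha, by simpa using hb⟩
  have hs : ∀ σ ∈ K.M, ∑ C ∈ kids r W, (cr C σ - 1) = cr W σ - 1 := by
    have hu : a ∈ W := ha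
    rw [hreg.uni] at hu
    rcases mem_union.1 hu with hu | hu
    · rcases mem_union.1 hu with hu | hu
      · exfalso
        obtain ⟨k, hk, hk', hs⟩ := hreg.exitN hWt hτ hu hb
        exact hno0 W hW ⟨k, hk, hk', fun σ hσ => by rw [← hs σ hσ, sum_pp (K.pm σ hσ)]⟩
      · exfalso
        have := hreg.exitZ hWt hτ hu hb
        rw [this] at hIne
        exact not_nonempty_empty hIne
    · intro σ hσ
      rw [← hreg.exitP hfl hWt hτ hu hb σ hσ, sum_pp (K.pm σ hσ)]
  by_cases h2 : ∃ B ∈ kids r W, A ≠ B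
  · obtain ⟨B, hB, hAB⟩ := h2
    left
    refine ⟨A, hAr, B, (kid_mem hB).1, hAB, fun σ hσ => ?_⟩
    rw [← hs σ hσ]
    exact sum_two_le hA hB hAB (fun A => cr A σ - 1) (fun C hC => hkn _ C hC σ hσ)
  · right
    push Not at h2
    have : kids r W = {A} := by
      ext B; simp only [mem_singleton]
      exact ⟨fun q => (h2 B q).symm, fun q => q ▸ hA⟩
    refine ⟨A, hAr, fun σ hσ => ?_⟩
    rw [← hs σ hσ, this, sum_singleton]

noncomputable def sep (U : Finset V) (a b : V) : ℚ :=
  (if a ∈ U ∧ b ∉ U then 1 else 0) + (if b ∈ U ∧ a ∉ U then 1 else 0)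

theorem sep_compl (U : Finset V) (a b : V) : sep Uᶜ a b = sep U a b := by
  unfold sep; simp only [mem_compl, not_not]
  rw [add_comm]; congr 1 <;> (congr 1; rw [and_comm])

theorem sum_ind (U : Finset V) (σ : V → V) :
    ∑ v, (if v ∈ U ∧ σ v ∉ U then (1 : ℚ) else 0) = cr U σ := by
  unfold cr cnt
  rw [← Finset.sum_filter]
  simp only [sum_const, nsmul_eq_mul, mul_one]
  push_cast
  congr 2
  ext v; simp

/-- potentials from identities -/
theorem potential (F : PFace K) (c : Finset V → ℚ) (D : ℚ)
    (h : ∀ σ ∈ K.M, ∑ U, c U * ((cr U σ : ℚ) - 1) = D * F.xe σ) :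
    ∃ y : V → ℚ, ∀ σ ∈ K.M, ∀ a, ¬ F.exc a (σ a) → y a + y (σ a) + ∑ U, c U * sep U a (σ a) = 0 := by
  obtain ⟨y, hy⟩ := K.f3 (fun a b => ∑ U, c U * (if a ∈ U ∧ b ∉ U then (1 : ℚ) else 0) -
    D * (if F.fl ∧ a = F.e1 ∧ b = F.e2 then 1 else 0)) (∑ U, c U) (by
    intro σ hσ
    have h0 := h σ hσ
    rw [Finset.sum_sub_distrib, Finset.sum_comm]
    have e1 : ∀ U : Finset V, ∑ v, c U * (if v ∈ U ∧ σ v ∉ U then (1 : ℚ) else 0) = c U * cr U σ := by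
      intro U; rw [← Finset.mul_sum, sum_ind]
    rw [Finset.sum_congr rfl (fun U _ => e1 U), ← Finset.mul_sum]
    have e2 : ∑ v, (if F.fl ∧ v = F.e1 ∧ σ v = F.e2 then (1 : ℚ) else 0) = F.xe σ := by
      rw [Finset.sum_eq_single F.e1]
      · unfold xe; simp
      · intro b _ hb; rw [if_neg]; tauto
      · simp
    rw [e2]
    simp only [mul_sub, mul_one, Finset.sum_sub_distrib] at h0
    linarith)
  refine ⟨fun v => - y v, fun σ hσ a hex => ?_⟩
  have h1 := hy σ hσ a
  rw [if_neg (fun t => hex ⟨t.1, Or.inl t.2⟩), if_neg (fun t => hex ⟨t.1, Or.inr ⟨t.2.2, t.2.1⟩⟩)] at h1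
  have e : ∑ U, c U * sep U a (σ a) = ∑ U, c U * (if a ∈ U ∧ σ a ∉ U then (1 : ℚ) else 0)
      + ∑ U, c U * (if σ a ∈ U ∧ a ∉ U then (1 : ℚ) else 0) := by
    rw [← Finset.sum_add_distrib]
    apply Finset.sum_congr rfl
    intro U _; unfold sep; ring
  simp only
  rw [e]; linarith

/-- normalising shores -/
theorem shore_sum (c g : Finset V → ℚ) (Q : Finset V → Prop) (hg : ∀ U, g Uᶜ = g U)
    (hQ : ∀ U, c U ≠ 0 → g U ≠ 0 → (Q U ∧ ¬ Q Uᶜ) ∨ (¬ Q U ∧ Q Uᶜ)) :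
    ∑ U, (if Q U then c U + c Uᶜ else 0) * g U = ∑ U, c U * g U := by
  have e1 : ∀ U, (if Q U then c U + c Uᶜ else 0) * g U =
      (if Q U then c U * g U else 0) + (if Q U then c Uᶜ * g U else 0) := by
    intro U; split_ifs <;> ring
  rw [Finset.sum_congr rfl (fun U _ => e1 U), Finset.sum_add_distrib]
  have e2 : ∑ U, (if Q U then c Uᶜ * g U else 0) = ∑ U, (if Q Uᶜ then c U * g U else 0) := by
    apply Fintype.sum_equiv (compl_involutive (α := Finset V)).toPerm
    intro U
    simp only [Function.Involutive.coe_toPerm, compl_compl, hg]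
  rw [e2, ← Finset.sum_add_distrib]
  apply Finset.sum_congr rfl
  intro U _
  by_cases h1 : c U = 0
  · simp [h1]
  by_cases h2 : g U = 0
  · simp [h2]
  rcases hQ U h1 h2 with ⟨a, b⟩ | ⟨a, b⟩ <;> simp [a, b]

end PFace


def Cross {V : Type} (A B : Finset V) : Prop :=
  (∃ v, v ∈ A ∧ v ∈ B) ∧ (∃ v, v ∈ A ∧ v ∉ B) ∧ (∃ v, v ∉ A ∧ v ∈ B) ∧ (∃ v, v ∉ A ∧ v ∉ B)

theorem cross_compl_left {V : Type} [Fintype V] {A B : Finset V} : Cross Aᶜ B ↔ Cross A B := by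
  unfold Cross; simp only [mem_compl, not_not]; tauto

theorem cross_symm {V : Type} {A B : Finset V} (h : Cross A B) : Cross B A := by
  obtain ⟨⟨a, a1, a2⟩, ⟨b, b1, b2⟩, ⟨c, c1, c2⟩, ⟨d, d1, d2⟩⟩ := h
  exact ⟨⟨a, a2, a1⟩, ⟨c, c2, c1⟩, ⟨b, b2, b1⟩, ⟨d, d2, d1⟩⟩

theorem cross_comm {V : Type} {A B : Finset V} : Cross A B ↔ Cross B A := ⟨cross_symm, cross_symm⟩

theorem cross_compl_right {V : Type} [Fintype V] {A B : Finset V} : Cross A Bᶜ ↔ Cross A B := by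
  rw [cross_comm, cross_compl_left, cross_comm]

theorem lam_of_not_cross {V : Type} {A B : Finset V} (h : ¬ Cross A B) {v : V} (h1 : v ∉ A) (h2 : v ∉ B) :
    A ⊆ B ∨ B ⊆ A ∨ Disjoint A B := by
  by_contra hc
  push Not at hc
  obtain ⟨c1, c2, c3⟩ := hc
  apply h
  rw [Finset.not_subset] at c1 c2
  rw [Finset.not_disjoint_iff] at c3
  obtain ⟨a, a1, a2⟩ := c1
  obtain ⟨b, b1, b2⟩ := c2
  obtain ⟨c, c1, c2⟩ := c3
  exact ⟨⟨c, c1, c2⟩, ⟨a, a1, a2⟩, ⟨b, b2, b1⟩, ⟨v, h1, h2⟩⟩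

namespace PFace
variable {V : Type} [Fintype V] {K : PMSys V} {F : PFace K}

/-- a family of shores, normalised by `Q` -/
noncomputable def lq (c : Finset V → ℚ) (Q : Finset V → Prop) (U : Finset V) : ℚ :=
  if Q U then c U + c Uᶜ else 0

theorem lq_ne {c : Finset V → ℚ} {Q : Finset V → Prop} {U : Finset V} (h : lq c Q U ≠ 0) :
    Q U ∧ (c U ≠ 0 ∨ c Uᶜ ≠ 0) := by
  unfold lq at h
  by_cases hQ : Q U
  · refine ⟨hQ, ?_⟩
    rw [if_pos hQ] at h
    by_contra hc
    push Not at hc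
    rw [hc.1, hc.2] at h
    simp at h
  · rw [if_neg hQ] at h; exact absurd rfl h

theorem sep_split (r : Finset (Finset V)) (l : Finset V → ℚ) (a b : V) :
    ∑ A ∈ r.filter (fun A => a ∈ A ∧ b ∉ A), l A + ∑ A ∈ r.filter (fun A => b ∈ A ∧ a ∉ A), l A
      = ∑ A ∈ r, l A * sep A a b := by
  rw [Finset.sum_filter, Finset.sum_filter, ← Finset.sum_add_distrib]
  apply Finset.sum_congr rfl
  intro A _; unfold sep; rw [mul_add, mul_ite, mul_ite, mul_one, mul_zero]

theorem cr_compl_q {σ : V → V} (hσ : σ ∈ K.M) (U : Finset V) : cr Uᶜ σ = cr U σ := cr_compl (K.pm σ hσ) U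

theorem mkLam {c : Finset V → ℚ} {Q : Finset V → Prop} {S : Finset V} {y : V → ℚ} (v0 : V)
    (hc : ∀ U, 0 ≤ c U) (hNT : ∀ U, c U ≠ 0 → NTr U) (ht : ∀ U, c U ≠ 0 → ∀ σ ∈ F.P, cr U σ = 1)
    (hcr : ∀ A B, c A ≠ 0 → c B ≠ 0 → ¬ Cross A B)
    (hQS : ∀ U, Q U → v0 ∉ U ∧ U ⊆ S)
    (hQ : ∀ a ∈ S, ∀ b ∈ S, ∀ U, c U ≠ 0 → sep U a b ≠ 0 → (Q U ∧ ¬ Q Uᶜ) ∨ (¬ Q U ∧ Q Uᶜ))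
    (hy : ∀ τ ∈ F.P, ∀ a ∈ S, τ a ∈ S → y a + y (τ a) + ∑ U, c U * sep U a (τ a) = 0) :
    Lam F (univ.filter (fun U => lq c Q U ≠ 0)) (lq c Q) y S ∧
      ∀ A ∈ univ.filter (fun U => lq c Q U ≠ 0), NTr A := by
  obtain ⟨τ0, hτ0⟩ := F.ne
  have hpm0 := K.pm τ0 (F.sub τ0 hτ0)
  have hNT' : ∀ A, lq c Q A ≠ 0 → NTr A := by
    intro A hA
    rcases (lq_ne hA).2 with q | q
    · exact hNT A q
    · have := NTr_compl hpm0 (hNT _ q)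
      rwa [compl_compl] at this
  refine ⟨⟨?_, ?_, ?_, ?_, ?_, ?_⟩, ?_⟩
  · intro A hA B hB
    simp only [mem_filter, mem_univ, true_and] at hA hB
    obtain ⟨qA, hA⟩ := lq_ne hA
    obtain ⟨qB, hB⟩ := lq_ne hB
    apply lam_of_not_cross _ (hQS A qA).1 (hQS B qB).1
    rcases hA with hA | hA <;> rcases hB with hB | hB
    · exact hcr A B hA hB
    · have := hcr A Bᶜ hA hB; rwa [cross_compl_right] at this
    · have := hcr Aᶜ B hA hB; rwa [cross_compl_left] at this
    · have := hcr Aᶜ Bᶜ hA hB; rwa [cross_compl_left, cross_compl_right] at this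
  · intro A hA
    simp only [mem_filter, mem_univ, true_and] at hA
    exact (hQS A (lq_ne hA).1).2
  · intro A hA
    simp only [mem_filter, mem_univ, true_and] at hA
    apply lt_of_le_of_ne _ hA.symm
    unfold lq; split_ifs
    · linarith [hc A, hc Aᶜ]
    · exact le_refl _
  · intro A hA
    simp only [mem_filter, mem_univ, true_and] at hA
    exact (hNT' A hA).1
  · intro A hA σ hσ
    simp only [mem_filter, mem_univ, true_and] at hA
    rcases (lq_ne hA).2 with q | q
    · exact ht A q σ hσ
    · rw [← cr_compl_q (F.sub σ hσ)]; exact ht _ q σ hσ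
  · intro τ hτ a ha hb
    have e0 := hy τ hτ a ha hb
    rw [add_assoc (y a + y (τ a)), sep_split]
    have e1 := shore_sum c (fun U => sep U a (τ a)) Q (fun U => sep_compl U a (τ a))
      (fun U h1 h2 => hQ a ha (τ a) hb U h1 h2)
    have e2 : ∑ A ∈ univ.filter (fun U => lq c Q U ≠ 0), lq c Q A * sep A a (τ a) =
        ∑ A, lq c Q A * sep A a (τ a) := by
      apply Finset.sum_subset (subset_univ _)
      intro U _ h1
      simp only [mem_filter, mem_univ, true_and, not_not] at h1
      rw [h1, zero_mul]
    rw [e2]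
    have e3 : ∑ A, lq c Q A * sep A a (τ a) = ∑ U, c U * sep U a (τ a) := e1
    rw [e3]; exact e0
  · intro A hA
    simp only [mem_filter, mem_univ, true_and] at hA
    exact hNT' A hA

theorem cf1' {c : Finset V → ℚ} {D : ℚ}
    (hc : ∀ U, 0 ≤ c U) (hne : ∃ U, c U ≠ 0) (hNT : ∀ U, c U ≠ 0 → NTr U)
    (ht : ∀ U, c U ≠ 0 → ∀ σ ∈ F.P, cr U σ = 1)
    (hcr : ∀ A B, c A ≠ 0 → c B ≠ 0 → ¬ Cross A B)
    (hid : ∀ σ ∈ K.M, ∑ U, c U * ((cr U σ : ℚ) - 1) = D * F.xe σ) :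
    (∃ A B, NTr A ∧ NTr B ∧ ∀ σ ∈ K.M, (cr A σ - 1) + (cr B σ - 1) ≤ 2 * F.xe σ) ∨
    (∃ A, c A ≠ 0 ∧ ∃ k : ℤ, k ≤ 2 ∧ ∀ σ ∈ K.M, cr A σ - 1 = k * F.xe σ) := by
  obtain ⟨y, hy⟩ := potential F c D hid
  obtain ⟨U0, hU0⟩ := hne
  have v0 : V := F.e1
  obtain ⟨hL, hN⟩ := mkLam (F := F) (c := c) (Q := fun U => v0 ∉ U) (S := univ) (y := y) v0 hc hNT ht hcr
    (fun U h => ⟨h, subset_univ _⟩)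
    (fun a _ b _ U _ _ => by simp only [mem_compl]; tauto)
    (fun τ hτ a _ _ => hy τ (F.sub τ hτ) a (F.not_exc_P hτ a))
  have hr : (univ.filter (fun U => lq c (fun U => v0 ∉ U) U ≠ 0)).Nonempty := by
    have hpos : 0 < c U0 := lt_of_le_of_ne (hc U0) hU0.symm
    by_cases hv : v0 ∈ U0
    · refine ⟨U0ᶜ, ?_⟩
      refine mem_filter.2 ⟨mem_univ _, ?_⟩; unfold lq
      rw [if_pos (by simpa using hv), compl_compl]
      have := hc U0ᶜ
      linarith
    · refine ⟨U0, ?_⟩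
      refine mem_filter.2 ⟨mem_univ _, ?_⟩; unfold lq
      rw [if_pos hv]
      have := hc U0ᶜ
      linarith
  rcases hL.cf1 hr hN with ⟨A, hA, B, hB, _, h⟩ | ⟨A, hA, k, hk, h⟩
  · exact Or.inl ⟨A, B, hN A hA, hN B hB, h⟩
  · right
    simp only [mem_filter, mem_univ, true_and] at hA
    rcases (lq_ne hA).2 with q | q
    · exact ⟨A, q, k, hk, h⟩
    · exact ⟨Aᶜ, q, k, hk, fun σ hσ => by rw [cr_compl_q hσ]; exact h σ hσ⟩

theorem cf2' {c : Finset V → ℚ} {D : ℚ} {W : Finset V} (hfl : ¬ F.fl) (hW : NTr W)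
    (hWt : ∀ σ ∈ F.P, cr W σ = 1)
    (hc : ∀ U, 0 ≤ c U) (hne : ∃ U, c U ≠ 0) (hNT : ∀ U, c U ≠ 0 → NTr U)
    (ht : ∀ U, c U ≠ 0 → ∀ σ ∈ F.P, cr U σ = 1)
    (hcr : ∀ A B, c A ≠ 0 → c B ≠ 0 → ¬ Cross A B)
    (hcW : ∀ A, c A ≠ 0 → ¬ Cross A W) (hW1 : ∀ A, c A ≠ 0 → A ≠ W ∧ A ≠ Wᶜ)
    (hid : ∀ σ ∈ K.M, ∑ U, c U * ((cr U σ : ℚ) - 1) = D * ((cr W σ : ℚ) - 1)) :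
    (∃ A B, NTr A ∧ NTr B ∧ ∀ σ ∈ K.M, (cr A σ - 1) + (cr B σ - 1) ≤ cr W σ - 1) ∨
    (∃ A, c A ≠ 0 ∧ ∀ σ ∈ K.M, cr A σ - 1 = cr W σ - 1) := by
  -- reduce to a member inside W
  obtain ⟨τ0, hτ0⟩ := F.ne
  have hpm0 := K.pm τ0 (F.sub τ0 hτ0)
  have main : ∀ W : Finset V, NTr W → (∀ σ ∈ F.P, cr W σ = 1) → 
    (∀ A, c A ≠ 0 → A ≠ W ∧ A ≠ Wᶜ) →
    (∀ σ ∈ K.M, ∑ U, c U * ((cr U σ : ℚ) - 1) = D * ((cr W σ : ℚ) - 1)) →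
    (∃ A, c A ≠ 0 ∧ (A ⊆ W ∨ Aᶜ ⊆ W)) →
    (∀ A, c A ≠ 0 → ¬ Cross A W) → 
    (∃ A B, NTr A ∧ NTr B ∧ ∀ σ ∈ K.M, (cr A σ - 1) + (cr B σ - 1) ≤ cr W σ - 1) ∨
    (∃ A, c A ≠ 0 ∧ ∀ σ ∈ K.M, cr A σ - 1 = cr W σ - 1) := by
    intro W hW hWt hW1 hid hin hcW
    obtain ⟨v0, hv0⟩ : (Wᶜ).Nonempty := card_pos.1 (by have := hW.2.2; omega)
    rw [mem_compl] at hv0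
    obtain ⟨y, hy⟩ := potential F (fun U => c U - if U = W then D else 0) 0 (by
      intro σ hσ
      have := hid σ hσ
      simp only [sub_mul, Finset.sum_sub_distrib, this]
      simp)
    have hy' : ∀ τ ∈ F.P, ∀ a ∈ W, τ a ∈ W → y a + y (τ a) + ∑ U, c U * sep U a (τ a) = 0 := by
      intro τ hτ a ha hb
      have := hy τ (F.sub τ hτ) a (F.not_exc_P hτ a)
      simp only [sub_mul, Finset.sum_sub_distrib] at this
      have e : ∑ U, (if U = W then D else 0) * sep U a (τ a) = 0 := by
        apply Finset.sum_eq_zero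
        intro U _
        by_cases hU : U = W
        · subst hU; unfold sep; simp [ha, hb]
        · simp [hU]
      rw [e] at this
      linarith
    obtain ⟨hL, hN⟩ := mkLam (F := F) (c := c) (Q := fun U => U ⊆ W) (S := W) (y := y) v0 hc hNT ht hcr
      (fun U h => ⟨fun q => hv0 (h q), h⟩)
      (by
        intro a ha b hb U hU hs
        have hx : ¬ (U ⊆ W ∧ Uᶜ ⊆ W) := by
          rintro ⟨h1, h2⟩
          by_cases q : v0 ∈ U
          · exact hv0 (h1 q)
          · exact hv0 (h2 (mem_compl.2 q))
        have hcw := hcW U hU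
        have hor : U ⊆ W ∨ Uᶜ ⊆ W := by
          by_contra hno
          push Not at hno
          rw [Finset.not_subset, Finset.not_subset] at hno
          obtain ⟨⟨u, u1, u2⟩, ⟨w, w1, w2⟩⟩ := hno
          rw [mem_compl] at w1
          apply hcw
          unfold sep at hs
          by_cases q1 : a ∈ U <;> by_cases q2 : b ∈ U
          · simp [q1, q2] at hs
          · exact ⟨⟨a, q1, ha⟩, ⟨u, u1, u2⟩, ⟨b, q2, hb⟩, ⟨w, w1, w2⟩⟩
          · exact ⟨⟨b, q2, hb⟩, ⟨u, u1, u2⟩, ⟨a, q1, ha⟩, ⟨w, w1, w2⟩⟩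
          · simp [q1, q2] at hs
        tauto)
      hy'
    have hr : (univ.filter (fun U => lq c (fun U => U ⊆ W) U ≠ 0)).Nonempty := by
      obtain ⟨U0, hU0, h⟩ := hin
      have hpos : 0 < c U0 := lt_of_le_of_ne (hc U0) hU0.symm
      rcases h with h | h
      · refine ⟨U0, ?_⟩
        refine mem_filter.2 ⟨mem_univ _, ?_⟩; unfold lq
        rw [if_pos h]
        have := hc U0ᶜ
        linarith
      · refine ⟨U0ᶜ, ?_⟩
        refine mem_filter.2 ⟨mem_univ _, ?_⟩; unfold lq
        rw [if_pos h, compl_compl]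
        have := hc U0ᶜ
        linarith
    rcases hL.cf2 hfl hW hWt hr hN (by
        intro A hA
        refine lt_of_le_of_ne (hL.sub A hA) ?_
        simp only [mem_filter, mem_univ, true_and] at hA
        rcases (lq_ne hA).2 with q | q
        · exact (hW1 A q).1
        · intro e; exact (hW1 _ q).2 (by rw [e])) with ⟨A, hA, B, hB, _, h⟩ | ⟨A, hA, h⟩
    · exact Or.inl ⟨A, B, hN A hA, hN B hB, h⟩
    · right
      simp only [mem_filter, mem_univ, true_and] at hA
      rcases (lq_ne hA).2 with q | q
      · exact ⟨A, q, h⟩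
      · exact ⟨Aᶜ, q, fun σ hσ => by rw [cr_compl_q hσ]; exact h σ hσ⟩
  by_cases hin : ∃ A, c A ≠ 0 ∧ (A ⊆ W ∨ Aᶜ ⊆ W)
  · exact main W hW hWt hW1 hid hin hcW
  · obtain ⟨U0, hU0⟩ := hne
    have hcw := hcW U0 hU0
    push Not at hin
    obtain ⟨i1, i2⟩ := hin U0 hU0
    have := main Wᶜ (NTr_compl hpm0 hW) (fun σ hσ => by rw [cr_compl_q (F.sub σ hσ)]; exact hWt σ hσ)
      (fun A hA => by rw [compl_compl]; exact (hW1 A hA).symm)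
      (fun σ hσ => by rw [cr_compl_q hσ]; exact hid σ hσ)
      ⟨U0, hU0, by
        by_contra hno
        push Not at hno
        rw [Finset.not_subset] at i1 i2 hno
        rw [Finset.not_subset] at hno
        simp only [mem_compl, not_not] at i1 i2 hno
        exact hcw ⟨hno.1, i1, hno.2, i2⟩⟩
      (fun A hA => by rw [cross_compl_right]; exact hcW A hA)
    rcases this with ⟨A, B, hA, hB, h⟩ | ⟨A, hA, h⟩
    · exact Or.inl ⟨A, B, hA, hB, fun σ hσ => by rw [← cr_compl_q hσ W]; exact h σ hσ⟩
    · exact Or.inr ⟨A, hA, fun σ hσ => by rw [← cr_compl_q hσ W]; exact h σ hσ⟩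

end PFace


namespace PFace
variable {V : Type} [Fintype V] {K : PMSys V} {F : PFace K}

theorem kids_single (U : Finset V) : kids {U} U = ∅ := by
  unfold kids
  rw [filter_eq_empty_iff]
  intro A hA h
  rw [mem_singleton] at hA
  subst hA
  exact absurd h.1 (ssubset_irrefl _)

/-- exit positivity for a single set avoided by the exceptional edge -/
theorem single_exit {U T : Finset V} {y : V → ℚ} (hU : NTr U) (hUT : Disjoint U T)
    (ht : ∀ σ ∈ F.P, cr U σ = 1)
    (hex : F.fl → F.e1 ∉ U ∧ F.e2 ∉ U)
    (hy : ∀ τ ∈ F.P, ∀ a, a ∉ T → τ a ∉ T → y a + y (τ a) + sep U a (τ a) = 0) :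
    ∀ τ ∈ F.P, ∀ a ∈ U, τ a ∉ U → 0 < y a + 1 := by
  have hL : Lam F {U} (fun _ => 1) y Tᶜ := by
    refine ⟨?_, ?_, ?_, ?_, ?_, ?_⟩
    · intro A hA B hB
      rw [mem_singleton] at hA hB; subst hA; subst hB; exact Or.inl (Subset.refl _)
    · intro A hA
      rw [mem_singleton] at hA; subst hA
      intro v hv; rw [mem_compl]; exact Finset.disjoint_left.1 hUT hv
    · intro A hA; norm_num
    · intro A hA; rw [mem_singleton] at hA; subst hA; exact hU.1
    · intro A hA; rw [mem_singleton] at hA; subst hA; exact ht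
    · intro τ hτ a ha hb
      have := hy τ hτ a (mem_compl.1 ha) (mem_compl.1 hb)
      rw [add_assoc (y a + y (τ a)), sep_split, sum_singleton, one_mul]
      exact this
  have hE := hL.exit (by
    intro R hR
    rw [mem_singleton] at hR; subst hR
    rintro ⟨k, hk, hk', hs⟩
    rw [kids_single] at hs
    obtain ⟨σ, hσ, hc⟩ := K.f2 R hU
    have e := hs σ hσ
    rw [sum_empty, zero_add] at e
    have e2 := s_nonneg hσ hU.1
    by_cases hfl : F.fl
    · have : ¬ 0 < k := fun q => by
        have := hex hfl
        have := hk' q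
        tauto
      have hk0 : k ≤ 0 := not_lt.1 this
      have h0 := mul_nonneg (neg_nonneg.2 hk0) (F.xe_nonneg σ)
      rw [neg_mul] at h0
      omega
    · have : F.xe σ = 0 := by unfold xe; rw [if_neg (fun t => hfl t.1)]
      rw [this, mul_zero] at e
      omega) U (mem_singleton_self _)
  intro τ hτ a ha hb
  have := hE τ hτ a ha hb
  rw [show ({U} : Finset (Finset V)).filter (fun A => a ∈ A ∧ A ⊆ U) = {U} by
    rw [filter_true_of_mem]; intro A hA; rw [mem_singleton] at hA; subst hA; exact ⟨ha, Subset.refl _⟩,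
    sum_singleton] at this
  exact this

theorem pl_hall {U T Q1 Q2 : Finset V} (huni : ∀ v, v ∈ U ∨ v ∈ T ∨ v ∈ Q1 ∨ v ∈ Q2) :
    (univ : Finset V) = U ∪ T ∪ Q1 ∪ Q2 := by
  ext v; simp only [mem_union, mem_univ, true_iff]; have := huni v; tauto

theorem pl_compl {A B : Finset V} (hd : Disjoint A B) (hu : ∀ v, v ∈ A ∨ v ∈ B) : Aᶜ = B := by
  ext v; rw [mem_compl]
  constructor
  · intro h; exact (hu v).resolve_left h
  · intro h h'; exact Finset.disjoint_left.1 hd h' h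

set_option maxHeartbeats 2000000 in
theorem pair_lemma {U T Q1 Q2 : Finset V} (hU : NTr U) (hT : NTr T) (hUT : Disjoint U T)
    (hQ : Disjoint Q1 Q2) (hQU : Disjoint Q1 U) (hQT : Disjoint Q1 T) (hQU2 : Disjoint Q2 U) (hQT2 : Disjoint Q2 T)
    (huni : ∀ v, v ∈ U ∨ v ∈ T ∨ v ∈ Q1 ∨ v ∈ Q2)
    (htU : ∀ σ ∈ F.P, cr U σ = 1) (htT : ∀ σ ∈ F.P, cr T σ = 1)
    (htA : ∀ σ ∈ F.P, cr (U ∪ Q1) σ = 1)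
    (hst : ∀ σ ∈ K.M, cr U σ = cr T σ)
    (hno : ∀ σ ∈ F.P, ∀ a ∈ Q1, σ a ∉ Q2)
    (hex : F.fl → (F.e1 ∈ Q1 ∧ F.e2 ∈ Q2) ∨ (F.e1 ∈ Q2 ∧ F.e2 ∈ Q1)) :
    ∃ k : ℤ, ∀ σ ∈ K.M, cr (U ∪ Q1) σ - 1 = (cr U σ - 1) + k * F.xe σ := by
  have dj : ∀ {A B : Finset V}, Disjoint A B → ∀ v, v ∈ A → v ∉ B := fun h v hv => Finset.disjoint_left.1 h hv
  have hUTne : U ≠ T := by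
    rintro rfl
    have := hU.2.1
    rw [disjoint_self_iff_empty] at hUT
    subst hUT; simp at this
  obtain ⟨y, hy⟩ := potential F (fun A => (if A = U then 1 else 0) - (if A = T then 1 else 0)) 0 (by
    intro σ hσ
    simp only [sub_mul, Finset.sum_sub_distrib, ite_mul, one_mul, zero_mul, Finset.sum_ite_eq', mem_univ, if_true]
    rw [hst σ hσ]; ring)
  have hy' : ∀ σ ∈ K.M, ∀ a, ¬ F.exc a (σ a) → y a + y (σ a) + (sep U a (σ a) - sep T a (σ a)) = 0 := by
    intro σ hσ a ha
    have := hy σ hσ a ha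
    simp only [sub_mul, Finset.sum_sub_distrib, ite_mul, one_mul, zero_mul, Finset.sum_ite_eq', mem_univ, if_true] at this
    exact this
  have xU := single_exit (F := F) (y := y) hU hUT htU (fun hfl => by
    rcases hex hfl with ⟨a, b⟩ | ⟨a, b⟩
    · exact ⟨dj hQU _ a, dj hQU2 _ b⟩
    · exact ⟨dj hQU2 _ a, dj hQU _ b⟩) (fun τ hτ a ha hb => by
      have := hy' τ (F.sub τ hτ) a (F.not_exc_P hτ a)
      have e : sep T a (τ a) = 0 := by unfold sep; simp [ha, hb]
      rw [e] at this; linarith)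
  have xT := single_exit (F := F) (y := fun v => - y v) hT hUT.symm htT (fun hfl => by
    rcases hex hfl with ⟨a, b⟩ | ⟨a, b⟩
    · exact ⟨dj hQT _ a, dj hQT2 _ b⟩
    · exact ⟨dj hQT2 _ a, dj hQT _ b⟩) (fun τ hτ a ha hb => by
      have := hy' τ (F.sub τ hτ) a (F.not_exc_P hτ a)
      have e : sep U a (τ a) = 0 := by unfold sep; simp [ha, hb]
      rw [e] at this; linarith)
  -- edge facts
  have notexc : ∀ a b, F.exc a b → (a ∈ Q1 ∧ b ∈ Q2) ∨ (a ∈ Q2 ∧ b ∈ Q1) := by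
    rintro a b ⟨hfl, ⟨rfl, rfl⟩ | ⟨rfl, rfl⟩⟩
    · exact hex hfl
    · exact (hex hfl).symm.imp And.symm And.symm
  have fU : ∀ σ ∈ K.M, ∀ a ∈ Q1, σ a ∈ U → y a < 0 := by
    intro σ hσ a ha hb
    have hne : ¬ F.exc a (σ a) := fun h => by
      rcases notexc _ _ h with ⟨_, q⟩ | ⟨q, _⟩
      · exact dj hQU2 _ q hb
      · exact dj hQ _ ha q
    obtain ⟨τ, hτ, e⟩ := F.cover σ hσ a hne
    have hpm := (K.pm τ (F.sub τ hτ)).1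
    have h1 := xU τ hτ (τ a) (by rw [e]; exact hb) (by rw [hpm]; exact dj hQU _ ha)
    have h2 := hy' τ (F.sub τ hτ) a (F.not_exc_P hτ a)
    have e1 : sep U a (τ a) = 1 := by unfold sep; rw [e]; simp [hb, dj hQU _ ha]
    have e2 : sep T a (τ a) = 0 := by unfold sep; rw [e]; simp [dj hQT _ ha, dj hUT _ hb]
    rw [e1, e2] at h2; linarith
  have fT : ∀ σ ∈ K.M, ∀ a ∈ Q1, σ a ∈ T → 0 < y a := by
    intro σ hσ a ha hb
    have hne : ¬ F.exc a (σ a) := fun h => by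
      rcases notexc _ _ h with ⟨_, q⟩ | ⟨q, _⟩
      · exact dj hQT2 _ q hb
      · exact dj hQ _ ha q
    obtain ⟨τ, hτ, e⟩ := F.cover σ hσ a hne
    have hpm := (K.pm τ (F.sub τ hτ)).1
    have h1 := xT τ hτ (τ a) (by rw [e]; exact hb) (by rw [hpm]; exact dj hQT _ ha)
    have h2 := hy' τ (F.sub τ hτ) a (F.not_exc_P hτ a)
    have e1 : sep T a (τ a) = 1 := by unfold sep; rw [e]; simp [hb, dj hQT _ ha]
    have e2 : sep U a (τ a) = 0 := by unfold sep; rw [e]; simp [dj hQU _ ha, dj hUT.symm _ hb]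
    rw [e1, e2] at h2; linarith
  have fQ : ∀ σ ∈ K.M, ∀ a ∈ Q1, σ a ∈ Q1 → y a + y (σ a) = 0 := by
    intro σ hσ a ha hb
    have hne : ¬ F.exc a (σ a) := fun h => by
      rcases notexc _ _ h with ⟨_, q⟩ | ⟨q, _⟩
      · exact dj hQ _ hb q
      · exact dj hQ _ ha q
    have h2 := hy' σ hσ a hne
    have e1 : sep T a (σ a) = 0 := by unfold sep; simp [dj hQT _ hb, dj hQT _ ha]
    have e2 : sep U a (σ a) = 0 := by unfold sep; simp [dj hQU _ ha, dj hQU _ hb]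
    rw [e1, e2] at h2; linarith
  set N1 := Q1.filter (fun v => y v < 0) with hN1
  set P1 := Q1.filter (fun v => 0 < y v) with hP1
  set Z1 := Q1.filter (fun v => y v = 0) with hZ1
  have mN : ∀ v, v ∈ N1 ↔ v ∈ Q1 ∧ y v < 0 := fun v => by rw [hN1, mem_filter]
  have mP : ∀ v, v ∈ P1 ↔ v ∈ Q1 ∧ 0 < y v := fun v => by rw [hP1, mem_filter]
  have mZ : ∀ v, v ∈ Z1 ↔ v ∈ Q1 ∧ y v = 0 := fun v => by rw [hZ1, mem_filter]
  have dNP : Disjoint N1 P1 := by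
    rw [Finset.disjoint_left]; intro v h1 h2; rw [mN] at h1; rw [mP] at h2; linarith [h1.2, h2.2]
  have dNPZ : Disjoint (N1 ∪ P1) Z1 := by
    rw [Finset.disjoint_left]; intro v h1 h2; rw [mem_union, mN, mP] at h1; rw [mZ] at h2
    rcases h1 with h1 | h1 <;> linarith [h1.2, h2.2]
  have hQ1 : Q1 = N1 ∪ P1 ∪ Z1 := by
    ext v; rw [mem_union, mem_union, mN, mP, mZ]
    rcases lt_trichotomy (y v) 0 with q | q | q <;> tauto
  have hall : (univ : Finset V) = U ∪ T ∪ Q1 ∪ Q2 := pl_hall huni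
  have dUTQ : Disjoint (U ∪ T) Q1 := by rw [disjoint_union_left]; exact ⟨hQU.symm, hQT.symm⟩
  have dUTQQ : Disjoint (U ∪ T ∪ Q1) Q2 := by
    rw [disjoint_union_left, disjoint_union_left]; exact ⟨⟨hQU2.symm, hQT2.symm⟩, hQ⟩
  have split : ∀ σ A, (A.card : ℤ) = cnt σ A U + cnt σ A T + (cnt σ A N1 + cnt σ A P1 + cnt σ A Z1) + cnt σ A Q2 := by
    intro σ A
    rw [← cnt_union_right _ _ dNP, ← cnt_union_right _ _ dNPZ, ← hQ1, ← cnt_union_right _ _ hUT,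
      ← cnt_union_right _ _ dUTQ, ← cnt_union_right _ _ dUTQQ, ← hall, cnt_univ]
  have cU : Uᶜ = T ∪ Q1 ∪ Q2 := by
    apply pl_compl
    · rw [disjoint_union_right, disjoint_union_right]; exact ⟨⟨hUT, hQU.symm⟩, hQU2.symm⟩
    · intro v; rw [mem_union, mem_union]
      rcases huni v with q | q | q | q
      exacts [Or.inl q, Or.inr (Or.inl (Or.inl q)), Or.inr (Or.inl (Or.inr q)), Or.inr (Or.inr q)]
  have cA : (U ∪ Q1)ᶜ = T ∪ Q2 := by
    apply pl_compl
    · rw [disjoint_union_right, disjoint_union_left, disjoint_union_left]; exact ⟨⟨hUT, hQT⟩, hQU2.symm, hQ⟩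
    · intro v; rw [mem_union, mem_union]
      rcases huni v with q | q | q | q
      exacts [Or.inl (Or.inl q), Or.inr (Or.inl q), Or.inl (Or.inr q), Or.inr (Or.inr q)]
  have main : ∀ σ ∈ K.M, cr (U ∪ Q1) σ - cr U σ = (P1.card : ℤ) - N1.card + (cnt σ N1 Q2 - cnt σ P1 Q2 + cnt σ Q1 Q2) := by
    intro σ hσ
    have hpm := K.pm σ hσ
    have e1 : cr (U ∪ Q1) σ = cnt σ U T + cnt σ U Q2 + (cnt σ Q1 T + cnt σ Q1 Q2) := by
      unfold cr; rw [cA, cnt_union_left _ _ hQU.symm, cnt_union_right _ _ hQT2.symm, cnt_union_right _ _ hQT2.symm]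
    have e2 : cr U σ = cnt σ U T + cnt σ U Q1 + cnt σ U Q2 := by
      unfold cr; rw [cU, cnt_union_right, cnt_union_right _ _ hQT.symm]
      rw [disjoint_union_left]; exact ⟨hQT2.symm, hQ⟩
    have e3 : cnt σ U Q1 = cnt σ N1 U + cnt σ P1 U + cnt σ Z1 U := by
      rw [cnt_comm hpm, hQ1, cnt_union_left _ _ dNPZ, cnt_union_left _ _ dNP]
    have e4 : cnt σ Q1 T = cnt σ N1 T + cnt σ P1 T + cnt σ Z1 T := by
      conv_lhs => rw [hQ1]
      rw [cnt_union_left _ _ dNPZ, cnt_union_left _ _ dNP]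
    have e5 := split σ N1
    have e6 := split σ P1
    have e7 := cnt_comm hpm N1 P1
    have z1 : cnt σ N1 T = 0 := by
      rw [cnt_zero_iff]; intro v hv hv'; rw [mN] at hv; linarith [fT σ hσ v hv.1 hv', hv.2]
    have z2 : cnt σ Z1 T = 0 := by
      rw [cnt_zero_iff]; intro v hv hv'; rw [mZ] at hv; linarith [fT σ hσ v hv.1 hv', hv.2]
    have z3 : cnt σ P1 U = 0 := by
      rw [cnt_zero_iff]; intro v hv hv'; rw [mP] at hv; linarith [fU σ hσ v hv.1 hv', hv.2]
    have z4 : cnt σ Z1 U = 0 := by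
      rw [cnt_zero_iff]; intro v hv hv'; rw [mZ] at hv; linarith [fU σ hσ v hv.1 hv', hv.2]
    have z5 : cnt σ N1 N1 = 0 := by
      rw [cnt_zero_iff]; intro v hv hv'; rw [mN] at hv hv'; linarith [fQ σ hσ v hv.1 hv'.1, hv.2, hv'.2]
    have z6 : cnt σ N1 Z1 = 0 := by
      rw [cnt_zero_iff]; intro v hv hv'; rw [mN] at hv; rw [mZ] at hv'; linarith [fQ σ hσ v hv.1 hv'.1, hv.2, hv'.2]
    have z7 : cnt σ P1 P1 = 0 := by
      rw [cnt_zero_iff]; intro v hv hv'; rw [mP] at hv hv'; linarith [fQ σ hσ v hv.1 hv'.1, hv.2, hv'.2]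
    have z8 : cnt σ P1 Z1 = 0 := by
      rw [cnt_zero_iff]; intro v hv hv'; rw [mP] at hv; rw [mZ] at hv'; linarith [fQ σ hσ v hv.1 hv'.1, hv.2, hv'.2]
    linarith
  have zz : ∀ A : Finset V, A ⊆ Q1 → ∀ σ ∈ F.P, cnt σ A Q2 = 0 := by
    intro A hA σ hσ
    rw [cnt_zero_iff]; intro v hv; exact hno σ hσ v (hA hv)
  have sN : N1 ⊆ Q1 := filter_subset _ _
  have sP : P1 ⊆ Q1 := filter_subset _ _
  have hcard : (P1.card : ℤ) - N1.card = 0 := by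
    obtain ⟨τ, hτ⟩ := F.ne
    have := main τ (F.sub τ hτ)
    rw [htA τ hτ, htU τ hτ, zz N1 sN τ hτ, zz P1 sP τ hτ, zz Q1 (Subset.refl _) τ hτ] at this
    linarith
  refine ⟨F.kk (fun a b => a ∈ N1 ∧ b ∈ Q2) - F.kk (fun a b => a ∈ P1 ∧ b ∈ Q2) + F.kk (fun a b => a ∈ Q1 ∧ b ∈ Q2), ?_⟩
  intro σ hσ
  have h1 := main σ hσ
  rw [F.exc_cnt _ _ (exc_of_tight N1 Q2 (zz N1 sN)) hσ, F.exc_cnt _ _ (exc_of_tight P1 Q2 (zz P1 sP)) hσ,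
    F.exc_cnt _ _ (exc_of_tight Q1 Q2 (zz Q1 (Subset.refl _))) hσ, hcard] at h1
  linarith

end PFace


namespace PFace
variable {V : Type} [Fintype V] {K : PMSys V}

def Bad (F : PFace K) (φ : (V → V) → ℤ) (B : Finset V) : Prop :=
  NTr B ∧ (∀ σ ∈ F.P, cr B σ = 1) ∧ ¬ ∃ k : ℚ, ∀ σ ∈ K.M, (cr B σ : ℚ) - 1 = k * φ σ

def Rep (F : PFace K) (φ : (V → V) → ℤ) (l : Finset V → ℕ) : Prop :=
  (∃ U, l U ≠ 0) ∧ (∀ U, l U ≠ 0 → Bad F φ U) ∧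
    ∃ D : ℚ, ∀ σ ∈ K.M, ∑ U, (l U : ℚ) * ((cr U σ : ℚ) - 1) = D * φ σ

structure Phi (F : PFace K) (φ : (V → V) → ℤ) : Prop where
  lin : ∃ f : V → V → ℚ, ∀ σ ∈ K.M, (φ σ : ℚ) = ∑ v, f v (σ v)
  nn : ∀ σ ∈ K.M, 0 ≤ φ σ
  z : ∀ σ ∈ K.M, φ σ = 0 ↔ σ ∈ F.P
  x : ∃ t : ℚ, ∀ σ ∈ K.M, (F.xe σ : ℚ) = t * φ σ

theorem edge_sum (F : PFace K) (m : V → V → ℚ) (hm : ∀ σ ∈ F.P, ∀ v, m v (σ v) = 0)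
    {σ : V → V} (hσ : σ ∈ K.M) : ∑ v, m v (σ v) = (m F.e1 F.e2 + m F.e2 F.e1) * F.xe σ := by
  have hpm := K.pm σ hσ
  have hz : ∀ v, ¬ F.exc v (σ v) → m v (σ v) = 0 := by
    intro v hv
    obtain ⟨τ, hτ, e⟩ := F.cover σ hσ v hv
    rw [← e]; exact hm τ hτ v
  by_cases hx : F.fl ∧ σ F.e1 = F.e2
  · have h2 : σ F.e2 = F.e1 := by rw [← hx.2, hpm.1]
    have hne : F.e1 ≠ F.e2 := by
      intro h; exact hpm.2 F.e1 (by rw [hx.2, ← h])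
    rw [← Finset.sum_subset (subset_univ ({F.e1, F.e2} : Finset V)), Finset.sum_pair hne, hx.2, h2]
    · unfold xe; rw [if_pos hx]; simp
    · intro v _ hv
      apply hz
      rintro ⟨_, h | h⟩
      · exact hv (by rw [h.1]; simp)
      · exact hv (by rw [h.1]; simp)
  · rw [Finset.sum_eq_zero]
    · unfold xe; rw [if_neg hx]; simp
    · intro v _
      apply hz
      rintro ⟨hf, ⟨h1, h2⟩ | ⟨h1, h2⟩⟩
      · exact hx ⟨hf, h1 ▸ h2⟩
      · exact hx ⟨hf, by rw [← h2, hpm.1, h1]⟩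

theorem cr_lin (B : Finset V) (F : PFace K) {σ : V → V} :
    ∑ v, ((if v ∈ B ∧ σ v ∉ B then (1 : ℚ) else 0) - 1 / (Fintype.card V : ℚ)) = cr B σ - 1 := by
  rw [Finset.sum_sub_distrib, sum_ind, Finset.sum_const, Finset.card_univ, nsmul_eq_mul]
  have := F.n6
  have : (Fintype.card V : ℚ) ≠ 0 := by
    have : Fintype.card V ≠ 0 := by omega
    exact_mod_cast this
  field_simp

theorem exists_rep {F : PFace K} {φ : (V → V) → ℤ} (hφ : Phi F φ) {B : Finset V} (hB : Bad F φ B) :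
    ∃ l, Rep F φ l := by
  obtain ⟨f, hf⟩ := hφ.lin
  obtain ⟨t, ht⟩ := hφ.x
  have hid : ∀ σ ∈ K.M, ∑ v, ((Fintype.card V : ℚ) * f v (σ v) - ((if v ∈ B ∧ σ v ∉ B then (1 : ℚ) else 0) - 1 / (Fintype.card V : ℚ))) = (Fintype.card V : ℚ) * φ σ - (cr B σ - 1) := by
    intro σ hσ
    rw [Finset.sum_sub_distrib, cr_lin B F, ← Finset.mul_sum, hf σ hσ]
  obtain ⟨μ, l, hμ, hl, hlN, hE⟩ := K.f4 (fun v w => (Fintype.card V : ℚ) * f v w - ((if v ∈ B ∧ w ∉ B then (1 : ℚ) else 0) - 1 / (Fintype.card V : ℚ))) (by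
    intro σ hσ
    rw [hid σ hσ]
    rcases eq_or_lt_of_le (hφ.nn σ hσ) with h | h
    · have := hB.2.1 σ ((hφ.z σ hσ).1 h.symm)
      rw [← h, this]; norm_num
    · have h1 : cr B σ ≤ Fintype.card V := by
        have e := cr_card (σ := σ) B
        have := cnt_nonneg σ B B
        have := card_le_univ B
        omega
      have h2 : (Fintype.card V : ℤ) * 1 ≤ Fintype.card V * φ σ := by
        apply mul_le_mul_of_nonneg_left (by omega) (by positivity)
      have h3 : (0 : ℤ) ≤ Fintype.card V * φ σ - (cr B σ - 1) := by omega
      exact_mod_cast h3)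
  have hE' : ∀ σ ∈ K.M, (Fintype.card V : ℚ) * φ σ - (cr B σ - 1) = ∑ v, μ v (σ v) + ∑ U, l U * ((cr U σ : ℚ) - 1) := fun σ hσ => by
    rw [← hE σ hσ, ← hid σ hσ]
  have sn : ∀ σ ∈ K.M, ∀ U, 0 ≤ l U * ((cr U σ : ℚ) - 1) := by
    intro σ hσ U
    by_cases h : l U = 0
    · rw [h]; simp
    · apply mul_nonneg (hl U)
      have := s_nonneg hσ (hlN U h).1
      exact_mod_cast this
  have hP : ∀ σ ∈ F.P, (∀ v, μ v (σ v) = 0) ∧ ∀ U, l U * ((cr U σ : ℚ) - 1) = 0 := by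
    intro σ hσ
    have e := hE' σ (F.sub σ hσ)
    rw [(hφ.z σ (F.sub σ hσ)).2 hσ, hB.2.1 σ hσ] at e
    have h1 : 0 ≤ ∑ v, μ v (σ v) := Finset.sum_nonneg (fun v _ => hμ _ _)
    have h2 : 0 ≤ ∑ U, l U * ((cr U σ : ℚ) - 1) := Finset.sum_nonneg (fun U _ => sn σ (F.sub σ hσ) U)
    norm_num at e
    have h3 : ∑ v, μ v (σ v) = 0 := by linarith
    have h4 : ∑ U, l U * ((cr U σ : ℚ) - 1) = 0 := by linarith
    rw [Finset.sum_eq_zero_iff_of_nonneg (fun v _ => hμ _ _)] at h3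
    rw [Finset.sum_eq_zero_iff_of_nonneg (fun U _ => sn σ (F.sub σ hσ) U)] at h4
    exact ⟨fun v => h3 v (mem_univ _), fun U => h4 U (mem_univ _)⟩
  have tightU : ∀ U, l U ≠ 0 → ∀ σ ∈ F.P, cr U σ = 1 := by
    intro U hU σ hσ
    have := ((hP σ hσ).2 U)
    rcases mul_eq_zero.1 this with h | h
    · exact absurd h hU
    · have : (cr U σ : ℚ) = 1 := by linarith
      exact_mod_cast this
  have nb : ∀ U, l U ≠ 0 → ¬ Bad F φ U → ∃ k : ℚ, ∀ σ ∈ K.M, (cr U σ : ℚ) - 1 = k * φ σ := by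
    intro U hU hb
    by_contra hc
    exact hb ⟨hlN U hU, tightU U hU, hc⟩
  have nb' : ∀ U, ∃ k : ℚ, ∀ σ ∈ K.M, ¬ Bad F φ U → l U * ((cr U σ : ℚ) - 1) = k * φ σ := by
    intro U
    by_cases hU : l U = 0
    · exact ⟨0, fun σ _ _ => by rw [hU]; simp⟩
    by_cases hb : Bad F φ U
    · exact ⟨0, fun σ _ h => absurd hb h⟩
    · obtain ⟨k, hk⟩ := nb U hU hb
      exact ⟨l U * k, fun σ hσ _ => by rw [hk σ hσ]; ring⟩
  choose k hk using nb'
  let c : Finset V → ℚ := fun U => (if Bad F φ U then l U else 0) + if U = B then 1 else 0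
  have hc0 : ∀ U, 0 ≤ c U := by
    intro U
    have := hl U
    simp only [c]; split_ifs <;> linarith
  have hcB : ∀ U, c U ≠ 0 → Bad F φ U := by
    intro U hU
    by_contra hb
    apply hU
    simp only [c]; have : U ≠ B := by rintro rfl; exact hb hB
    rw [if_neg hb, if_neg this]; simp
  have hcne : c B ≠ 0 := by
    have := hl B
    simp only [c]; simp only [if_pos hB, if_true]; intro h; linarith
  have hcid : ∀ σ ∈ K.M, ∑ U, c U * ((cr U σ : ℚ) - 1) =
      ((Fintype.card V : ℚ) - (μ F.e1 F.e2 + μ F.e2 F.e1) * t - ∑ U, if Bad F φ U then 0 else k U) * φ σ := by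
    intro σ hσ
    have e := hE' σ hσ
    rw [edge_sum F μ (fun τ hτ => (hP τ hτ).1) hσ, ht σ hσ] at e
    have e2 : ∑ U, l U * ((cr U σ : ℚ) - 1) = ∑ U, (if Bad F φ U then l U else 0) * ((cr U σ : ℚ) - 1) + ∑ U, (if Bad F φ U then 0 else k U) * φ σ := by
      rw [← Finset.sum_add_distrib]
      apply Finset.sum_congr rfl
      intro U _
      by_cases hb : Bad F φ U
      · simp [hb]
      · simp only [hb, if_false]; rw [hk U σ hσ hb]; ring
    have e3 : ∑ U, c U * ((cr U σ : ℚ) - 1) = ∑ U, (if Bad F φ U then l U else 0) * ((cr U σ : ℚ) - 1) + (cr B σ - 1) := by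
      simp only [c, add_mul, Finset.sum_add_distrib, ite_mul, one_mul, zero_mul, Finset.sum_ite_eq', mem_univ, if_true]
    rw [e3, sub_mul, Finset.sum_mul]
    rw [e2] at e
    linarith
  -- scale
  let N : ℕ := ∏ U, (c U).den
  have hN : ∀ U, ∃ m : ℕ, (m : ℚ) = c U * N := by
    intro U
    have hd : (c U).den ∣ N := Finset.dvd_prod_of_mem _ (mem_univ U)
    obtain ⟨q, hq⟩ := hd
    refine ⟨(c U).num.toNat * q, ?_⟩
    have h1 : ((c U).num.toNat : ℤ) = (c U).num := Int.toNat_of_nonneg (Rat.num_nonneg.2 (hc0 U))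
    have h2 : ((c U).num.toNat : ℚ) = (c U).num := by exact_mod_cast congrArg (Int.cast : ℤ → ℚ) h1
    rw [hq]; push_cast; rw [h2, ← mul_assoc, Rat.mul_den_eq_num]
  have hNne : (N : ℚ) ≠ 0 := by
    have : N ≠ 0 := Finset.prod_ne_zero_iff.2 (fun U _ => (c U).den_nz)
    exact_mod_cast this
  choose m hm using hN
  have mz : ∀ U, m U ≠ 0 ↔ c U ≠ 0 := by
    intro U
    have : (m U : ℚ) ≠ 0 ↔ c U ≠ 0 := by rw [hm U]; simp [hNne]
    rw [← this]; norm_num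
  refine ⟨m, ⟨B, (mz B).2 hcne⟩, fun U hU => hcB U ((mz U).1 hU), ?_⟩
  refine ⟨N * ((Fintype.card V : ℚ) - (μ F.e1 F.e2 + μ F.e2 F.e1) * t - ∑ U, if Bad F φ U then 0 else k U), ?_⟩
  intro σ hσ
  rw [mul_assoc, ← hcid σ hσ, Finset.mul_sum]
  apply Finset.sum_congr rfl
  intro U _
  rw [hm U]; ring

/-- total weight -/
noncomputable def wt (w : Finset V → ℕ) (l : Finset V → ℕ) : ℕ := ∑ U, l U * w U

def MinRep (F : PFace K) (φ : (V → V) → ℤ) (w : Finset V → ℕ) (l : Finset V → ℕ) : Prop :=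
  Rep F φ l ∧ ∀ l', Rep F φ l' → wt w l ≤ wt w l'

theorem exists_minRep {F : PFace K} {φ : (V → V) → ℤ} (hφ : Phi F φ) {B : Finset V} (hB : Bad F φ B)
    (w : Finset V → ℕ) : ∃ l, MinRep F φ w l := by
  obtain ⟨l0, h0⟩ := exists_rep hφ hB
  have hex : ∃ n, ∃ l, Rep F φ l ∧ wt w l = n := ⟨_, l0, h0, rfl⟩
  obtain ⟨l, hl, e⟩ := Nat.find_spec hex
  refine ⟨l, hl, fun l' hl' => ?_⟩
  rw [e]; exact Nat.find_min' hex ⟨l', hl', rfl⟩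

theorem exchange {F : PFace K} {φ : (V → V) → ℤ} {w l : Finset V → ℕ} (hm : MinRep F φ w l)
    (α β : Finset V → ℕ) (hα : ∀ U, α U ≤ l U) (hw : wt w β < wt w α) (hβ : ∃ U, β U ≠ 0)
    (hβb : ∀ U, β U ≠ 0 → Bad F φ U) (k : ℚ)
    (hid : ∀ σ ∈ K.M, ∑ U, (α U : ℚ) * ((cr U σ : ℚ) - 1) = ∑ U, (β U : ℚ) * ((cr U σ : ℚ) - 1) + k * φ σ) :
    False := by
  obtain ⟨⟨_, hlb, D, hD⟩, hmin⟩ := hm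
  have := hmin (fun U => l U - α U + β U) ⟨?_, ?_, D - k, ?_⟩
  · have e : wt w l = wt w (fun U => l U - α U) + wt w α := by
      unfold wt; rw [← Finset.sum_add_distrib]; apply Finset.sum_congr rfl; intro U _
      rw [← add_mul, Nat.sub_add_cancel (hα U)]
    have e2 : wt w (fun U => l U - α U + β U) = wt w (fun U => l U - α U) + wt w β := by
      unfold wt; rw [← Finset.sum_add_distrib]; apply Finset.sum_congr rfl; intro U _
      rw [← add_mul]
    omega
  · obtain ⟨U, hU⟩ := hβ
    exact ⟨U, by simp only; omega⟩
  · intro U hU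
    simp only at hU
    by_cases h : β U = 0
    · apply hlb; omega
    · exact hβb U h
  · intro σ hσ
    have e : ∑ U, ((l U - α U + β U : ℕ) : ℚ) * ((cr U σ : ℚ) - 1) = ∑ U, (l U : ℚ) * ((cr U σ : ℚ) - 1) - ∑ U, (α U : ℚ) * ((cr U σ : ℚ) - 1) + ∑ U, (β U : ℚ) * ((cr U σ : ℚ) - 1) := by
      rw [← Finset.sum_sub_distrib, ← Finset.sum_add_distrib]
      apply Finset.sum_congr rfl; intro U _
      rw [Nat.cast_add, Nat.cast_sub (hα U)]; ring
    rw [e, hD σ hσ, hid σ hσ]; ring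

end PFace


theorem uncross_id {V : Type} [Fintype V] {σ : V → V} (h : IsPM σ) (A B : Finset V) :
    cr A σ + cr B σ = cr (A ∩ B) σ + cr (A ∪ B) σ + 2 * cnt σ (A \ B) (B \ A) := by
  have e := cnt_comm h (A \ B) (B \ A)
  have key : ∀ X Y : Finset V, (cnt σ X Y : ℤ) = ∑ v, if v ∈ X ∧ σ v ∈ Y then 1 else 0 := by
    intro X Y
    rw [PFace.cnt_eq_filter, Finset.card_filter]; push_cast; rfl
  have : cr A σ + cr B σ = cr (A ∩ B) σ + cr (A ∪ B) σ + (cnt σ (A \ B) (B \ A) + cnt σ (B \ A) (A \ B)) := by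
    unfold cr
    rw [key, key, key, key, key, key]
    simp only [← Finset.sum_add_distrib]
    apply Finset.sum_congr rfl
    intro v _
    simp only [mem_inter, mem_union, mem_sdiff, mem_compl]
    by_cases h1 : v ∈ A <;> by_cases h2 : v ∈ B <;> by_cases h3 : σ v ∈ A <;> by_cases h4 : σ v ∈ B <;> simp [h1, h2, h3, h4]
  rw [this, ← e]; ring

theorem w_uncross {V : Type} [Fintype V] {A B : Finset V} (h : Cross A B) :
    (A ∩ B).card * ((A ∩ B)ᶜ).card + (A ∪ B).card * ((A ∪ B)ᶜ).card < A.card * (Aᶜ).card + B.card * (Bᶜ).card := by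
  obtain ⟨-, ⟨b, b1, b2⟩, ⟨c, c1, c2⟩, -⟩ := h
  have h1 := Finset.card_inter_add_card_union A B
  have h2 := Finset.card_compl_add_card (A ∩ B)
  have h3 := Finset.card_compl_add_card (A ∪ B)
  have h4 := Finset.card_compl_add_card A
  have h5 := Finset.card_compl_add_card B
  have h6 : (A ∩ B).card < A.card := Finset.card_lt_card ⟨inter_subset_left, fun h => b2 (mem_inter.1 (h b1)).2⟩
  have h7 : (A ∩ B).card < B.card := Finset.card_lt_card ⟨inter_subset_right, fun h => c1 (mem_inter.1 (h c2)).1⟩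
  zify at *
  have e2 : (((A ∩ B)ᶜ).card : ℤ) = Fintype.card V - (A ∩ B).card := by linarith
  have e3 : (((A ∪ B)ᶜ).card : ℤ) = Fintype.card V - (A ∪ B).card := by linarith
  have e4 : ((Aᶜ).card : ℤ) = Fintype.card V - A.card := by linarith
  have e5 : ((Bᶜ).card : ℤ) = Fintype.card V - B.card := by linarith
  have e6 : ((A ∪ B).card : ℤ) = A.card + B.card - (A ∩ B).card := by linarith
  rw [e2, e3, e4, e5, e6]
  nlinarith [mul_pos (sub_pos.2 h6) (sub_pos.2 h7)]

namespace PFace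
variable {V : Type} [Fintype V] {K : PMSys V}

theorem odd_cases (F : PFace K) {U : Finset V} (hU : Odd U.card) :
    NTr U ∨ ∀ σ ∈ K.M, cr U σ = 1 := by
  have hev := F_even F
  have h1 := Finset.card_compl_add_card U
  have hn := F.n6
  by_cases h : U.card = 1
  · right
    obtain ⟨a, rfl⟩ := Finset.card_eq_one.1 h
    intro σ hσ; exact cr_singleton (K.pm σ hσ) a
  by_cases h' : (Uᶜ).card = 1
  · right
    obtain ⟨a, ha⟩ := Finset.card_eq_one.1 h'
    intro σ hσ
    rw [← cr_compl (K.pm σ hσ), ha]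
    exact cr_singleton (K.pm σ hσ) a
  · left
    refine ⟨hU, ?_, ?_⟩ <;> grind

theorem uncross_pack (F : PFace K) {A B : Finset V} (hA : Odd A.card) (hB : Odd B.card)
    (tA : ∀ σ ∈ F.P, cr A σ = 1) (tB : ∀ σ ∈ F.P, cr B σ = 1) (hodd : Odd (A ∩ B).card) :
    Odd (A ∪ B).card ∧ (∀ σ ∈ F.P, cr (A ∩ B) σ = 1) ∧ (∀ σ ∈ F.P, cr (A ∪ B) σ = 1) ∧
    (∀ σ ∈ F.P, cnt σ (A \ B) (B \ A) = 0) ∧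
    ∀ σ ∈ K.M, (cr A σ - 1) + (cr B σ - 1) = (cr (A ∩ B) σ - 1) + (cr (A ∪ B) σ - 1) +
      2 * (F.kk (fun a b => a ∈ A \ B ∧ b ∈ B \ A) * F.xe σ) := by
  have hun : Odd (A ∪ B).card := by
    have := Finset.card_inter_add_card_union A B
    grind
  have h0 : ∀ σ ∈ F.P, cr (A ∩ B) σ = 1 ∧ cr (A ∪ B) σ = 1 ∧ cnt σ (A \ B) (B \ A) = 0 := by
    intro σ hσ
    have e := uncross_id (K.pm σ (F.sub σ hσ)) A B
    rw [tA σ hσ, tB σ hσ] at e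
    have := one_le_cr (K.pm σ (F.sub σ hσ)) hodd
    have := one_le_cr (K.pm σ (F.sub σ hσ)) hun
    have := cnt_nonneg σ (A \ B) (B \ A)
    omega
  refine ⟨hun, fun σ hσ => (h0 σ hσ).1, fun σ hσ => (h0 σ hσ).2.1, fun σ hσ => (h0 σ hσ).2.2, ?_⟩
  intro σ hσ
  have e := uncross_id (K.pm σ hσ) A B
  rw [F.exc_cnt _ _ (exc_of_tight _ _ (fun σ hσ => (h0 σ hσ).2.2)) hσ] at e
  linarith

/-- non-bad tight odd sets are proportional -/
theorem prop_of_not_bad {F : PFace K} {φ : (V → V) → ℤ} {U : Finset V} (hU : Odd U.card)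
    (ht : ∀ σ ∈ F.P, cr U σ = 1) (hb : ¬ Bad F φ U) : ∃ k : ℚ, ∀ σ ∈ K.M, (cr U σ : ℚ) - 1 = k * φ σ := by
  rcases odd_cases F hU with h | h
  · by_contra hc; exact hb ⟨h, ht, hc⟩
  · exact ⟨0, fun σ hσ => by rw [h σ hσ]; simp⟩

theorem bad_compl {F : PFace K} {φ : (V → V) → ℤ} {U : Finset V} (h : Bad F φ U) : Bad F φ Uᶜ := by
  obtain ⟨σ0, h0⟩ := F.ne
  refine ⟨NTr_compl (K.pm σ0 (F.sub σ0 h0)) h.1, ?_, ?_⟩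
  · intro σ hσ; rw [cr_compl (K.pm σ (F.sub σ hσ))]; exact h.2.1 σ hσ
  · rintro ⟨k, hk⟩
    apply h.2.2
    exact ⟨k, fun σ hσ => by rw [← hk σ hσ, cr_compl (K.pm σ hσ)]⟩

theorem wt_single (w : Finset V → ℕ) (A : Finset V) : wt w (fun U => if U = A then 1 else 0) = w A := by
  unfold wt; simp

theorem wt_add (w f g : Finset V → ℕ) : wt w (fun U => f U + g U) = wt w f + wt w g := by
  unfold wt; rw [← Finset.sum_add_distrib]; apply Finset.sum_congr rfl; intros; ring

theorem s_single (A : Finset V) (σ : V → V) :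
   ∑ U, ((if U = A then 1 else 0 : ℕ) : ℚ) * ((cr U σ : ℚ) - 1) = cr A σ - 1 := by
  simp

theorem s_add (f g : Finset V → ℕ) (σ : V → V) :
   ∑ U, ((f U + g U : ℕ) : ℚ) * ((cr U σ : ℚ) - 1) = ∑ U, (f U : ℚ) * ((cr U σ : ℚ) - 1) + ∑ U, (g U : ℚ) * ((cr U σ : ℚ) - 1) := by
  rw [← Finset.sum_add_distrib]; apply Finset.sum_congr rfl; intros; push_cast; ring

/-- removing `α` and adding the bad ones among `C`, `D` -/
theorem exchange2 {F : PFace K} {φ : (V → V) → ℤ} {w l : Finset V → ℕ} (hm : MinRep F φ w l)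
    (α : Finset V → ℕ) (hα : ∀ U, α U ≤ l U) {C D : Finset V} (hw : w C + w D < wt w α)
    (hC : Odd C.card) (hD : Odd D.card) (tC : ∀ σ ∈ F.P, cr C σ = 1) (tD : ∀ σ ∈ F.P, cr D σ = 1) (k : ℚ)
    (hid : ∀ σ ∈ K.M, ∑ U, (α U : ℚ) * ((cr U σ : ℚ) - 1) = (cr C σ - 1) + (cr D σ - 1) + k * φ σ) :
    ¬ Bad F φ C ∧ ¬ Bad F φ D := by
  have one : ∀ C, Odd C.card → (∀ σ ∈ F.P, cr C σ = 1) → ∃ (β : Finset V → ℕ) (j : ℚ), (∀ U, β U ≠ 0 → Bad F φ U) ∧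
      (Bad F φ C → β C ≠ 0) ∧ wt w β ≤ w C ∧ ∀ σ ∈ K.M, (cr C σ : ℚ) - 1 = ∑ U, (β U : ℚ) * ((cr U σ : ℚ) - 1) + j * φ σ := by
    intro C hC tC
    by_cases hb : Bad F φ C
    · refine ⟨fun U => if U = C then 1 else 0, 0, ?_, ?_, ?_, ?_⟩
      · intro U hU
        by_cases h : U = C
        · rw [h]; exact hb
        · simp [h] at hU
      · intro _; simp
      · rw [wt_single]
      · intro σ _; rw [s_single]; ring
    · obtain ⟨j, hj⟩ := prop_of_not_bad hC tC hb
      refine ⟨fun U => 0, j, ?_, ?_, ?_, ?_⟩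
      · intro U hU; exact absurd rfl hU
      · intro h; exact absurd h hb
      · unfold wt; simp
      · intro σ hσ; rw [hj σ hσ]; simp
  obtain ⟨β1, j1, a1, b1, c1, d1⟩ := one C hC tC
  obtain ⟨β2, j2, a2, b2, c2, d2⟩ := one D hD tD
  by_contra hc
  refine exchange hm α (fun U => β1 U + β2 U) hα ?_ ?_ ?_ (j1 + j2 + k) ?_
  · rw [wt_add]; omega
  · by_cases h : Bad F φ C
    · exact ⟨C, by have := b1 h; omega⟩
    · have : Bad F φ D := by tauto
      exact ⟨D, by have := b2 this; omega⟩
  · intro U hU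
    by_cases h : β1 U = 0
    · apply a2; omega
    · exact a1 U h
  · intro σ hσ
    rw [hid σ hσ, s_add, d1 σ hσ, d2 σ hσ]; ring

/-- uncrossing in a minimal representation -/
theorem uncross_min {F : PFace K} {φ : (V → V) → ℤ} (hφ : Phi F φ) {w l : Finset V → ℕ} (hm : MinRep F φ w l)
    (hwc : ∀ U, w Uᶜ = w U)
    (hw : ∀ A B, l A ≠ 0 → l B ≠ 0 ∨ l Bᶜ ≠ 0 → Cross A B → w (A ∩ B) + w (A ∪ B) < w A + w B) {A B : Finset V}
    (hA : l A ≠ 0) (hB : l B ≠ 0) (hc : Cross A B) :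
    ∃ B', Bad F φ A ∧ Bad F φ B' ∧ Cross A B' ∧ Odd (A ∩ B').card ∧ ¬ Bad F φ (A ∩ B') ∧ ¬ Bad F φ (A ∪ B') ∧ (B' = B ∨ B' = Bᶜ) := by
  have bA := hm.1.2.1 A hA
  have bB := hm.1.2.1 B hB
  obtain ⟨t, ht⟩ := hφ.x
  have hAB : A ≠ B := by
    rintro rfl
    obtain ⟨-, ⟨b, b1, b2⟩, -⟩ := hc
    exact b2 b1
  have main : ∀ B', (B' = B ∨ B' = Bᶜ) → Odd (A ∩ B').card → ∃ B', Bad F φ A ∧ Bad F φ B' ∧ Cross A B' ∧ Odd (A ∩ B').card ∧ ¬ Bad F φ (A ∩ B') ∧ ¬ Bad F φ (A ∪ B') ∧ (B' = B ∨ B' = Bᶜ) := by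
    intro B' hB' hodd
    have hcr : ∀ σ ∈ K.M, cr B' σ = cr B σ := by
      rcases hB' with rfl | rfl
      · intro σ _; rfl
      · intro σ hσ; rw [cr_compl (K.pm σ hσ)]
    have hbad : Bad F φ B' := by
      rcases hB' with rfl | rfl
      · exact bB
      · exact bad_compl bB
    have hcross : Cross A B' := by
      rcases hB' with rfl | rfl
      · exact hc
      · exact cross_compl_right.2 hc
    have hwB : w B' = w B := by
      rcases hB' with rfl | rfl
      · rfl
      · exact hwc B
    have hlB : l B' ≠ 0 ∨ l B'ᶜ ≠ 0 := by
      rcases hB' with rfl | rfl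
      · exact Or.inl hB
      · rw [compl_compl]; exact Or.inr hB
    obtain ⟨p1, p2, p3, p4, p5⟩ := uncross_pack F bA.1.1 hbad.1.1 bA.2.1 hbad.2.1 hodd
    have := exchange2 hm (fun U => (if U = A then 1 else 0) + (if U = B then 1 else 0)) (by
        intro U
        by_cases h1 : U = A
        · subst h1; rw [if_pos rfl, if_neg hAB]; omega
        · by_cases h2 : U = B
          · subst h2; rw [if_pos rfl, if_neg h1]; omega
          · rw [if_neg h1, if_neg h2]; omega) (C := A ∩ B') (D := A ∪ B') (by
        rw [wt_add, wt_single, wt_single, ← hwB]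
        exact hw A B' hA hlB hcross) hodd p1 p2 p3 (2 * F.kk (fun a b => a ∈ A \ B' ∧ b ∈ B' \ A) * t) (by
        intro σ hσ
        rw [s_add, s_single, s_single]
        have e := p5 σ hσ
        rw [hcr σ hσ] at e
        have e' : ((cr A σ : ℚ) - 1) + (cr B σ - 1) = (cr (A ∩ B') σ - 1) + (cr (A ∪ B') σ - 1) +
          2 * (F.kk (fun a b => a ∈ A \ B' ∧ b ∈ B' \ A) * F.xe σ) := by exact_mod_cast e
        rw [e', ht σ hσ]; ring)
    exact ⟨B', bA, hbad, hcross, hodd, this.1, this.2, hB'⟩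
  by_cases hodd : Odd (A ∩ B).card
  · exact main B (Or.inl rfl) hodd
  · refine main Bᶜ (Or.inr rfl) ?_
    have h1 : (A ∩ Bᶜ).card + (A ∩ B).card = A.card := by
      rw [← sdiff_eq_inter_compl, Finset.card_sdiff_add_card_inter]
    have := bA.1.1
    grind

end PFace


namespace PFace
variable {V : Type} [Fintype V] {K : PMSys V}

theorem phi_xe (F : PFace K) (hfl : F.fl) (hP : ∀ σ, σ ∈ F.P ↔ σ ∈ K.M ∧ σ F.e1 ≠ F.e2) : Phi F F.xe := by
  refine ⟨⟨fun v w => if v = F.e1 ∧ w = F.e2 then 1 else 0, ?_⟩, fun σ _ => F.xe_nonneg σ, ?_, 1, ?_⟩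
  · intro σ hσ
    have : ∀ v, (if v = F.e1 ∧ σ v = F.e2 then (1 : ℚ) else 0) = if v = F.e1 then (if σ F.e1 = F.e2 then 1 else 0) else 0 := by
      intro v
      by_cases h : v = F.e1
      · subst h; simp
      · simp [h]
    simp only [this]
    rw [Finset.sum_ite_eq' univ F.e1, if_pos (mem_univ _)]
    unfold xe
    by_cases h : σ F.e1 = F.e2 <;> simp [h, hfl]
  · intro σ hσ
    rw [hP]; unfold xe
    by_cases h : σ F.e1 = F.e2 <;> simp [h, hfl, hσ]
  · intro σ _; simp

theorem single_nonneg (U : Finset V) : ∀ A, (0 : ℚ) ≤ (if A = U then 1 else 0) := by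
  intro A; split_ifs <;> norm_num

/-- decomposition gives step one -/
theorem dec1 (F : PFace K) {A B : Finset V} (hA : NTr A) (hB : NTr B)
    (h : ∀ σ ∈ K.M, (cr A σ - 1) + (cr B σ - 1) ≤ 2 * F.xe σ) :
    ∃ W, NTr W ∧ (∀ σ ∈ K.M, cr W σ ≤ 5) ∧ (∀ σ ∈ F.P, cr W σ = 1) ∧ ∃ σ ∈ K.M, σ F.e1 = F.e2 ∧ cr W σ = 1 := by
  have hx : ∀ σ, F.xe σ = 1 ∧ σ F.e1 = F.e2 ∨ F.xe σ = 0 := by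
    intro σ; unfold xe; split_ifs with q
    · exact Or.inl ⟨rfl, q.2⟩
    · exact Or.inr rfl
  refine ⟨A, hA, ?_, ?_, ?_⟩
  · intro σ hσ
    have := h σ hσ
    have := s_nonneg hσ hB.1
    rcases hx σ with q | q <;> omega
  · intro σ hσ
    have := h σ (F.sub σ hσ)
    have := s_nonneg (F.sub σ hσ) hB.1
    have := s_nonneg (F.sub σ hσ) hA.1
    have := F.xe_P hσ
    omega
  · obtain ⟨σ, hσ, hc⟩ := K.f2 B hB
    have := h σ hσ
    have := s_nonneg hσ hB.1
    have := s_nonneg hσ hA.1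
    obtain ⟨j, hj⟩ := cr_odd (K.pm σ hσ) hB.1
    rcases hx σ with ⟨q, q'⟩ | q
    · exact ⟨σ, hσ, q', by omega⟩
    · omega

theorem step1 (F : PFace K) (hfl : F.fl) (hP : ∀ σ, σ ∈ F.P ↔ σ ∈ K.M ∧ σ F.e1 ≠ F.e2)
    {σ1 : V → V} (h1 : σ1 ∈ K.M) (h1' : σ1 F.e1 = F.e2) {B : Finset V} (hB : Bad F F.xe B) :
    ∃ W, NTr W ∧ (∀ σ ∈ K.M, cr W σ ≤ 5) ∧ (∀ σ ∈ F.P, cr W σ = 1) ∧ ∃ σ ∈ K.M, σ F.e1 = F.e2 ∧ cr W σ = 1 := by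
  have hφ := phi_xe F hfl hP
  have hx1 : F.xe σ1 = 1 := by unfold xe; rw [if_pos ⟨hfl, h1'⟩]
  obtain ⟨l, hm⟩ := exists_minRep hφ hB (fun U => U.card * (Uᶜ).card)
  obtain ⟨D, hD⟩ := hm.1.2.2
  by_cases hcf : ∀ A B, (l A : ℚ) ≠ 0 → (l B : ℚ) ≠ 0 → ¬ Cross A B
  · have nz : ∀ A, (l A : ℚ) ≠ 0 → l A ≠ 0 := fun A h h' => h (by rw [h']; simp)
    rcases cf1' (F := F) (c := fun U => (l U : ℚ)) (D := D) (fun U => by positivity)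
      (by obtain ⟨U, hU⟩ := hm.1.1; exact ⟨U, by exact_mod_cast hU⟩)
      (fun U hU => (hm.1.2.1 U (nz U hU)).1) (fun U hU => (hm.1.2.1 U (nz U hU)).2.1) hcf hD with ⟨A, B, a, b, h⟩ | ⟨A, hA, k, hk, h⟩
    · exact dec1 F a b h
    · exfalso
      apply (hm.1.2.1 A (nz A hA)).2.2
      exact ⟨k, fun σ hσ => by exact_mod_cast h σ hσ⟩
  push Not at hcf
  obtain ⟨A, B, hA, hB, hc⟩ := hcf
  obtain ⟨B', bA, bB, cr', odd', nb1, nb2, -⟩ := uncross_min hφ hm (fun U => by simp only [compl_compl]; ring)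
    (fun A B _ _ h => w_uncross h) (by exact_mod_cast hA) (by exact_mod_cast hB) hc
  clear hB hc hA
  obtain ⟨p1, p2, p3, p4, p5⟩ := uncross_pack F bA.1.1 bB.1.1 bA.2.1 bB.2.1 odd'
  by_cases hdec : ∃ A B, NTr A ∧ NTr B ∧ ∀ σ ∈ K.M, (cr A σ - 1) + (cr B σ - 1) ≤ 2 * F.xe σ
  · obtain ⟨A, B, a, b, h⟩ := hdec
    exact dec1 F a b h
  have hsingle : ∀ U : Finset V, Odd U.card → (∀ σ ∈ F.P, cr U σ = 1) → ¬ Bad F F.xe U →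
      ∃ k : ℤ, k ≤ 2 ∧ (k = 2 → NTr U) ∧ ∀ σ ∈ K.M, cr U σ - 1 = k * F.xe σ := by
    intro U hU ht hb
    obtain ⟨k, hk⟩ := prop_of_not_bad hU ht hb
    rcases odd_cases F hU with hN | hN
    · rcases cf1' (F := F) (c := fun A => if A = U then 1 else 0) (D := k) (single_nonneg U) ⟨U, by simp⟩
        (fun A hA => by have : A = U := by by_contra q; simp [q] at hA
                        rw [this]; exact hN)
        (fun A hA => by have : A = U := by by_contra q; simp [q] at hA
                        rw [this]; exact ht)
        (fun A B hA hB => by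
          have e1 : A = U := by by_contra q; simp [q] at hA
          have e2 : B = U := by by_contra q; simp [q] at hB
          rw [e1, e2]
          rintro ⟨-, ⟨b, b1, b2⟩, -⟩
          exact b2 b1)
        (fun σ hσ => by
          simp only [ite_mul, one_mul, zero_mul, Finset.sum_ite_eq', mem_univ, if_true]
          exact hk σ hσ) with h | ⟨A, hA, j, hj, h⟩
      · exact absurd h hdec
      · have e1 : A = U := by by_contra q; simp [q] at hA
        rw [e1] at h
        exact ⟨j, hj, fun _ => hN, h⟩
    · exact ⟨0, by norm_num, fun h => by norm_num at h, fun σ hσ => by rw [hN σ hσ]; ring⟩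
  obtain ⟨k1, k1le, k1N, hk1⟩ := hsingle _ odd' p2 nb1
  obtain ⟨k2, k2le, k2N, hk2⟩ := hsingle _ p1 p3 nb2
  set ε := F.kk (fun a b => a ∈ A \ B' ∧ b ∈ B' \ A) with hε
  have hid : ∀ σ ∈ K.M, (cr A σ - 1) + (cr B' σ - 1) = (k1 + k2 + 2 * ε) * F.xe σ := by
    intro σ hσ
    rw [p5 σ hσ, hk1 σ hσ, hk2 σ hσ]; ring
  have hε1 : ε ≤ 1 ∧ (ε = 1 → (F.e1 ∈ A \ B' ∧ F.e2 ∈ B' \ A) ∨ (F.e1 ∈ B' \ A ∧ F.e2 ∈ A \ B')) := by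
    rw [hε]; unfold kk
    have : ¬ ((F.e1 ∈ A \ B' ∧ F.e2 ∈ B' \ A) ∧ (F.e2 ∈ A \ B' ∧ F.e1 ∈ B' \ A)) := by
      rintro ⟨⟨h, _⟩, ⟨_, h'⟩⟩
      exact (mem_sdiff.1 h).2 (mem_sdiff.1 h').1
    by_cases q1 : (F.e1 ∈ A \ B' ∧ F.e2 ∈ B' \ A) <;> by_cases q2 : (F.e2 ∈ A \ B' ∧ F.e1 ∈ B' \ A)
    · exact absurd ⟨q1, q2⟩ this
    · rw [if_pos q1, if_neg q2]; exact ⟨by norm_num, fun _ => Or.inl q1⟩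
    · rw [if_neg q1, if_pos q2]; exact ⟨by norm_num, fun _ => Or.inr q2.symm⟩
    · rw [if_neg q1, if_neg q2]; exact ⟨by norm_num, fun h => by norm_num at h⟩
  by_cases hsix : k1 = 2 ∧ k2 = 2 ∧ ε = 1
  · exfalso
    obtain ⟨q1, q2, q3⟩ := hsix
    obtain ⟨σ0, h0⟩ := F.ne
    have hpm0 := K.pm σ0 (F.sub σ0 h0)
    have eA : A ∩ B' ∪ A \ B' = A := by rw [union_comm]; exact sdiff_union_inter A B'
    obtain ⟨k, hk⟩ := pair_lemma (F := F) (U := A ∩ B') (T := (A ∪ B')ᶜ) (Q1 := A \ B') (Q2 := B' \ A)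
      (k1N q1) (NTr_compl hpm0 (k2N q2))
      (by rw [Finset.disjoint_left]; intro v; simp only [mem_inter, mem_compl, mem_union]; tauto)
      (by rw [Finset.disjoint_left]; intro v; simp only [mem_sdiff]; tauto)
      (by rw [Finset.disjoint_left]; intro v; simp only [mem_inter, mem_sdiff]; tauto)
      (by rw [Finset.disjoint_left]; intro v; simp only [mem_sdiff, mem_compl, mem_union]; tauto)
      (by rw [Finset.disjoint_left]; intro v; simp only [mem_inter, mem_sdiff]; tauto)
      (by rw [Finset.disjoint_left]; intro v; simp only [mem_sdiff, mem_compl, mem_union]; tauto)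
      (by intro v; simp only [mem_sdiff, mem_compl, mem_union, mem_inter]; tauto)
      p2 (fun σ hσ => by rw [cr_compl (K.pm σ (F.sub σ hσ))]; exact p3 σ hσ)
      (by rw [eA]; exact bA.2.1)
      (fun σ hσ => by
        rw [cr_compl (K.pm σ hσ)]
        have e1 := hk1 σ hσ
        have e2 := hk2 σ hσ
        rw [q1] at e1; rw [q2] at e2; omega)
      (fun σ hσ => (cnt_zero_iff _ _ _).1 (p4 σ hσ))
      (fun _ => hε1.2 q3)
    rw [eA] at hk
    apply bA.2.2
    refine ⟨k1 + k, fun σ hσ => ?_⟩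
    have := hk σ hσ
    rw [hk1 σ hσ] at this
    have h' : ((cr A σ : ℚ) - 1) = k1 * F.xe σ + k * F.xe σ := by exact_mod_cast this
    rw [h']; ring
  · have hx : ∀ σ, F.xe σ = 1 ∧ σ F.e1 = F.e2 ∨ F.xe σ = 0 := by
      intro σ; unfold xe; split_ifs with q
      · exact Or.inl ⟨rfl, q.2⟩
      · exact Or.inr rfl
    have hle : k1 + k2 + 2 * ε ≤ 5 := by
      have := hε1.1
      by_contra q
      apply hsix
      omega
    obtain ⟨s, hs⟩ : ∃ s, s = k1 + k2 + 2 * ε := ⟨_, rfl⟩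
    rw [← hs] at hid hle
    have hval : ∀ σ ∈ K.M, (∃ a b : ℤ, 0 ≤ a ∧ 0 ≤ b ∧ cr A σ = 2 * a + 1 ∧ cr B' σ = 2 * b + 1 ∧ 2 * a + 2 * b = s * F.xe σ) := by
      intro σ hσ
      obtain ⟨a, ha⟩ := cr_odd (K.pm σ hσ) bA.1.1
      obtain ⟨b, hb⟩ := cr_odd (K.pm σ hσ) bB.1.1
      have := cr_nonneg A σ
      have := cr_nonneg B' σ
      have := hid σ hσ
      exact ⟨a, b, by omega, by omega, ha, hb, by omega⟩
    have hb5 : ∀ σ ∈ K.M, cr A σ ≤ 5 ∧ cr B' σ ≤ 5 := by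
      intro σ hσ
      obtain ⟨a, b, a0, b0, ha, hb, e⟩ := hval σ hσ
      rcases hx σ with ⟨q, _⟩ | q
      · rw [q] at e; omega
      · rw [q] at e; omega
    by_cases hzA : ∃ σ ∈ K.M, σ F.e1 = F.e2 ∧ cr A σ = 1
    · exact ⟨A, bA.1, fun σ hσ => (hb5 σ hσ).1, bA.2.1, hzA⟩
    by_cases hzB : ∃ σ ∈ K.M, σ F.e1 = F.e2 ∧ cr B' σ = 1
    · exact ⟨B', bB.1, fun σ hσ => (hb5 σ hσ).2, bB.2.1, hzB⟩
    exfalso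
    push Not at hzA hzB
    apply bA.2.2
    refine ⟨2, fun σ hσ => ?_⟩
    obtain ⟨a, b, a0, b0, ha, hb, e⟩ := hval σ hσ
    rcases hx σ with ⟨q, q'⟩ | q
    · have := hzA σ hσ q'
      have := hzB σ hσ q'
      rw [q] at e ⊢
      have : a = 1 := by omega
      rw [ha, this]; norm_num
    · rw [q] at e ⊢
      have : a = 0 := by omega
      rw [ha, this]; norm_num

end PFace


theorem not_cross_inter {V : Type} {A B W : Finset V} (h1 : ¬ Cross A W) (h2 : ¬ Cross B W) (hc : Cross A B) :
    ¬ Cross (A ∩ B) W := by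
  rintro ⟨⟨a, a1, a2⟩, ⟨b, b1, b2⟩, ⟨c, c1, c2⟩, ⟨d, d1, d2⟩⟩
  rw [mem_inter] at a1 b1 c1 d1
  obtain ⟨-, -, -, ⟨u, u1, u2⟩⟩ := hc
  -- A meets W and its complement, as does B
  have hA : (∀ v, v ∈ W → v ∈ A) ∨ (∀ v, v ∉ W → v ∈ A) := by
    by_contra q
    push Not at q
    obtain ⟨⟨x, x1, x2⟩, ⟨y, y1, y2⟩⟩ := q
    exact h1 ⟨⟨a, a1.1, a2⟩, ⟨b, b1.1, b2⟩, ⟨x, x2, x1⟩, ⟨y, y2, y1⟩⟩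
  have hB : (∀ v, v ∈ W → v ∈ B) ∨ (∀ v, v ∉ W → v ∈ B) := by
    by_contra q
    push Not at q
    obtain ⟨⟨x, x1, x2⟩, ⟨y, y1, y2⟩⟩ := q
    exact h2 ⟨⟨a, a1.2, a2⟩, ⟨b, b1.2, b2⟩, ⟨x, x2, x1⟩, ⟨y, y2, y1⟩⟩
  rcases hA with hA | hA <;> rcases hB with hB | hB
  · exact c1 ⟨hA c c2, hB c c2⟩
  · by_cases q : u ∈ W
    · exact u1 (hA u q)
    · exact u2 (hB u q)
  · by_cases q : u ∈ W
    · exact u2 (hB u q)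
    · exact u1 (hA u q)
  · exact d1 ⟨hA d d2, hB d d2⟩

theorem not_cross_union {V : Type} [Fintype V] {A B W : Finset V} (h1 : ¬ Cross A W) (h2 : ¬ Cross B W) (hc : Cross A B) :
    ¬ Cross (A ∪ B) W := by
  have := not_cross_inter (A := Aᶜ) (B := Bᶜ) (W := W) (by rwa [cross_compl_left]) (by rwa [cross_compl_left])
    (by rw [cross_compl_left, cross_compl_right]; exact hc)
  rwa [← compl_union, cross_compl_left] at this

namespace PFace
variable {V : Type} [Fintype V] {K : PMSys V}

noncomputable def w2 (W U : Finset V) : ℕ := U.card * (Uᶜ).card + if Cross U W then 2 * (Fintype.card V * Fintype.card V) + 1 else 0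

theorem w2_compl (W U : Finset V) : w2 W Uᶜ = w2 W U := by
  unfold w2
  rw [compl_compl, mul_comm]
  congr 2
  rw [cross_compl_left]

theorem w2_lt (W : Finset V) {U : Finset V} (h : ¬ Cross U W) : w2 W U ≤ Fintype.card V * Fintype.card V := by
  unfold w2; rw [if_neg h, add_zero]
  exact Nat.mul_le_mul (card_le_univ _) (card_le_univ _)

theorem phi_s (F : PFace K) (hfl : ¬ F.fl) {W : Finset V} (hW : NTr W) (hP : ∀ σ, σ ∈ F.P ↔ σ ∈ K.M ∧ cr W σ = 1) :
    Phi F (fun σ => cr W σ - 1) := by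
  refine ⟨⟨fun v w => (if v ∈ W ∧ w ∉ W then (1 : ℚ) else 0) - 1 / (Fintype.card V : ℚ), ?_⟩, fun σ hσ => s_nonneg hσ hW.1, ?_, 0, ?_⟩
  · intro σ hσ
    rw [cr_lin W F]; push_cast; rfl
  · intro σ hσ
    rw [hP]
    constructor
    · intro h; exact ⟨hσ, by linarith⟩
    · intro h; rw [h.2]; norm_num
  · intro σ _
    unfold xe; rw [if_neg (fun t => hfl t.1)]; simp

theorem step2 (F : PFace K) (hfl : ¬ F.fl) {W : Finset V} (hW : NTr W)
    (hP : ∀ σ, σ ∈ F.P ↔ σ ∈ K.M ∧ cr W σ = 1) {B : Finset V} (hB : Bad F (fun σ => cr W σ - 1) B) :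
    ∃ A B, NTr A ∧ NTr B ∧ ∀ σ ∈ K.M, (cr A σ - 1) + (cr B σ - 1) ≤ cr W σ - 1 := by
  have hφ := phi_s F hfl hW hP
  have tW : ∀ σ ∈ F.P, cr W σ = 1 := fun σ hσ => ((hP σ).1 hσ).2
  have hxe : ∀ σ, F.xe σ = 0 := fun σ => by unfold xe; rw [if_neg (fun t => hfl t.1)]
  obtain ⟨l, hm⟩ := exists_minRep hφ hB (w2 W)
  obtain ⟨σ0, h0⟩ := F.ne
  have hpm0 := K.pm σ0 (F.sub σ0 h0)
  by_contra hdec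
  -- no member crosses W
  have hncW : ∀ A, l A ≠ 0 → ¬ Cross A W := by
    intro A hA hc
    have bA := hm.1.2.1 A hA
    have main : ∀ W', (∀ σ ∈ K.M, cr W' σ = cr W σ) → Odd W'.card → (∀ U, Cross U W' ↔ Cross U W) → Odd (A ∩ W').card → False := by
      intro W' hcr hWo hWc hodd
      obtain ⟨p1, p2, p3, p4, p5⟩ := uncross_pack F bA.1.1 hWo bA.2.1 (fun σ hσ => by rw [hcr σ (F.sub σ hσ)]; exact tW σ hσ) hodd
      have nc1 : ¬ Cross (A ∩ W') W := by
        rw [← hWc]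
        rintro ⟨-, ⟨b, b1, b2⟩, -⟩
        exact b2 (mem_inter.1 b1).2
      have nc2 : ¬ Cross (A ∪ W') W := by
        rw [← hWc]
        rintro ⟨-, -, ⟨b, b1, b2⟩, -⟩
        exact b1 (mem_union_right _ b2)
      have hq : ∀ σ ∈ K.M, (cr A σ : ℚ) - 1 = (cr (A ∩ W') σ - 1) + (cr (A ∪ W') σ - 1) + (-1) * ((cr W σ - 1 : ℤ) : ℚ) := by
        intro σ hσ
        have e := p5 σ hσ
        rw [hxe, hcr σ hσ] at e
        have e' : ((cr A σ : ℚ) - 1) + (cr W σ - 1) = (cr (A ∩ W') σ - 1) + (cr (A ∪ W') σ - 1) := by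
          have : (cr A σ - 1) + (cr W σ - 1) = (cr (A ∩ W') σ - 1) + (cr (A ∪ W') σ - 1) := by linarith
          exact_mod_cast this
        push_cast; linarith
      have nb := exchange2 hm (fun U => if U = A then 1 else 0) (by
          intro U
          by_cases h1 : U = A
          · subst h1; rw [if_pos rfl]; omega
          · rw [if_neg h1]; omega) (C := A ∩ W') (D := A ∪ W') (by
          rw [wt_single]
          have := w2_lt W nc1
          have := w2_lt W nc2
          unfold w2 at *; rw [if_pos hc]; omega) hodd p1 p2 p3 (-1) (by
          intro σ hσ
          rw [s_single]; exact hq σ hσ)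
      obtain ⟨k1, hk1⟩ := prop_of_not_bad hodd p2 nb.1
      obtain ⟨k2, hk2⟩ := prop_of_not_bad p1 p3 nb.2
      apply bA.2.2
      refine ⟨k1 + k2 - 1, fun σ hσ => ?_⟩
      rw [hq σ hσ, hk1 σ hσ, hk2 σ hσ]; ring
    by_cases hodd : Odd (A ∩ W).card
    · exact main W (fun _ _ => rfl) hW.1 (fun _ => Iff.rfl) hodd
    · refine main Wᶜ (fun σ hσ => cr_compl (K.pm σ hσ) W) (NTr_compl hpm0 hW).1 (fun _ => cross_compl_right) ?_
      have h1 : (A ∩ Wᶜ).card + (A ∩ W).card = A.card := by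
        rw [← sdiff_eq_inter_compl, Finset.card_sdiff_add_card_inter]
      have := bA.1.1
      grind
  obtain ⟨D, hD⟩ := hm.1.2.2
  by_cases hcf : ∀ A B, (l A : ℚ) ≠ 0 → (l B : ℚ) ≠ 0 → ¬ Cross A B
  · have nz : ∀ A, (l A : ℚ) ≠ 0 → l A ≠ 0 := fun A h h' => h (by rw [h']; simp)
    rcases cf2' (F := F) (c := fun U => (l U : ℚ)) (D := D) hfl hW tW (fun U => by positivity)
      (by obtain ⟨U, hU⟩ := hm.1.1; exact ⟨U, by exact_mod_cast hU⟩)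
      (fun U hU => (hm.1.2.1 U (nz U hU)).1) (fun U hU => (hm.1.2.1 U (nz U hU)).2.1) hcf
      (fun A hA => hncW A (nz A hA))
      (fun A hA => by
        have bA := (hm.1.2.1 A (nz A hA)).2.2
        constructor
        · rintro rfl
          exact bA ⟨1, fun σ hσ => by push_cast; ring⟩
        · rintro rfl
          exact bA ⟨1, fun σ hσ => by rw [cr_compl (K.pm σ hσ)]; push_cast; ring⟩)
      (fun σ hσ => by rw [hD σ hσ]; push_cast; ring) with h | ⟨A, hA, h⟩
    · exact hdec h
    · apply (hm.1.2.1 A (nz A hA)).2.2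
      refine ⟨1, fun σ hσ => ?_⟩
      rw [one_mul]; exact_mod_cast h σ hσ
  push Not at hcf
  obtain ⟨A, B, hA, hB, hc⟩ := hcf
  have hA' : l A ≠ 0 := by exact_mod_cast hA
  have hB' : l B ≠ 0 := by exact_mod_cast hB
  obtain ⟨B', bA, bB, cr', odd', nb1, nb2, hBB⟩ := uncross_min hφ hm (w2_compl W)
    (fun A B hA hB h => by
      have n1 := hncW A hA
      have n2 : ¬ Cross B W := by
        rcases hB with hB | hB
        · exact hncW B hB
        · have := hncW _ hB; rwa [cross_compl_left] at this
      have := w_uncross h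
      unfold w2
      rw [if_neg n1, if_neg n2, if_neg (not_cross_inter n1 n2 h), if_neg (not_cross_union n1 n2 h)]
      omega) hA' hB' hc
  obtain ⟨p1, p2, p3, p4, p5⟩ := uncross_pack F bA.1.1 bB.1.1 bA.2.1 bB.2.1 odd'
  have ncA := hncW A hA'
  have ncB : ¬ Cross B' W := by
    rcases hBB with rfl | rfl
    · exact hncW _ hB'
    · rw [cross_compl_left]; exact hncW _ hB'
  have hsingle : ∀ U : Finset V, Odd U.card → (∀ σ ∈ F.P, cr U σ = 1) → ¬ Cross U W → ¬ Bad F (fun σ => cr W σ - 1) U →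
      (∀ σ ∈ K.M, cr U σ = 1) ∨ (NTr U ∧ ∀ σ ∈ K.M, cr U σ = cr W σ) := by
    intro U hU ht hcW hb
    obtain ⟨k, hk⟩ := prop_of_not_bad hU ht hb
    rcases odd_cases F hU with hN | hN
    · right
      refine ⟨hN, ?_⟩
      by_cases e1 : U = W
      · intro σ _; rw [e1]
      by_cases e2 : U = Wᶜ
      · intro σ hσ; rw [e2, cr_compl (K.pm σ hσ)]
      have hs : ∀ A, (if A = U then (1 : ℚ) else 0) ≠ 0 → A = U := fun A hA => by by_contra q; simp [q] at hA
      rcases cf2' (F := F) (c := fun A => if A = U then 1 else 0) (D := k) hfl hW tW (single_nonneg U) ⟨U, by simp⟩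
        (fun A hA => by rw [hs A hA]; exact hN)
        (fun A hA => by rw [hs A hA]; exact ht)
        (fun A B hA hB => by
          rw [hs A hA, hs B hB]
          rintro ⟨-, ⟨b, b1, b2⟩, -⟩
          exact b2 b1)
        (fun A hA => by rw [hs A hA]; exact hcW)
        (fun A hA => by rw [hs A hA]; exact ⟨e1, e2⟩)
        (fun σ hσ => by
          simp only [ite_mul, one_mul, zero_mul, Finset.sum_ite_eq', mem_univ, if_true]
          rw [hk σ hσ]; push_cast; ring) with h | ⟨A, hA, h⟩
      · exact absurd h hdec
      · rw [hs A hA] at h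
        intro σ hσ; linarith [h σ hσ]
    · exact Or.inl hN
  have id : ∀ σ ∈ K.M, (cr A σ - 1) + (cr B' σ - 1) = (cr (A ∩ B') σ - 1) + (cr (A ∪ B') σ - 1) := by
    intro σ hσ
    have := p5 σ hσ
    rw [hxe] at this; linarith
  rcases hsingle _ odd' p2 (not_cross_inter ncA ncB cr') nb1 with h1 | ⟨N1, h1⟩ <;>
    rcases hsingle _ p1 p3 (not_cross_union ncA ncB cr') nb2 with h2 | ⟨N2, h2⟩
  · obtain ⟨σ, hσ, hne⟩ := K.f2 A bA.1
    have := id σ hσ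
    have := s_nonneg hσ bA.1.1
    have := s_nonneg hσ bB.1.1
    have := h1 σ hσ
    have := h2 σ hσ
    omega
  · apply hdec
    refine ⟨A, B', bA.1, bB.1, fun σ hσ => ?_⟩
    rw [id σ hσ, h1 σ hσ, h2 σ hσ]; omega
  · apply hdec
    refine ⟨A, B', bA.1, bB.1, fun σ hσ => ?_⟩
    rw [id σ hσ, h1 σ hσ, h2 σ hσ]; omega
  · have eA : A ∩ B' ∪ A \ B' = A := by rw [union_comm]; exact sdiff_union_inter A B'
    obtain ⟨k, hk⟩ := pair_lemma (F := F) (U := A ∩ B') (T := (A ∪ B')ᶜ) (Q1 := A \ B') (Q2 := B' \ A)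
      N1 (NTr_compl hpm0 N2)
      (by rw [Finset.disjoint_left]; intro v; simp only [mem_inter, mem_compl, mem_union]; tauto)
      (by rw [Finset.disjoint_left]; intro v; simp only [mem_sdiff]; tauto)
      (by rw [Finset.disjoint_left]; intro v; simp only [mem_inter, mem_sdiff]; tauto)
      (by rw [Finset.disjoint_left]; intro v; simp only [mem_sdiff, mem_compl, mem_union]; tauto)
      (by rw [Finset.disjoint_left]; intro v; simp only [mem_inter, mem_sdiff]; tauto)
      (by rw [Finset.disjoint_left]; intro v; simp only [mem_sdiff, mem_compl, mem_union]; tauto)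
      (by intro v; simp only [mem_sdiff, mem_compl, mem_union, mem_inter]; tauto)
      p2 (fun σ hσ => by rw [cr_compl (K.pm σ (F.sub σ hσ))]; exact p3 σ hσ)
      (by rw [eA]; exact bA.2.1)
      (fun σ hσ => by
        rw [cr_compl (K.pm σ hσ), h1 σ hσ, h2 σ hσ])
      (fun σ hσ => (cnt_zero_iff _ _ _).1 (p4 σ hσ))
      (fun h => absurd h hfl)
    rw [eA] at hk
    apply bA.2.2
    refine ⟨1, fun σ hσ => ?_⟩
    have := hk σ hσ
    rw [h1 σ hσ, hxe, mul_zero, add_zero] at this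
    rw [one_mul]; exact_mod_cast this

end PFace


namespace PMSys
variable {V : Type} [Fintype V] (K : PMSys V)

def EMax (p q : V) : Prop := ∀ σ ∈ K.M, ∀ a, (∀ τ ∈ K.M, τ p ≠ q → τ a ≠ σ a) → ∀ τ ∈ K.M, τ p = q → τ a = σ a

variable {K}

theorem EMax.const {p q : V} (h : K.EMax p q) {X Y : Finset V} (h0 : ∀ τ ∈ K.M, τ p ≠ q → cnt τ X Y = 0)
    {σ σ' : V → V} (hσ : σ ∈ K.M) (hσ' : σ' ∈ K.M) (e : σ p = q) (e' : σ' p = q) : cnt σ X Y = cnt σ' X Y := by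
  have key : ∀ σ ∈ K.M, ∀ σ' ∈ K.M, σ' p = q → ∀ v ∈ X, σ v ∈ Y → σ' v ∈ Y := by
    intro σ hσ σ' hσ' e' v hv hY
    rw [h σ hσ v _ σ' hσ' e']
    · exact hY
    · intro τ hτ hne heq
      have := (cnt_zero_iff _ _ _).1 (h0 τ hτ hne) v hv
      rw [heq] at this; exact this hY
  unfold cnt
  congr 2
  apply Finset.filter_congr
  intro v hv
  exact ⟨key σ hσ σ' hσ' e' v hv, key σ' hσ' σ hσ e v hv⟩

theorem cell {σ : V → V} (X U Y : Finset V) :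
   (X.card : ℤ) = cnt σ X (U ∩ Y) + cnt σ X (U \ Y) + cnt σ X Uᶜ := by
  rw [← cnt_union_right, ← cnt_union_right, ← cnt_univ σ X]
  · congr 1; ext v; simp only [mem_union, mem_inter, mem_sdiff, mem_compl, mem_univ, true_iff]; tauto
  · rw [Finset.disjoint_left]; intro v; simp only [mem_union, mem_inter, mem_sdiff, mem_compl]; tauto
  · rw [Finset.disjoint_left]; intro v; simp only [mem_union, mem_inter, mem_sdiff, mem_compl]; tauto

theorem cr_cell {σ : V → V} (U Y : Finset V) : cr U σ = cnt σ (U ∩ Y) Uᶜ + cnt σ (U \ Y) Uᶜ := by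
  unfold cr
  rw [← cnt_union_left]
  · congr 1; rw [union_comm, sdiff_union_inter]
  · rw [Finset.disjoint_left]; intro v; simp only [mem_inter, mem_sdiff]; tauto

theorem bip {p q : V} (h : K.EMax p q) {B : Finset V}
    (hB : ∀ τ ∈ K.M, τ p ≠ q → (∀ v ∈ B, τ v ∉ B) ∧ (∀ v, v ∉ B → τ v ∈ B))
    {τ0 : V → V} (hτ0 : τ0 ∈ K.M) (hne : τ0 p ≠ q) {U : Finset V}
    (ht : ∀ τ ∈ K.M, τ p ≠ q → cr U τ = 1) :
    ∃ k : ℤ, ∀ σ ∈ K.M, σ p = q → cr U σ = k := by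
  have exit : ∀ B : Finset V, (∀ τ ∈ K.M, τ p ≠ q → (∀ v ∈ B, τ v ∉ B) ∧ (∀ v, v ∉ B → τ v ∈ B)) →
      ∀ τ ∈ K.M, τ p ≠ q → cnt τ (U ∩ B) (U ∩ B) = 0 ∧ cnt τ (U \ B) (U \ B) = 0 ∧
      cnt τ (U ∩ B) Uᶜ = (U ∩ B).card - (U \ B).card + cnt τ (U \ B) Uᶜ := by
    intro B hB τ hτ hne
    obtain ⟨b1, b2⟩ := hB τ hτ hne
    have z1 : cnt τ (U ∩ B) (U ∩ B) = 0 := by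
      rw [cnt_zero_iff]; intro v hv hv'; exact b1 v (mem_inter.1 hv).2 (mem_inter.1 hv').2
    have z2 : cnt τ (U \ B) (U \ B) = 0 := by
      rw [cnt_zero_iff]; intro v hv hv'; exact (mem_sdiff.1 hv').2 (b2 v (mem_sdiff.1 hv).2)
    have c1 := cell (σ := τ) (U ∩ B) U B
    have c2 := cell (σ := τ) (U \ B) U B
    have := cnt_comm (K.pm τ hτ) (U ∩ B) (U \ B)
    exact ⟨z1, z2, by omega⟩
  have main : ∀ B : Finset V, (∀ τ ∈ K.M, τ p ≠ q → (∀ v ∈ B, τ v ∉ B) ∧ (∀ v, v ∉ B → τ v ∈ B)) →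
      0 < ((U ∩ B).card : ℤ) - (U \ B).card → ∃ k : ℤ, ∀ σ ∈ K.M, σ p = q → cr U σ = k := by
    intro B hB hpos
    by_cases hex : ∃ σ1 ∈ K.M, σ1 p = q
    · obtain ⟨σ1, h1, e1⟩ := hex
      refine ⟨cr U σ1, fun σ hσ e => ?_⟩
      have z1 := h.const (fun τ hτ hne => (exit B hB τ hτ hne).1) hσ h1 e e1
      have z2 := h.const (fun τ hτ hne => (exit B hB τ hτ hne).2.1) hσ h1 e e1
      have z3 := h.const (X := U \ B) (Y := Uᶜ) (fun τ hτ hne => by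
        have a1 := ht τ hτ hne
        rw [cr_cell U B] at a1
        have := (exit B hB τ hτ hne).2.2
        have := cnt_nonneg τ (U \ B) Uᶜ
        omega) hσ h1 e e1
      have a1 := cell (σ := σ) (U ∩ B) U B
      have a2 := cell (σ := σ) (U \ B) U B
      have a3 := cell (σ := σ1) (U ∩ B) U B
      have a4 := cell (σ := σ1) (U \ B) U B
      have a5 := cnt_comm (K.pm σ hσ) (U ∩ B) (U \ B)
      have a6 := cnt_comm (K.pm σ1 h1) (U ∩ B) (U \ B)
      rw [cr_cell U B, cr_cell U B]
      omega
    · exact ⟨0, fun σ hσ e => absurd ⟨σ, hσ, e⟩ hex⟩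
  have a0 := exit B hB τ0 hτ0 hne
  have a1 := ht τ0 hτ0 hne
  rw [cr_cell U B] at a1
  by_cases hpos : 0 < ((U ∩ B).card : ℤ) - (U \ B).card
  · exact main B hB hpos
  · apply main Bᶜ
    · intro τ hτ hne
      obtain ⟨b1, b2⟩ := hB τ hτ hne
      constructor
      · intro v hv; rw [mem_compl] at hv ⊢; exact fun h' => h' (b2 v hv)
      · intro v hv; rw [mem_compl, not_not] at hv; rw [mem_compl]; exact b1 v hv
    · have e1 : U ∩ Bᶜ = U \ B := (sdiff_eq_inter_compl U B).symm
      have e2 : U \ Bᶜ = U ∩ B := by ext v; simp [mem_sdiff]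
      rw [e1, e2]; omega

end PMSys


namespace PMSys
variable {V : Type} [Fintype V] {K : PMSys V}

theorem cnt_single (σ : V → V) (c : V) (B : Finset V) : cnt σ {c} B = if σ c ∈ B then 1 else 0 := by
  unfold cnt; rw [filter_singleton]; split_ifs <;> simp

theorem erase_tight {D : Finset V} {c : V} (hc : c ∈ D) (he : Even D.card) (h4 : 4 ≤ D.card) (h2 : 2 ≤ (Dᶜ).card)
    (h : ∀ σ ∈ K.M, cr D σ = 0 ∨ (σ c ∉ D ∧ cr D σ = 2)) : False := by
  have e1 := Finset.card_erase_of_mem hc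
  have e2 := Finset.card_compl_add_card D
  have e3 := Finset.card_compl_add_card (D.erase c)
  obtain ⟨σ, hσ, hne⟩ := K.f2 (D.erase c) ⟨by rw [e1]; grind, by omega, by omega⟩
  apply hne
  have hpm := K.pm σ hσ
  have hD : D = {c} ∪ D.erase c := by
    ext v; rw [mem_union, mem_singleton, mem_erase]
    by_cases q : v = c
    · subst q; simp [hc]
    · simp [q]
  have hdis : Disjoint {c} (D.erase c) := by rw [disjoint_singleton_left]; simp
  have hU : (D.erase c)ᶜ = Dᶜ ∪ {c} := by
    ext v; rw [mem_union, mem_singleton, mem_compl, mem_compl, mem_erase]; tauto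
  have hdis2 : Disjoint Dᶜ {c} := by rw [disjoint_singleton_right]; simpa
  have c1 : cr D σ = cnt σ {c} Dᶜ + cnt σ (D.erase c) Dᶜ := by
    unfold cr
    rw [← cnt_union_left _ _ hdis, ← hD]
  have c2 : cr (D.erase c) σ = cnt σ (D.erase c) Dᶜ + cnt σ {c} (D.erase c) := by
    unfold cr
    rw [hU, cnt_union_right _ _ hdis2, cnt_comm hpm (D.erase c) {c}]
  rw [cnt_single] at c1 c2
  have := cnt_nonneg σ (D.erase c) Dᶜ
  have hne2 : σ c ≠ c := hpm.2 c
  by_cases q : σ c ∈ D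
  · rw [if_neg (by simpa)] at c1
    rw [if_pos (mem_erase.2 ⟨hne2, q⟩)] at c2
    rcases h σ hσ with h | h
    · omega
    · exact absurd q h.1
  · rw [if_pos (by simpa)] at c1
    rw [if_neg (fun t => q (mem_erase.1 t).2)] at c2
    rcases h σ hσ with h | h
    · omega
    · omega

theorem lemmaC (hn : 6 ≤ Fintype.card V) {p q a b : V} (hxy : ∀ σ ∈ K.M, σ p = q ↔ σ a = b)
    (hd1 : ¬ (a = p ∧ b = q)) (hd2 : ¬ (a = q ∧ b = p))
    {σ1 τ0 : V → V} (h1 : σ1 ∈ K.M) (e1 : σ1 p = q) (h0 : τ0 ∈ K.M) (e0 : τ0 p ≠ q) :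
    ∃ B : Finset V, ∀ τ ∈ K.M, τ p ≠ q → (∀ v ∈ B, τ v ∉ B) ∧ (∀ v, v ∉ B → τ v ∈ B) := by
  have hsum : ∀ (σ : V → V) (p q : V), ∑ v, (if v = p ∧ σ v = q then (1 : ℚ) else 0) = if σ p = q then 1 else 0 := by
    intro σ p q
    have : ∀ v, (if v = p ∧ σ v = q then (1 : ℚ) else 0) = if v = p then (if σ p = q then 1 else 0) else 0 := by
      intro v
      by_cases h : v = p
      · subst h; simp
      · simp [h]
    simp only [this]
    rw [Finset.sum_ite_eq' univ p, if_pos (mem_univ _)]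
  obtain ⟨y, hy⟩ := K.f3 (fun v w => (if v = p ∧ w = q then 1 else 0) - (if v = a ∧ w = b then 1 else 0)) 0 (by
    intro σ hσ
    rw [Finset.sum_sub_distrib, hsum, hsum]
    by_cases h : σ p = q
    · rw [if_pos h, if_pos ((hxy σ hσ).1 h)]; ring
    · rw [if_neg h, if_neg (fun h' => h ((hxy σ hσ).2 h'))]; ring)
  have hP : ∀ τ ∈ K.M, τ p ≠ q → ∀ v, y v + y (τ v) = 0 := by
    intro τ hτ hne v
    have hpm := K.pm τ hτ
    have hne' : τ a ≠ b := fun h => hne ((hxy τ hτ).2 h)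
    rw [← hy τ hτ v]
    rw [if_neg (by rintro ⟨rfl, h⟩; exact hne h), if_neg (by rintro ⟨rfl, h⟩; exact hne' h),
      if_neg (by rintro ⟨h, rfl⟩; exact hne (by rw [← h, hpm.1])), if_neg (by rintro ⟨h, rfl⟩; exact hne' (by rw [← h, hpm.1]))]
    ring
  -- distinctness
  have ea : σ1 a = b := (hxy σ1 h1).1 e1
  have eq : σ1 q = p := by rw [← e1, (K.pm σ1 h1).1]
  have eb : σ1 b = a := by rw [← ea, (K.pm σ1 h1).1]
  have npq : p ≠ q := fun h => (K.pm σ1 h1).2 p (by rw [e1, h])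
  have nab : a ≠ b := fun h => (K.pm σ1 h1).2 a (by rw [ea, h])
  have npa : p ≠ a := fun h => hd1 ⟨h.symm, by rw [← ea, ← h, e1]⟩
  have nqa : q ≠ a := fun h => hd2 ⟨h.symm, by rw [← ea, ← h, eq]⟩
  have npb : p ≠ b := fun h => hd2 ⟨by rw [← eb, ← h, e1], h.symm⟩
  have nqb : q ≠ b := fun h => hd1 ⟨by rw [← eb, ← h, eq], h.symm⟩
  have ypq : y p + y q = 1 := by
    have := hy σ1 h1 p
    rw [e1] at this
    rw [← this, if_pos ⟨rfl, rfl⟩, if_neg (fun h => npa h.1), if_neg (fun h => npq h.2), if_neg (fun h => nqa h.1)]; ring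
  have yab : y a + y b = -1 := by
    have := hy σ1 h1 a
    rw [ea] at this
    rw [← this, if_neg (fun h => npa h.1.symm), if_pos ⟨rfl, rfl⟩, if_neg (fun h => npb h.1.symm), if_neg (fun h => nab h.2)]; ring
  have hE : ∀ σ ∈ K.M, ∀ v, v ≠ p → v ≠ q → v ≠ a → v ≠ b → y v + y (σ v) = 0 := by
    intro σ hσ v n1 n2 n3 n4
    rw [← hy σ hσ v, if_neg (fun h => n1 h.1), if_neg (fun h => n3 h.1), if_neg (fun h => n2 h.2), if_neg (fun h => n4 h.2)]; ring
  obtain ⟨Z, hZ⟩ : ∃ Z : Finset V, Z = univ.filter (fun v => y v = 0) := ⟨_, rfl⟩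
  have mZ : ∀ v, v ∈ Z ↔ y v = 0 := fun v => by rw [hZ, mem_filter]; simp
  have crP : ∀ τ ∈ K.M, τ p ≠ q → cr Z τ = 0 := by
    intro τ hτ hne
    unfold cr; rw [cnt_zero_iff]
    intro v hv hv'
    rw [mem_compl, mZ] at hv'; rw [mZ] at hv
    have := hP τ hτ hne v
    rw [hv, zero_add] at this; exact hv' this
  have hZe : Even Z.card := by
    by_contra ho
    rw [Nat.not_even_iff_odd] at ho
    have := one_le_cr (K.pm τ0 h0) ho
    rw [crP τ0 h0 e0] at this; norm_num at this
  obtain ⟨m, hm⟩ : ∃ m, m = (({p, q, a, b} : Finset V).filter (fun v => y v = 0)).card := ⟨_, rfl⟩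
  have crE : ∀ σ ∈ K.M, σ p = q → cr Z σ = m := by
    intro σ hσ e
    have ea : σ a = b := (hxy σ hσ).1 e
    have eq : σ q = p := by rw [← e, (K.pm σ hσ).1]
    have eb : σ b = a := by rw [← ea, (K.pm σ hσ).1]
    unfold cr cnt
    rw [hm]
    congr 2
    ext v
    rw [mem_filter, mem_filter, mZ, mem_compl, mZ]
    simp only [mem_insert, mem_singleton]
    constructor
    · rintro ⟨h1, h2⟩
      refine ⟨?_, h1⟩
      by_contra hc
      push Not at hc
      have := hE σ hσ v hc.1 hc.2.1 hc.2.2.1 hc.2.2.2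
      rw [h1, zero_add] at this; exact h2 this
    · rintro ⟨h1, h2⟩
      refine ⟨h2, fun h3 => ?_⟩
      rcases h1 with rfl | rfl | rfl | rfl
      · rw [e] at h3; linarith
      · rw [eq] at h3; linarith
      · rw [ea] at h3; linarith
      · rw [eb] at h3; linarith
  have hmcase : m = 0 ∨ (m = 2 ∧ ((y p = 0 ∧ y q ≠ 0) ∨ (y q = 0 ∧ y p ≠ 0))) := by
    have hev : Even (m : ℤ) := by rw [← crE σ1 h1 e1]; exact cr_even (K.pm σ1 h1) hZe
    have hev : Even m := by exact_mod_cast hev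
    have e : m = (if y p = 0 then 1 else 0) + ((if y q = 0 then 1 else 0) + ((if y a = 0 then 1 else 0) + (if y b = 0 then 1 else 0))) := by
      rw [hm, Finset.card_filter, Finset.sum_insert (by simp; tauto), Finset.sum_insert (by simp; tauto),
        Finset.sum_insert (by simp; tauto), Finset.sum_singleton]
    by_cases q1 : y p = 0 <;> by_cases q2 : y q = 0 <;> by_cases q3 : y a = 0 <;> by_cases q4 : y b = 0 <;>
      simp only [q1, q2, q3, q4, if_true, if_false] at e <;> (try (exfalso; linarith)) <;> subst e <;> first
      | (left; rfl) | (right; exact ⟨rfl, by tauto⟩) | (exfalso; revert hev; decide)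
  have hZ0 : ∀ v, y v ≠ 0 := by
    by_contra hc
    push Not at hc
    obtain ⟨z, hz⟩ := hc
    have ev2 : Even (Fintype.card V) := pm_card_even (K.pm σ1 h1)
    have hcard := Finset.card_compl_add_card Z
    have zpos : 0 < Z.card := card_pos.2 ⟨z, (mZ z).2 hz⟩
    have cpos : 0 < (Zᶜ).card := by
      rw [card_pos]
      by_cases q1 : y p = 0
      · refine ⟨q, ?_⟩; rw [mem_compl, mZ]; intro h; linarith
      · exact ⟨p, by rw [mem_compl, mZ]; exact q1⟩
    have hnc : ∀ D : Finset V, D = Z ∨ D = Zᶜ → 4 ≤ D.card → False := by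
      intro D hD h4
      have hcr : ∀ σ ∈ K.M, cr D σ = cr Z σ := by
        rcases hD with rfl | rfl
        · intro _ _; rfl
        · intro σ hσ; rw [cr_compl (K.pm σ hσ)]
      have hev : Even D.card := by
        rcases hD with rfl | rfl
        · exact hZe
        · grind
      have h2 : 2 ≤ (Dᶜ).card := by
        rcases hD with rfl | rfl
        · grind
        · rw [compl_compl]; grind
      rcases hmcase with hm0 | ⟨hm2, hpq⟩
      · obtain ⟨c, hc⟩ := card_pos.1 (show 0 < D.card by omega)
        refine erase_tight (K := K) hc hev h4 h2 (fun σ hσ => Or.inl ?_)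
        rw [hcr σ hσ]
        by_cases e : σ p = q
        · rw [crE σ hσ e, hm0]; rfl
        · exact crP σ hσ e
      · have : (p ∈ D ∧ q ∉ D) ∨ (q ∈ D ∧ p ∉ D) := by
          rcases hD with rfl | rfl
          · rw [mZ, mZ]; exact hpq
          · rw [mem_compl, mem_compl, mZ, mZ, not_not, not_not]; tauto
        rcases this with ⟨hc, hc'⟩ | ⟨hc, hc'⟩
        · refine erase_tight (K := K) hc hev h4 h2 (fun σ hσ => ?_)
          rw [hcr σ hσ]
          by_cases e : σ p = q
          · right; rw [e, crE σ hσ e, hm2]; exact ⟨hc', rfl⟩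
          · left; exact crP σ hσ e
        · refine erase_tight (K := K) hc hev h4 h2 (fun σ hσ => ?_)
          rw [hcr σ hσ]
          by_cases e : σ p = q
          · right
            have : σ q = p := by rw [← e, (K.pm σ hσ).1]
            rw [this, crE σ hσ e, hm2]; exact ⟨hc', rfl⟩
          · left; exact crP σ hσ e
    by_cases h4 : 4 ≤ Z.card
    · exact hnc Z (Or.inl rfl) h4
    · exact hnc Zᶜ (Or.inr rfl) (by grind)
  refine ⟨univ.filter (fun v => 0 < y v), fun τ hτ hne => ?_⟩
  constructor
  · intro v hv
    rw [mem_filter] at hv ⊢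
    have := hP τ hτ hne v
    rintro ⟨_, h⟩
    linarith [hv.2]
  · intro v hv
    rw [mem_filter] at hv ⊢
    have := hP τ hτ hne v
    have h2 := hZ0 v
    have h3 : ¬ 0 < y v := fun h => hv ⟨mem_univ _, h⟩
    have h4 : y v < 0 := lt_of_le_of_ne (not_lt.1 h3) h2
    exact ⟨mem_univ _, by linarith⟩

end PMSys


namespace PMSys
variable {V : Type} [Fintype V] (K : PMSys V)

def OutE : Prop := ∃ p q, (∃ σ ∈ K.M, σ p = q) ∧ K.EMax p q ∧
  ∀ U : Finset V, NTr U → (∀ τ ∈ K.M, τ p ≠ q → cr U τ = 1) → ∃ k : ℤ, ∀ σ ∈ K.M, σ p = q → cr U σ = k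

def OutW : Prop := ∃ W : Finset V, NTr W ∧ (∃ σ ∈ K.M, cr W σ = 3 ∨ cr W σ = 5) ∧
  (∀ σ ∈ K.M, ∀ a, ∃ τ ∈ K.M, cr W τ = 1 ∧ τ a = σ a) ∧
  ∀ U : Finset V, NTr U → (∀ τ ∈ K.M, cr W τ = 1 → cr U τ = 1) →
    ∃ k : ℚ, ∀ σ ∈ K.M, (cr U σ : ℚ) - 1 = k * ((cr W σ : ℚ) - 1)

variable {K}

theorem outW_of (n6 : 6 ≤ Fintype.card V) {W0 : Finset V} (h0 : NTr W0) (h05 : ∀ σ ∈ K.M, cr W0 σ ≤ 5)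
    (hc0 : ∀ σ ∈ K.M, ∀ a, ∃ τ ∈ K.M, cr W0 τ = 1 ∧ τ a = σ a) (hM : K.M.Nonempty) : K.OutW := by
  obtain ⟨W, ⟨hW, hW5, hWc⟩, hmin⟩ : ∃ W, (NTr W ∧ (∀ σ ∈ K.M, cr W σ ≤ 5) ∧
      (∀ σ ∈ K.M, ∀ a, ∃ τ ∈ K.M, cr W τ = 1 ∧ τ a = σ a)) ∧
      ∀ W', (NTr W' ∧ (∀ σ ∈ K.M, cr W' σ ≤ 5) ∧
      (∀ σ ∈ K.M, ∀ a, ∃ τ ∈ K.M, cr W' τ = 1 ∧ τ a = σ a)) → ∑ σ ∈ K.M, cr W σ ≤ ∑ σ ∈ K.M, cr W' σ := by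
    obtain ⟨W, hW, hm⟩ := Finset.exists_min_image (univ.filter (fun W => (NTr W ∧ (∀ σ ∈ K.M, cr W σ ≤ 5) ∧
      (∀ σ ∈ K.M, ∀ a, ∃ τ ∈ K.M, cr W τ = 1 ∧ τ a = σ a)))) (fun W => ∑ σ ∈ K.M, cr W σ) ⟨W0, by
        rw [mem_filter]; exact ⟨mem_univ _, h0, h05, hc0⟩⟩
    rw [mem_filter] at hW
    refine ⟨W, hW.2, fun W' h' => hm W' (by rw [mem_filter]; exact ⟨mem_univ _, h'⟩)⟩
  have hV : Nonempty V := Fintype.card_pos_iff.1 (by omega)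
  obtain ⟨v0⟩ := hV
  obtain ⟨s0, hs0⟩ := hM
  obtain ⟨t0, ht0, ht01, -⟩ := hWc s0 hs0 v0
  let F : PFace K :=
    { P := K.M.filter (fun σ => cr W σ = 1)
      sub := fun σ h => (mem_filter.1 h).1
      ne := ⟨t0, mem_filter.2 ⟨ht0, ht01⟩⟩
      fl := False
      e1 := v0
      e2 := v0
      n6 := n6
      cover := by
        intro σ hσ a _
        obtain ⟨τ, h1, h2, h3⟩ := hWc σ hσ a
        exact ⟨τ, mem_filter.2 ⟨h1, h2⟩, h3⟩
      avoid := fun _ _ h => h.elim }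
  have hP : ∀ σ, σ ∈ F.P ↔ σ ∈ K.M ∧ cr W σ = 1 := fun σ => mem_filter
  have nobad : ∀ B, ¬ PFace.Bad F (fun σ => cr W σ - 1) B := by
    intro B hB
    obtain ⟨A, B', hA, hB', hs⟩ := PFace.step2 F (fun h => h) hW hP hB
    have hB1 : ∀ σ ∈ K.M, 1 ≤ cr B' σ := fun σ hσ => one_le_cr (K.pm σ hσ) hB'.1
    have hA1 : ∀ σ ∈ K.M, 1 ≤ cr A σ := fun σ hσ => one_le_cr (K.pm σ hσ) hA.1
    have := hmin A ⟨hA, fun σ hσ => by have := hs σ hσ; have := hB1 σ hσ; have := hW5 σ hσ; omega, fun σ hσ a => by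
      obtain ⟨τ, h1, h2, h3⟩ := hWc σ hσ a
      refine ⟨τ, h1, ?_, h3⟩
      have := hs τ h1; have := hB1 τ h1; have := hA1 τ h1; omega⟩
    obtain ⟨σ2, h2, h2'⟩ := K.f2 B' hB'
    have hlt : ∑ σ ∈ K.M, cr A σ < ∑ σ ∈ K.M, cr W σ := by
      apply Finset.sum_lt_sum
      · intro σ hσ; have := hs σ hσ; have := hB1 σ hσ; omega
      · exact ⟨σ2, h2, by have := hs σ2 h2; have := hB1 σ2 h2; omega⟩
    omega
  refine ⟨W, hW, ?_, hWc, ?_⟩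
  · obtain ⟨σ, hσ, h⟩ := K.f2 W hW
    refine ⟨σ, hσ, ?_⟩
    have := cr_odd (K.pm σ hσ) hW.1
    have := hW5 σ hσ
    have := one_le_cr (K.pm σ hσ) hW.1
    obtain ⟨k, hk⟩ := cr_odd (K.pm σ hσ) hW.1
    omega
  · intro U hU ht
    have := nobad U
    unfold PFace.Bad at this
    push Not at this
    obtain ⟨k, hk⟩ := this hU (fun σ hσ => ht σ ((hP σ).1 hσ).1 ((hP σ).1 hσ).2)
    exact ⟨k, fun σ hσ => by rw [hk σ hσ]; push_cast; rfl⟩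

theorem core [Nonempty V] (hM : K.M.Nonempty) : K.OutE ∨ K.OutW := by
  obtain ⟨⟨p, q⟩, ⟨σ1, h1, e1⟩, hmax⟩ : ∃ e : V × V, (∃ σ ∈ K.M, σ e.1 = e.2) ∧ ∀ e' : V × V, (∃ σ ∈ K.M, σ e'.1 = e'.2) →
      (K.M.filter (fun τ => τ e'.1 ≠ e'.2)).card ≤ (K.M.filter (fun τ => τ e.1 ≠ e.2)).card := by
    obtain ⟨s0, hs0⟩ := hM
    obtain ⟨v0⟩ := ‹Nonempty V›
    obtain ⟨e, he, hm⟩ := Finset.exists_max_image (univ.filter (fun e : V × V => ∃ σ ∈ K.M, σ e.1 = e.2))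
      (fun e => (K.M.filter (fun τ => τ e.1 ≠ e.2)).card) ⟨(v0, s0 v0), by rw [mem_filter]; exact ⟨mem_univ _, s0, hs0, rfl⟩⟩
    rw [mem_filter] at he
    exact ⟨e, he.2, fun e' h' => hm e' (by rw [mem_filter]; exact ⟨mem_univ _, h'⟩)⟩
  simp only at e1 hmax
  -- maximality
  have hmx : ∀ σ ∈ K.M, ∀ a, (∀ τ ∈ K.M, τ p ≠ q → τ a ≠ σ a) → ∀ τ ∈ K.M, τ a ≠ σ a → τ p ≠ q := by
    intro σ hσ a h τ hτ hta
    have hle := hmax (a, σ a) ⟨σ, hσ, rfl⟩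
    simp only at hle
    have hsub : K.M.filter (fun τ => τ p ≠ q) ⊆ K.M.filter (fun τ => τ a ≠ σ a) := by
      intro ρ hρ; rw [mem_filter] at *; exact ⟨hρ.1, h ρ hρ.1 hρ.2⟩
    have := Finset.eq_of_subset_of_card_le hsub hle
    have h3 : τ ∈ K.M.filter (fun τ => τ a ≠ σ a) := by rw [mem_filter]; exact ⟨hτ, hta⟩
    rw [← this, mem_filter] at h3
    exact h3.2
  have hE : K.EMax p q := by
    intro σ hσ a h τ hτ hp
    by_contra hc
    exact hmx σ hσ a h τ hτ hc hp
  by_cases n6 : 6 ≤ Fintype.card V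
  swap
  · left
    refine ⟨p, q, ⟨σ1, h1, e1⟩, hE, ?_⟩
    intro U hU
    exfalso
    have := hU.2.1; have := hU.2.2
    have := Finset.card_compl_add_card U
    omega
  obtain ⟨τ0, h0, e0⟩ : ∃ τ ∈ K.M, τ p ≠ q := by
    by_contra hc
    push Not at hc
    have npq : p ≠ q := fun h => (K.pm σ1 h1).2 p (by rw [e1, h])
    obtain ⟨c, hc'⟩ : ∃ c, c ∉ ({p, q} : Finset V) := by
      by_contra hcc
      push Not at hcc
      have : (univ : Finset V).card ≤ ({p, q} : Finset V).card := Finset.card_le_card (fun x _ => hcc x)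
      rw [Finset.card_univ, Finset.card_pair npq] at this; omega
    have hcd : (insert c ({p, q} : Finset V)).card = 3 := by
      rw [Finset.card_insert_of_notMem hc', Finset.card_pair npq]
    have hN : NTr (insert c ({p, q} : Finset V)) := by
      refine ⟨by rw [hcd]; decide, by omega, ?_⟩
      have := Finset.card_compl_add_card (insert c ({p, q} : Finset V))
      omega
    obtain ⟨σ, hσ, h⟩ := K.f2 _ hN
    have h2 := one_le_cr (K.pm σ hσ) hN.1
    have ep := hc σ hσ
    have eq : σ q = p := by rw [← ep, (K.pm σ hσ).1]
    have : cr (insert c ({p, q} : Finset V)) σ ≤ 1 := by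
      unfold cr cnt
      have : ((insert c ({p, q} : Finset V)).filter (fun v => σ v ∈ (insert c ({p, q} : Finset V))ᶜ)) ⊆ {c} := by
        intro v hv
        rw [mem_filter, mem_compl] at hv
        simp only [mem_insert, mem_singleton] at *
        rcases hv.1 with h | rfl | rfl
        · exact h
        · exfalso; apply hv.2; rw [ep]; tauto
        · exfalso; apply hv.2; rw [eq]; tauto
      have := Finset.card_le_card this
      simp only [card_singleton] at this
      exact_mod_cast this
    omega
  by_cases hf : ∃ σ ∈ K.M, ∃ a, ¬ ((a = p ∧ σ a = q) ∨ (a = q ∧ σ a = p)) ∧ ∀ τ ∈ K.M, τ p ≠ q → τ a ≠ σ a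
  · left
    obtain ⟨σ, hσ, a, hd, hv⟩ := hf
    have hxy : ∀ τ ∈ K.M, τ p = q ↔ τ a = σ a := by
      intro τ hτ
      constructor
      · exact hE σ hσ a hv τ hτ
      · intro h; by_contra hc; exact hv τ hτ hc h
    obtain ⟨B, hB⟩ := lemmaC n6 hxy (fun h => hd (Or.inl h)) (fun h => hd (Or.inr h)) h1 e1 h0 e0
    exact ⟨p, q, ⟨σ1, h1, e1⟩, hE, fun U hU ht => bip hE hB h0 e0 ht⟩
  push Not at hf
  let F : PFace K :=
    { P := K.M.filter (fun σ => σ p ≠ q)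
      sub := fun σ h => (mem_filter.1 h).1
      ne := ⟨τ0, mem_filter.2 ⟨h0, e0⟩⟩
      fl := True
      e1 := p
      e2 := q
      n6 := n6
      cover := by
        intro σ hσ a hh
        obtain ⟨τ, h1, h2, h3⟩ := hf σ hσ a (by tauto)
        exact ⟨τ, mem_filter.2 ⟨h1, h2⟩, h3⟩
      avoid := fun σ h _ => (mem_filter.1 h).2 }
  have hP : ∀ σ, σ ∈ F.P ↔ σ ∈ K.M ∧ σ F.e1 ≠ F.e2 := fun σ => mem_filter
  by_cases hb : ∃ B, PFace.Bad F F.xe B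
  · right
    obtain ⟨B, hB⟩ := hb
    obtain ⟨W, hW, hW5, hWP, σ2, h2, e2, hc2⟩ := PFace.step1 F trivial hP h1 e1 hB
    refine outW_of n6 hW hW5 ?_ hM
    intro σ hσ a
    by_contra hcc
    push Not at hcc
    have := hmx σ hσ a (fun τ hτ hne => hcc τ hτ (hWP τ ((hP τ).2 ⟨hτ, hne⟩))) σ2 h2 (hcc σ2 h2 hc2)
    exact this e2
  · left
    push Not at hb
    refine ⟨p, q, ⟨σ1, h1, e1⟩, hE, ?_⟩
    intro U hU ht
    have := hb U
    unfold PFace.Bad at this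
    push Not at this
    obtain ⟨k, hk⟩ := this hU (fun σ hσ => ht σ ((hP σ).1 hσ).1 ((hP σ).1 hσ).2)
    refine ⟨cr U σ1, fun σ hσ e => ?_⟩
    have x1 : ∀ σ, σ p = q → F.xe σ = 1 := fun σ h => if_pos ⟨trivial, h⟩
    have a1 := hk σ hσ
    have a2 := hk σ1 h1
    rw [x1 σ e] at a1
    rw [x1 σ1 e1] at a2
    have : (cr U σ : ℚ) = cr U σ1 := by linarith
    exact_mod_cast this

end PMSys


section MatchingCone
variable {V : Type} [Fintype V]

noncomputable def cut (x : V → V → ℚ) (U : Finset V) : ℚ := ∑ a ∈ U, ∑ b ∈ Uᶜ, x a b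

noncomputable def chi (σ : V → V) (a b : V) : ℚ := if σ a = b then 1 else 0

structure Adm (x : V → V → ℚ) (r : ℚ) : Prop where
  symm : ∀ a b, x a b = x b a
  diag : ∀ a, x a a = 0
  nn : ∀ a b, 0 ≤ x a b
  row : ∀ a, ∑ b, x a b = r
  cut : ∀ U : Finset V, Odd U.card → r ≤ cut x U

def InD (D : Subring ℚ) (x : V → V → ℚ) : Prop :=
  ∃ c : (V → V) → ℚ, (∀ σ, 0 ≤ c σ) ∧ (∀ σ, c σ ∈ D) ∧ (∀ σ, c σ ≠ 0 → IsPM σ) ∧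
    ∀ a b, x a b = ∑ σ, c σ * chi σ a b

theorem cut_lin (x y : V → V → ℚ) (s t : ℚ) (U : Finset V) :
    cut (fun a b => s * x a b + t * y a b) U = s * cut x U + t * cut y U := by
  unfold cut
  rw [Finset.mul_sum, Finset.mul_sum, ← Finset.sum_add_distrib]
  apply Finset.sum_congr rfl; intro a _
  rw [Finset.mul_sum, Finset.mul_sum, ← Finset.sum_add_distrib]

theorem cut_sum {ι : Type} (s : Finset ι) (c : ι → ℚ) (x : ι → V → V → ℚ) (U : Finset V) :
    cut (fun a b => ∑ i ∈ s, c i * x i a b) U = ∑ i ∈ s, c i * cut (x i) U := by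
  unfold cut
  calc _ = ∑ a ∈ U, ∑ i ∈ s, c i * ∑ b ∈ Uᶜ, x i a b := by
        apply Finset.sum_congr rfl; intro a _
        rw [Finset.sum_comm]; apply Finset.sum_congr rfl; intro i _; rw [Finset.mul_sum]
    _ = _ := by
        rw [Finset.sum_comm]; apply Finset.sum_congr rfl; intro i _; rw [Finset.mul_sum]

theorem cut_chi (σ : V → V) (U : Finset V) : cut (chi σ) U = cr U σ := by
  unfold cut chi cr cnt
  rw [Finset.card_filter]; push_cast
  apply Finset.sum_congr rfl; intro a _
  rw [Finset.sum_ite_eq]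

theorem cut_compl {x : V → V → ℚ} (h : ∀ a b, x a b = x b a) (U : Finset V) : cut x Uᶜ = cut x U := by
  unfold cut
  rw [compl_compl, Finset.sum_comm]
  apply Finset.sum_congr rfl; intro a _
  apply Finset.sum_congr rfl; intro b _
  exact h _ _

theorem cut_single {x : V → V → ℚ} (h : ∀ a, x a a = 0) (v : V) : cut x {v} = ∑ b, x v b := by
  unfold cut
  rw [Finset.sum_singleton, ← Finset.sum_compl_add_sum ({v} : Finset V), Finset.sum_singleton, h, add_zero]

theorem chi_row (σ : V → V) (a : V) : ∑ b, chi σ a b = 1 := by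
  unfold chi; rw [Finset.sum_ite_eq]; simp

theorem chi_symm {σ : V → V} (h : IsPM σ) (a b : V) : chi σ a b = chi σ b a := by
  unfold chi
  have : σ a = b ↔ σ b = a := ⟨fun e => by rw [← e, h.1], fun e => by rw [← e, h.1]⟩
  simp only [this]

theorem chi_diag {σ : V → V} (h : IsPM σ) (a : V) : chi σ a a = 0 := by
  unfold chi; rw [if_neg (h.2 a)]

theorem chi_nn (σ : V → V) (a b : V) : 0 ≤ chi σ a b := by unfold chi; split_ifs <;> norm_num

theorem adm_chi {σ : V → V} (h : IsPM σ) : Adm (chi σ) 1 where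
  symm := chi_symm h
  diag := chi_diag h
  nn := chi_nn σ
  row := chi_row σ
  cut := fun U hU => by rw [cut_chi]; exact_mod_cast one_le_cr h hU

/-- odd sets are nontrivial, singletons or complements of singletons -/
theorem odd_triv {U : Finset V} (hV : Even (Fintype.card V)) (hU : Odd U.card) :
    NTr U ∨ (∃ v, U = {v}) ∨ ∃ v, U = {v}ᶜ := by
  have h := Finset.card_compl_add_card U
  obtain ⟨k, hk⟩ := hV
  obtain ⟨j, hj⟩ := hU
  by_cases h1 : U.card = 1
  · right; left; exact Finset.card_eq_one.1 h1
  · by_cases h2 : (Uᶜ).card = 1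
    · right; right
      obtain ⟨v, hv⟩ := Finset.card_eq_one.1 h2
      exact ⟨v, by rw [← hv, compl_compl]⟩
    · left; exact ⟨⟨j, hj⟩, by omega, by omega⟩

theorem cut_triv {x : V → V → ℚ} (hs : ∀ a b, x a b = x b a) (hd : ∀ a, x a a = 0) {r : ℚ} (hr : ∀ a, ∑ b, x a b = r)
    {U : Finset V} (hU : (∃ v, U = {v}) ∨ ∃ v, U = {v}ᶜ) : cut x U = r := by
  rcases hU with ⟨v, rfl⟩ | ⟨v, rfl⟩
  · rw [cut_single hd, hr]
  · rw [cut_compl hs, cut_single hd, hr]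

theorem Adm.even {x : V → V → ℚ} {r : ℚ} (h : Adm x r) (hr : 0 < r) : Even (Fintype.card V) := by
  by_contra hc
  rw [Nat.not_even_iff_odd] at hc
  have := h.cut univ (by rwa [Finset.card_univ])
  unfold _root_.cut at this
  simp at this; linarith

theorem Adm.smul {x : V → V → ℚ} {r : ℚ} (h : Adm x r) {t : ℚ} (ht : 0 ≤ t) : Adm (fun a b => t * x a b) (t * r) where
  symm := fun a b => by rw [h.symm]
  diag := fun a => by rw [h.diag, mul_zero]
  nn := fun a b => mul_nonneg ht (h.nn a b)
  row := fun a => by rw [← Finset.mul_sum, h.row]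
  cut := fun U hU => by
    have := cut_lin x x t 0 U
    simp only [zero_mul, add_zero] at this
    rw [this]; exact mul_le_mul_of_nonneg_left (h.cut U hU) ht

theorem adm_sum {s : Finset (V → V)} (hs : ∀ σ ∈ s, IsPM σ) (c : (V → V) → ℚ) (hc : ∀ σ ∈ s, 0 ≤ c σ) :
    Adm (fun a b => ∑ σ ∈ s, c σ * chi σ a b) (∑ σ ∈ s, c σ) where
  symm := fun a b => Finset.sum_congr rfl fun σ h => by rw [chi_symm (hs σ h)]
  diag := fun a => Finset.sum_eq_zero fun σ h => by rw [chi_diag (hs σ h), mul_zero]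
  nn := fun a b => Finset.sum_nonneg fun σ h => mul_nonneg (hc σ h) (chi_nn _ _ _)
  row := fun a => by
    rw [Finset.sum_comm]; apply Finset.sum_congr rfl; intro σ _; rw [← Finset.mul_sum, chi_row, mul_one]
  cut := fun U hU => by
    rw [cut_sum]; apply Finset.sum_le_sum; intro σ h
    rw [cut_chi]
    have : (1 : ℚ) ≤ cr U σ := by exact_mod_cast one_le_cr (hs σ h) hU
    nlinarith [hc σ h]

/-- uniform small constants -/
theorem finpos {ι : Type} [Finite ι] (P : ι → ℚ → Prop) (h : ∀ i, ∃ e0 : ℚ, 0 < e0 ∧ ∀ e, 0 < e → e ≤ e0 → P i e) :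
    ∃ e0 : ℚ, 0 < e0 ∧ ∀ e, 0 < e → e ≤ e0 → ∀ i, P i e := by
  choose f hf hP using h
  cases isEmpty_or_nonempty ι
  · exact ⟨1, one_pos, fun e _ _ i => isEmptyElim i⟩
  · obtain ⟨i0, hi0⟩ := Finite.exists_min f
    exact ⟨f i0, hf i0, fun e h1 h2 i => hP i e h1 (h2.trans (hi0 i))⟩

theorem lin_pos {α β : ℚ} (h : 0 ≤ α) (h' : α = 0 → 0 ≤ β) : ∃ e0 : ℚ, 0 < e0 ∧ ∀ e, 0 < e → e ≤ e0 → 0 ≤ α + e * β := by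
  by_cases h0 : α = 0
  · exact ⟨1, one_pos, fun e he _ => by rw [h0, zero_add]; exact mul_nonneg he.le (h' h0)⟩
  · have hp : 0 < α := lt_of_le_of_ne h (Ne.symm h0)
    refine ⟨α / (|β| + 1), by positivity, fun e he h1 => ?_⟩
    rw [le_div_iff₀ (by positivity)] at h1
    have := neg_abs_le β
    nlinarith [abs_nonneg β]

theorem perturb {y z : V → V → ℚ} {r ρ : ℚ} (hy : Adm y r) (hs : ∀ a b, z a b = z b a) (hd : ∀ a, z a a = 0)
    (hr : ∀ a, ∑ b, z a b = ρ) (h0 : ∀ a b, y a b = 0 → 0 ≤ z a b)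
    (ht : ∀ U : Finset V, Odd U.card → cut y U = r → ρ ≤ cut z U) :
    ∃ e0 : ℚ, 0 < e0 ∧ ∀ e, 0 < e → e ≤ e0 → Adm (fun a b => y a b + e * z a b) (r + e * ρ) := by
  obtain ⟨e1, p1, h1⟩ := finpos (fun (i : V × V) e => 0 ≤ y i.1 i.2 + e * z i.1 i.2)
    (fun i => lin_pos (hy.nn _ _) (h0 _ _))
  obtain ⟨e2, p2, h2⟩ := finpos (fun (U : {U : Finset V // Odd U.card}) e => 0 ≤ (cut y U.1 - r) + e * (cut z U.1 - ρ))
    (fun U => lin_pos (by linarith [hy.cut U.1 U.2]) (fun h => by linarith [ht U.1 U.2 (by linarith)]))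
  refine ⟨min e1 e2, lt_min p1 p2, fun e he hle => ⟨?_, ?_, ?_, ?_, ?_⟩⟩
  · intro a b; rw [hy.symm, hs]
  · intro a; rw [hy.diag, hd]; simp
  · intro a b; exact h1 e he (hle.trans (min_le_left _ _)) (a, b)
  · intro a; rw [Finset.sum_add_distrib, hy.row, ← Finset.mul_sum, hr]
  · intro U hU
    have := h2 e he (hle.trans (min_le_right _ _)) ⟨U, hU⟩
    have e3 := cut_lin y z 1 e U
    simp only [one_mul] at e3
    rw [e3]; simp only at this; linarith

/-- three way transport -/
theorem transport (D : Subring ℚ) {I J A B : Type} [Fintype I] [Fintype J] [Fintype A] [Fintype B]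
    (α : I → A) (β : J → B) (n : ℕ) : ∀ (c : I → ℚ) (d : J → ℚ) (x : A → B → ℚ),
    (∀ i, 0 ≤ c i) → (∀ i, c i ∈ D) → (∀ i, 0 ≤ d i) → (∀ i, d i ∈ D) → (∀ a b, 0 ≤ x a b) → (∀ a b, x a b ∈ D) →
    (∀ a, ∑ i, (if α i = a then c i else 0) = ∑ b, x a b) → (∀ b, ∑ j, (if β j = b then d j else 0) = ∑ a, x a b) →
    (univ.filter (fun i => c i ≠ 0)).card + (univ.filter (fun i => d i ≠ 0)).card +
      (univ.filter (fun i : A × B => x i.1 i.2 ≠ 0)).card = n →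
    ∃ T : I → J → ℚ, (∀ i j, 0 ≤ T i j) ∧ (∀ i j, T i j ∈ D) ∧ (∀ i, ∑ j, T i j = c i) ∧ (∀ j, ∑ i, T i j = d j) ∧
      ∀ a b, ∑ i, ∑ j, (if α i = a ∧ β j = b then T i j else 0) = x a b := by
  induction n using Nat.strong_induction_on with
  | _ n ih =>
  intro c d x c0 cD d0 dD x0 xD hc hd hn
  by_cases hx : ∀ a b, x a b = 0
  · have c00 : ∀ i, c i = 0 := by
      intro i
      have := hc (α i)
      rw [Finset.sum_eq_zero (s := univ) (f := fun b => x (α i) b) (fun b _ => hx _ b)] at this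
      rw [Finset.sum_eq_zero_iff_of_nonneg (fun j _ => by split_ifs <;> simp [c0])] at this
      simpa using this i (mem_univ _)
    have d00 : ∀ i, d i = 0 := by
      intro i
      have := hd (β i)
      rw [Finset.sum_eq_zero (s := univ) (f := fun b => x b (β i)) (fun b _ => hx b _)] at this
      rw [Finset.sum_eq_zero_iff_of_nonneg (fun j _ => by split_ifs <;> simp [d0])] at this
      simpa using this i (mem_univ _)
    exact ⟨fun _ _ => 0, by simp, fun _ _ => D.zero_mem, by simp [c00], by simp [d00], by simp [hx]⟩
  · push Not at hx
    obtain ⟨a, b, hab⟩ := hx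
    have xp : 0 < x a b := lt_of_le_of_ne (x0 a b) (Ne.symm hab)
    obtain ⟨i, hia, hi⟩ : ∃ i, α i = a ∧ c i ≠ 0 := by
      by_contra hcc
      push Not at hcc
      have h1 := hc a
      rw [Finset.sum_eq_zero (fun i _ => by by_cases h : α i = a <;> simp [h]; exact hcc i h)] at h1
      have := (Finset.sum_eq_zero_iff_of_nonneg (fun b _ => x0 a b)).1 h1.symm b (mem_univ _)
      exact hab this
    obtain ⟨j, hjb, hj⟩ : ∃ j, β j = b ∧ d j ≠ 0 := by
      by_contra hcc
      push Not at hcc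
      have h1 := hd b
      rw [Finset.sum_eq_zero (fun i _ => by by_cases h : β i = b <;> simp [h]; exact hcc i h)] at h1
      have := (Finset.sum_eq_zero_iff_of_nonneg (fun a _ => x0 a b)).1 h1.symm a (mem_univ _)
      exact hab this
    have cp : 0 < c i := lt_of_le_of_ne (c0 i) (Ne.symm hi)
    have dp : 0 < d j := lt_of_le_of_ne (d0 j) (Ne.symm hj)
    obtain ⟨m, mp, mc, md, mx, mD, mcase⟩ : ∃ m : ℚ, 0 < m ∧ m ≤ c i ∧ m ≤ d j ∧ m ≤ x a b ∧ m ∈ D ∧ (m = c i ∨ m = d j ∨ m = x a b) := by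
      rcases le_total (c i) (d j) with h1 | h1
      · rcases le_total (c i) (x a b) with h2 | h2
        · exact ⟨c i, cp, le_rfl, h1, h2, cD i, by tauto⟩
        · exact ⟨x a b, xp, h2, h2.trans h1, le_rfl, xD a b, by tauto⟩
      · rcases le_total (d j) (x a b) with h2 | h2
        · exact ⟨d j, dp, h1, le_rfl, h2, dD j, by tauto⟩
        · exact ⟨x a b, xp, h2.trans h1, h2, le_rfl, xD a b, by tauto⟩
    have s1 : (univ.filter (fun k => c k - (if k = i then m else 0) ≠ 0)) ⊆ univ.filter (fun k => c k ≠ 0) := by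
      intro k; simp only [mem_filter, mem_univ, true_and]; by_cases h : k = i
      · subst h; tauto
      · simp [h]
    have s2 : (univ.filter (fun k => d k - (if k = j then m else 0) ≠ 0)) ⊆ univ.filter (fun k => d k ≠ 0) := by
      intro k; simp only [mem_filter, mem_univ, true_and]; by_cases h : k = j
      · subst h; tauto
      · simp [h]
    have s3 : (univ.filter (fun k : A × B => x k.1 k.2 - (if k.1 = a ∧ k.2 = b then m else 0) ≠ 0)) ⊆ univ.filter (fun k : A × B => x k.1 k.2 ≠ 0) := by
      intro k; simp only [mem_filter, mem_univ, true_and]; by_cases h : k.1 = a ∧ k.2 = b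
      · rw [h.1, h.2]; tauto
      · simp [h]
    have hlt : (univ.filter (fun k => c k - (if k = i then m else 0) ≠ 0)).card + (univ.filter (fun k => d k - (if k = j then m else 0) ≠ 0)).card +
      (univ.filter (fun k : A × B => x k.1 k.2 - (if k.1 = a ∧ k.2 = b then m else 0) ≠ 0)).card < n := by
      have l1 := Finset.card_le_card s1
      have l2 := Finset.card_le_card s2
      have l3 := Finset.card_le_card s3
      rcases mcase with h | h | h
      · have := Finset.card_lt_card (Finset.ssubset_iff_subset_ne.2 ⟨s1, fun he => by
          have : i ∈ univ.filter (fun k => c k ≠ 0) := by simp [hi]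
          rw [← he] at this; simp [h] at this⟩)
        omega
      · have := Finset.card_lt_card (Finset.ssubset_iff_subset_ne.2 ⟨s2, fun he => by
          have : j ∈ univ.filter (fun k => d k ≠ 0) := by simp [hj]
          rw [← he] at this; simp [h] at this⟩)
        omega
      · have := Finset.card_lt_card (Finset.ssubset_iff_subset_ne.2 ⟨s3, fun he => by
          have : (a, b) ∈ univ.filter (fun k : A × B => x k.1 k.2 ≠ 0) := by simp [hab]
          rw [← he] at this; simp [h] at this⟩)
        omega
    obtain ⟨T, T0, TD, Tc, Td, Tx⟩ := ih _ hlt (fun k => c k - (if k = i then m else 0)) (fun k => d k - (if k = j then m else 0))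
      (fun k l => x k l - (if k = a ∧ l = b then m else 0))
      (by intro k; by_cases h : k = i
          · subst h; simp [mc]
          · simp [h, c0])
      (by intro k; apply D.sub_mem (cD k); split_ifs; exacts [mD, D.zero_mem])
      (by intro k; by_cases h : k = j
          · subst h; simp [md]
          · simp [h, d0])
      (by intro k; apply D.sub_mem (dD k); split_ifs; exacts [mD, D.zero_mem])
      (by intro k l; by_cases h : k = a ∧ l = b
          · rw [h.1, h.2]; simp [mx]
          · simp [h, x0])
      (by intro k l; apply D.sub_mem (xD k l); split_ifs; exacts [mD, D.zero_mem])
      (by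
        intro k
        rw [Finset.sum_sub_distrib, ← hc k]
        have : ∀ l, (if α l = k then c l - (if l = i then m else 0) else 0) = (if α l = k then c l else 0) - (if l = i then (if α i = k then m else 0) else 0) := by
          intro l; by_cases h : l = i
          · subst h; split_ifs <;> simp
          · simp [h]
        simp only [this]
        rw [Finset.sum_sub_distrib]
        congr 1
        rw [Finset.sum_ite_eq' univ i, if_pos (mem_univ _), hia]
        by_cases h : a = k
        · subst h; simp
        · simp [h, Ne.symm h])
      (by
        intro k
        rw [Finset.sum_sub_distrib, ← hd k]
        have : ∀ l, (if β l = k then d l - (if l = j then m else 0) else 0) = (if β l = k then d l else 0) - (if l = j then (if β j = k then m else 0) else 0) := by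
          intro l; by_cases h : l = j
          · subst h; split_ifs <;> simp
          · simp [h]
        simp only [this]
        rw [Finset.sum_sub_distrib]
        congr 1
        rw [Finset.sum_ite_eq' univ j, if_pos (mem_univ _), hjb]
        by_cases h : b = k
        · subst h; simp
        · simp [h, Ne.symm h]) rfl
    refine ⟨fun k l => T k l + (if k = i ∧ l = j then m else 0), ?_, ?_, ?_, ?_, ?_⟩
    · intro k l; apply add_nonneg (T0 k l); split_ifs; exacts [mp.le, le_rfl]
    · intro k l; apply D.add_mem (TD k l); split_ifs; exacts [mD, D.zero_mem]
    · intro k; rw [Finset.sum_add_distrib, Tc k]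
      by_cases h : k = i
      · simp [h]
      · simp [h]
    · intro k; rw [Finset.sum_add_distrib, Td k]
      by_cases h : k = j
      · simp [h]
      · simp [h]
    · intro k l
      have e : ∀ u v, (if α u = k ∧ β v = l then T u v + (if u = i ∧ v = j then m else 0) else 0) =
        (if α u = k ∧ β v = l then T u v else 0) + (if u = i then (if v = j then (if a = k ∧ b = l then m else 0) else 0) else 0) := by
        intro u v
        by_cases h : u = i
        · by_cases h' : v = j
          · subst h; subst h'; rw [hia, hjb]; by_cases h3 : a = k ∧ b = l <;> simp only [h3, if_true, if_false, and_self, add_zero]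
          · simp [h, h']
        · simp [h]
      simp only [e, Finset.sum_add_distrib, Tx]
      have : (∑ u, ∑ v, (if u = i then (if v = j then (if a = k ∧ b = l then m else 0) else 0) else 0)) = (if k = a ∧ l = b then m else 0) := by
        rw [Finset.sum_eq_single i (by intro u _ h; simp [h]) (by simp)]
        rw [Finset.sum_eq_single j (by intro u _ h; simp [h]) (by simp)]
        simp [eq_comm]
      rw [this]; ring

end MatchingCone


section Contraction
variable {V : Type} [Fintype V]

theorem inD_of_family (D : Subring ℚ) {I : Type} [Fintype I] (c : I → ℚ) (s : I → V → V) (h0 : ∀ i, 0 ≤ c i)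
    (hD : ∀ i, c i ∈ D) (hp : ∀ i, c i ≠ 0 → IsPM (s i)) {x : V → V → ℚ}
    (hx : ∀ a b, x a b = ∑ i, c i * chi (s i) a b) : InD D x := by
  refine ⟨fun σ => ∑ i, if s i = σ then c i else 0, ?_, ?_, ?_, ?_⟩
  · intro σ; apply Finset.sum_nonneg; intro i _; split_ifs; exacts [h0 i, le_rfl]
  · intro σ; apply D.sum_mem; intro i _; split_ifs; exacts [hD i, D.zero_mem]
  · intro σ hσ
    obtain ⟨i, _, hi⟩ := Finset.exists_ne_zero_of_sum_ne_zero hσ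
    by_cases h : s i = σ
    · rw [if_pos h] at hi; rw [← h]; exact hp i hi
    · rw [if_neg h] at hi; exact absurd rfl hi
  · intro a b
    rw [hx]
    simp only [Finset.sum_mul]
    rw [Finset.sum_comm]
    apply Finset.sum_congr rfl; intro i _
    rw [Finset.sum_eq_single (s i)]
    · simp
    · intro σ _ h; rw [if_neg (Ne.symm h)]; simp
    · simp

theorem cut_eq (x : V → V → ℚ) (U : Finset V) : cut x U = ∑ v, ∑ w, if v ∈ U ∧ w ∉ U then x v w else 0 := by
  unfold cut
  rw [← Finset.sum_filter_add_sum_filter_not univ (fun v => v ∈ U)]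
  have h2 : ∑ v ∈ univ.filter (fun v => v ∉ U), ∑ w, (if v ∈ U ∧ w ∉ U then x v w else 0) = 0 := by
    apply Finset.sum_eq_zero; intro v hv; apply Finset.sum_eq_zero; intro w _
    rw [mem_filter] at hv; rw [if_neg (fun h => hv.2 h.1)]
  rw [h2, add_zero]
  have : univ.filter (fun v => v ∈ U) = U := by ext; simp
  rw [this]
  apply Finset.sum_congr rfl; intro a ha
  rw [← Finset.sum_filter_add_sum_filter_not univ (fun v => v ∉ U)]
  rw [Finset.sum_eq_zero (s := univ.filter (fun v => ¬ v ∉ U)), add_zero]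
  · have : univ.filter (fun v => v ∉ U) = Uᶜ := by ext; simp
    rw [this]
    apply Finset.sum_congr rfl; intro b hb
    rw [if_pos ⟨ha, by simpa using hb⟩]
  · intro b hb; rw [mem_filter] at hb; rw [if_neg (fun h => hb.2 h.2)]

noncomputable def contr {W : Type} (π : V → W) (x : V → V → ℚ) (a b : W) : ℚ :=
  if a = b then 0 else ∑ v, ∑ w, if π v = a ∧ π w = b then x v w else 0

theorem cut_contr {W : Type} [Fintype W] (π : V → W) (x : V → V → ℚ) (S : Finset W) :
    cut (contr π x) S = cut x (univ.filter (fun v => π v ∈ S)) := by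
  rw [cut_eq x]
  unfold cut
  have h1 : ∀ a ∈ S, ∀ b ∈ Sᶜ, contr π x a b = ∑ v, ∑ w, if π v = a ∧ π w = b then x v w else 0 := by
    intro a ha b hb
    unfold contr
    rw [if_neg]; rintro rfl; rw [mem_compl] at hb; exact hb ha
  rw [Finset.sum_congr rfl (fun a ha => Finset.sum_congr rfl (fun b hb => h1 a ha b hb))]
  rw [Finset.sum_congr rfl (fun a ha => Finset.sum_comm), Finset.sum_comm]
  apply Finset.sum_congr rfl; intro v _
  rw [Finset.sum_congr rfl (fun a ha => Finset.sum_comm), Finset.sum_comm]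
  apply Finset.sum_congr rfl; intro w _
  by_cases h : π v ∈ S ∧ π w ∉ S
  · rw [if_pos (by simpa using h)]
    rw [Finset.sum_eq_single (π v), Finset.sum_eq_single (π w)]
    · simp
    · intro b _ hb; rw [if_neg]; rintro ⟨_, h⟩; exact hb h.symm
    · intro hc; exact absurd (by simpa using h.2) hc
    · intro a _ ha; apply Finset.sum_eq_zero; intro b _; rw [if_neg]; rintro ⟨h, _⟩; exact ha h.symm
    · intro hc; exact absurd h.1 hc
  · rw [if_neg (by simpa using h)]
    apply Finset.sum_eq_zero; intro a ha; apply Finset.sum_eq_zero; intro b hb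
    rw [if_neg]; rintro ⟨rfl, rfl⟩; exact h ⟨ha, by simpa using hb⟩

theorem adm_contr {W : Type} [Fintype W] (π : V → W) {x : V → V → ℚ} {r : ℚ} (h : Adm x r)
    (ho : ∀ a, Odd (univ.filter (fun v => π v = a)).card) (ht : ∀ a, cut x (univ.filter (fun v => π v = a)) = r) :
    Adm (contr π x) r where
  symm := by
    intro a b; unfold contr
    by_cases hab : a = b
    · rw [if_pos hab, if_pos hab.symm]
    · rw [if_neg hab, if_neg (Ne.symm hab), Finset.sum_comm]
      apply Finset.sum_congr rfl; intro v _; apply Finset.sum_congr rfl; intro w _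
      rw [h.symm]; simp only [and_comm]
  diag := fun a => by unfold contr; rw [if_pos rfl]
  nn := by
    intro a b; unfold contr
    split_ifs
    · exact le_rfl
    · apply Finset.sum_nonneg; intro v _; apply Finset.sum_nonneg; intro w _
      split_ifs; exacts [h.nn _ _, le_rfl]
  row := by
    intro a
    rw [← cut_single (fun a => by unfold contr; rw [if_pos rfl]), cut_contr, ← ht a]
    congr 1; ext v; simp
  cut := by
    intro S hS
    rw [cut_contr]
    apply h.cut
    have : (univ.filter (fun v => π v ∈ S)).card = ∑ a ∈ S, (univ.filter (fun v => π v = a)).card := by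
      rw [Finset.card_eq_sum_card_fiberwise (f := π) (t := S)]
      · apply Finset.sum_congr rfl; intro a ha
        congr 1; ext v; simp; intro h; rw [h]; exact ha
      · intro v hv; simpa using hv
    rw [this, Finset.odd_sum_iff_odd_card_odd]
    rwa [Finset.filter_true_of_mem (fun a _ => ho a)]

/-- contraction of the complement of `p` to a point -/
noncomputable def sidep (p : V → Prop) (v : V) : Option {v // p v} := if h : p v then some ⟨v, h⟩ else none

theorem sidep_some (p : V → Prop) (v : V) (u : {v // p v}) : sidep p v = some u ↔ v = u.1 := by
  unfold sidep
  by_cases h : p v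
  · rw [dif_pos h, Option.some_inj]
    exact ⟨fun e => by rw [← e], fun e => Subtype.ext e⟩
  · rw [dif_neg h]
    constructor
    · intro e; cases e
    · intro e; exact absurd (e ▸ u.2) h

theorem sidep_none (p : V → Prop) (v : V) : sidep p v = none ↔ ¬ p v := by
  unfold sidep
  by_cases h : p v
  · rw [dif_pos h]; simp [h]
  · rw [dif_neg h]; simp [h]

theorem adm_side (p : V → Prop) {x : V → V → ℚ} {r : ℚ} (h : Adm x r)
    (ho : Odd (univ.filter (fun v => ¬ p v)).card) (ht : cut x (univ.filter (fun v => ¬ p v)) = r) :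
    Adm (contr (sidep p) x) r := by
  have e1 : ∀ (u : {v // p v}) (I : DecidablePred fun v => sidep p v = some u),
      @Finset.filter V (fun v => sidep p v = some u) I univ = {u.1} := by
    intro u I; ext v; simp [sidep_some]
  have e2 : ∀ (I : DecidablePred fun v => sidep p v = none),
      @Finset.filter V (fun v => sidep p v = none) I univ = univ.filter (fun v => ¬ p v) := by
    intro I; ext v; simp [sidep_none]
  apply adm_contr _ h
  · rintro (_ | u)
    · rw [e2]; exact ho
    · rw [e1]; simp
  · rintro (_ | u)
    · rw [e2]; exact ht
    · rw [e1, cut_single h.diag, h.row]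

theorem contr_some (p : V → Prop) {x : V → V → ℚ} (hd : ∀ a, x a a = 0) (u w : {v // p v}) :
    contr (sidep p) x (some u) (some w) = x u.1 w.1 := by
  unfold contr
  by_cases h : u = w
  · rw [if_pos (by rw [h]), h, hd]
  · rw [if_neg (by rwa [Option.some_inj])]
    simp only [sidep_some]
    rw [Finset.sum_eq_single u.1, Finset.sum_eq_single w.1]
    · simp
    · intro b _ hb; simp [hb]
    · simp
    · intro b _ hb; simp [hb]
    · simp

theorem sum_sub (q : V → Prop) [Fintype {v // q v}] (f : V → ℚ) : ∑ b : {v // q v}, f b.1 = ∑ v, if q v then f v else 0 := by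
  rw [← Finset.sum_filter]
  symm
  apply Finset.sum_subtype
  simp

theorem contr_none (p : V → Prop) (x : V → V → ℚ) (u : {v // p v}) :
    contr (sidep p) x none (some u) = ∑ w : {v // ¬ p v}, x w.1 u.1 := by
  unfold contr
  rw [if_neg (by simp), sum_sub (fun v => ¬ p v) (fun w => x w u.1)]
  apply Finset.sum_congr rfl; intro v _
  simp only [sidep_some, sidep_none]
  by_cases h : p v
  · simp [h]
  · simp [h]

noncomputable def glue (p : V → Prop) (σ : Option {v // p v} → Option {v // p v})
    (τ : Option {v // ¬ p v} → Option {v // ¬ p v}) (v : V) : V :=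
  if h : p v then (σ (some ⟨v, h⟩)).elim ((τ none).elim v Subtype.val) Subtype.val
  else (τ (some ⟨v, h⟩)).elim ((σ none).elim v Subtype.val) Subtype.val

section
variable {p : V → Prop} {σ : Option {v // p v} → Option {v // p v}}
    {τ : Option {v // ¬ p v} → Option {v // ¬ p v}}

theorem glue_ss {v : V} (h : p v) {u} (e : σ (some ⟨v, h⟩) = some u) : glue p σ τ v = u.1 := by
  unfold glue; rw [dif_pos h, e]; rfl

theorem glue_sn {v : V} (h : p v) {w} (e : σ (some ⟨v, h⟩) = none) (e' : τ none = some w) : glue p σ τ v = w.1 := by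
  unfold glue; rw [dif_pos h, e, e']; rfl

theorem glue_tt {v : V} (h : ¬ p v) {u} (e : τ (some ⟨v, h⟩) = some u) : glue p σ τ v = u.1 := by
  unfold glue; rw [dif_neg h, e]; rfl

theorem glue_tn {v : V} (h : ¬ p v) {w} (e : τ (some ⟨v, h⟩) = none) (e' : σ none = some w) : glue p σ τ v = w.1 := by
  unfold glue; rw [dif_neg h, e, e']; rfl

theorem glue_pm (hσ : IsPM σ) (hτ : IsPM τ) : IsPM (glue p σ τ) := by
  obtain ⟨a, ha⟩ : ∃ a, σ none = some a := Option.ne_none_iff_exists'.1 (hσ.2 none)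
  obtain ⟨b, hb⟩ : ∃ a, τ none = some a := Option.ne_none_iff_exists'.1 (hτ.2 none)
  have ha' : σ (some a) = none := by rw [← ha, hσ.1]
  have hb' : τ (some b) = none := by rw [← hb, hτ.1]
  have ga : glue p σ τ a.1 = b.1 := glue_sn a.2 ha' hb
  have gb : glue p σ τ b.1 = a.1 := glue_tn b.2 hb' ha
  constructor
  · intro v
    by_cases h : p v
    · cases e : σ (some ⟨v, h⟩) with
      | none =>
        have : (⟨v, h⟩ : {v // p v}) = a := by
          have := hσ.1 (some ⟨v, h⟩); rw [e, ha, Option.some_inj] at this; exact this.symm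
        have : v = a.1 := by rw [← this]
        rw [this, ga, gb]
      | some u =>
        rw [glue_ss h e]
        exact glue_ss (u := ⟨v, h⟩) u.2 (by have := hσ.1 (some ⟨v, h⟩); rw [e] at this; exact this)
    · cases e : τ (some ⟨v, h⟩) with
      | none =>
        have : (⟨v, h⟩ : {v // ¬ p v}) = b := by
          have := hτ.1 (some ⟨v, h⟩); rw [e, hb, Option.some_inj] at this; exact this.symm
        have : v = b.1 := by rw [← this]
        rw [this, gb, ga]
      | some u =>
        rw [glue_tt h e]
        exact glue_tt (u := ⟨v, h⟩) u.2 (by have := hτ.1 (some ⟨v, h⟩); rw [e] at this; exact this)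
  · intro v hv
    by_cases h : p v
    · cases e : σ (some ⟨v, h⟩) with
      | none => rw [glue_sn h e hb] at hv; exact b.2 (hv ▸ h)
      | some u =>
        rw [glue_ss h e] at hv
        exact hσ.2 (some ⟨v, h⟩) (by rw [e, Option.some_inj]; exact Subtype.ext hv)
    · cases e : τ (some ⟨v, h⟩) with
      | none => rw [glue_tn h e ha] at hv; exact h (hv ▸ a.2)
      | some u =>
        rw [glue_tt h e] at hv
        exact hτ.2 (some ⟨v, h⟩) (by rw [e, Option.some_inj]; exact Subtype.ext hv)

theorem glue_pp (hσ : IsPM σ) (hτ : IsPM τ) (u w : {v // p v}) : glue p σ τ u.1 = w.1 ↔ σ (some u) = some w := by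
  obtain ⟨b, hb⟩ : ∃ a, τ none = some a := Option.ne_none_iff_exists'.1 (hτ.2 none)
  cases e : σ (some u) with
  | none => rw [glue_sn u.2 e hb]; simp; intro h; exact b.2 (h ▸ w.2)
  | some t => rw [glue_ss u.2 e, Option.some_inj]; exact ⟨fun h => Subtype.ext h, fun h => by rw [h]⟩

theorem glue_nn (hσ : IsPM σ) (hτ : IsPM τ) (u w : {v // ¬ p v}) : glue p σ τ u.1 = w.1 ↔ τ (some u) = some w := by
  obtain ⟨b, hb⟩ : ∃ a, σ none = some a := Option.ne_none_iff_exists'.1 (hσ.2 none)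
  cases e : τ (some u) with
  | none => rw [glue_tn u.2 e hb]; simp; intro h; exact w.2 (h ▸ b.2)
  | some t => rw [glue_tt u.2 e, Option.some_inj]; exact ⟨fun h => Subtype.ext h, fun h => by rw [h]⟩

theorem glue_pn (hσ : IsPM σ) (hτ : IsPM τ) (u : {v // p v}) (w : {v // ¬ p v}) :
    glue p σ τ u.1 = w.1 ↔ σ none = some u ∧ τ none = some w := by
  obtain ⟨b, hb⟩ : ∃ a, τ none = some a := Option.ne_none_iff_exists'.1 (hτ.2 none)
  cases e : σ (some u) with
  | none =>
    have : σ none = some u := by rw [← e, hσ.1]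
    rw [glue_sn u.2 e hb, this, hb]
    simp [Subtype.ext_iff]
  | some t =>
    rw [glue_ss u.2 e]
    constructor
    · intro h; exact absurd (h ▸ t.2) w.2
    · rintro ⟨h, _⟩; have := hσ.1 none; rw [h, e] at this; cases this
end

theorem glueing (D : Subring ℚ) (p : V → Prop) {x : V → V → ℚ} (hs : ∀ a b, x a b = x b a) (hd : ∀ a, x a a = 0)
    (x0 : ∀ a b, 0 ≤ x a b) (xD : ∀ a b, x a b ∈ D)
    (h1 : InD D (contr (sidep p) x)) (h2 : InD D (contr (sidep (fun v => ¬ p v)) x)) : InD D x := by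
  obtain ⟨c, c0, cD, cp, hc⟩ := h1
  obtain ⟨d, d0, dD, dp, hd2⟩ := h2
  replace hc : ∀ a b, contr (sidep p) x a b = ∑ σ, c σ * chi σ a b := by
    intro a b; rw [hc]; refine Finset.sum_congr ?_ (fun _ _ => rfl); ext; simp
  replace hd2 : ∀ a b, contr (sidep (fun v => ¬ p v)) x a b = ∑ σ, d σ * chi σ a b := by
    intro a b; rw [hd2]; refine Finset.sum_congr ?_ (fun _ _ => rfl); ext; simp
  let X : Option {v // p v} → Option {v // ¬ p v} → ℚ := fun a b => a.elim 0 (fun u => b.elim 0 (fun w => x u.1 w.1))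
  have hX : ∀ u w, X (some u) (some w) = x u.1 w.1 := fun u w => rfl
  have hXn : ∀ w, X none w = 0 := fun w => rfl
  have hXn' : ∀ w, X w none = 0 := by rintro (_ | w) <;> rfl
  obtain ⟨T, T0, TD, Tc, Td, TX⟩ := transport D (fun σ : Option {v // p v} → Option {v // p v} => σ none)
    (fun τ : Option {v // ¬ p v} → Option {v // ¬ p v} => τ none) _ c d X c0 cD d0 dD
    (by rintro (_ | u) (_ | w) <;> simp [hX, hXn, hXn', x0])
    (by rintro (_ | u) (_ | w) <;> simp [hX, hXn, hXn', xD])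
    (by
      intro a
      have e : ∑ σ, (if σ none = a then c σ else 0) = contr (sidep p) x none a := by
        rw [hc]; apply Finset.sum_congr rfl; intro σ _; unfold chi; split_ifs <;> simp
      trans contr (sidep p) x none a
      · convert e
      rcases a with _ | u
      · simp [hXn, contr]
      · rw [contr_none, Fintype.sum_option, hXn', zero_add]
        apply Finset.sum_congr rfl; intro w _; rw [hX, hs])
    (by
      intro a
      have e : ∑ σ, (if σ none = a then d σ else 0) = contr (sidep (fun v => ¬ p v)) x none a := by
        rw [hd2]; apply Finset.sum_congr rfl; intro σ _; unfold chi; split_ifs <;> simp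
      trans contr (sidep (fun v => ¬ p v)) x none a
      · convert e
      rcases a with _ | u
      · simp [hXn', contr]
      · rw [contr_none, Fintype.sum_option, hXn, zero_add]
        simp only [hX]
        rw [sum_sub p (fun w => x w u.1)]
        trans ∑ v, (if ¬ ¬ p v then x v u.1 else 0)
        · convert sum_sub (fun v => ¬ ¬ p v) (fun w => x w u.1)
        simp only [not_not]) rfl
  have hσ : ∀ σ τ, T σ τ ≠ 0 → IsPM σ := by
    intro σ τ h
    apply cp
    intro h0
    have := Tc σ
    rw [h0, Finset.sum_eq_zero_iff_of_nonneg (fun j _ => T0 _ _)] at this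
    exact h (this τ (mem_univ _))
  have hτ : ∀ σ τ, T σ τ ≠ 0 → IsPM τ := by
    intro σ τ h
    apply dp
    intro h0
    have := Td τ
    rw [h0, Finset.sum_eq_zero_iff_of_nonneg (fun j _ => T0 _ _)] at this
    exact h (this σ (mem_univ _))
  have key : ∀ u w, x u w = ∑ σ, ∑ τ, T σ τ * chi (glue p σ τ) u w := by
    have kpn : ∀ (u : {v // p v}) (w : {v // ¬ p v}), x u.1 w.1 = ∑ σ, ∑ τ, T σ τ * chi (glue p σ τ) u.1 w.1 := by
      intro u w
      rw [← hX, ← TX]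
      apply Finset.sum_congr rfl; intro σ _; apply Finset.sum_congr rfl; intro τ _
      by_cases h : T σ τ = 0
      · simp [h]
      · unfold chi; simp only [glue_pn (hσ σ τ h) (hτ σ τ h)]; split_ifs <;> simp
    intro u w
    by_cases hu : p u <;> by_cases hw : p w
    · rw [← contr_some p hd ⟨u, hu⟩ ⟨w, hw⟩, hc]
      apply Finset.sum_congr rfl; intro σ _
      rw [← Tc σ, Finset.sum_mul]
      apply Finset.sum_congr rfl; intro τ _
      by_cases h : T σ τ = 0
      · simp [h]
      · unfold chi; simp only [← glue_pp (hσ σ τ h) (hτ σ τ h)]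
    · exact kpn ⟨u, hu⟩ ⟨w, hw⟩
    · rw [hs, kpn ⟨w, hw⟩ ⟨u, hu⟩]
      apply Finset.sum_congr rfl; intro σ _; apply Finset.sum_congr rfl; intro τ _
      by_cases h : T σ τ = 0
      · simp [h]
      · rw [chi_symm (glue_pm (hσ σ τ h) (hτ σ τ h))]
    · rw [← contr_some (fun v => ¬ p v) hd ⟨u, hu⟩ ⟨w, hw⟩, hd2, Finset.sum_comm]
      apply Finset.sum_congr rfl; intro τ _
      rw [← Td τ, Finset.sum_mul]
      apply Finset.sum_congr rfl; intro σ _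
      by_cases h : T σ τ = 0
      · simp [h]
      · unfold chi; simp only [← glue_nn (hσ σ τ h) (hτ σ τ h)]
  refine inD_of_family D (fun i : (Option {v // p v} → Option {v // p v}) × (Option {v // ¬ p v} → Option {v // ¬ p v}) => T i.1 i.2)
    (fun i => glue p i.1 i.2) (fun i => T0 _ _) (fun i => TD _ _) (fun i h => glue_pm (hσ _ _ h) (hτ _ _ h)) ?_
  intro a b
  rw [key, Fintype.sum_prod_type]

theorem contr_mem (D : Subring ℚ) {W : Type} (π : V → W) {x : V → V → ℚ} (xD : ∀ a b, x a b ∈ D) (a b : W) :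
    contr π x a b ∈ D := by
  unfold contr
  split_ifs
  · exact D.zero_mem
  · apply D.sum_mem; intro v _; apply D.sum_mem; intro w _; split_ifs; exacts [xD _ _, D.zero_mem]

theorem reduce_p (D : Subring ℚ) {x : V → V → ℚ} {r : ℚ} (h : Adm x r) (xD : ∀ a b, x a b ∈ D)
    (ih : ∀ (W : Type) [Fintype W], Fintype.card W < Fintype.card V → ∀ (y : W → W → ℚ) (s : ℚ), Adm y s →
      (∀ a b, y a b ∈ D) → InD D y) (p : V → Prop) {U : Finset V} (hp : ∀ v, p v ↔ v ∈ U)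
    (hU : NTr U) (hU' : Odd (Uᶜ).card) (ht : cut x U = r) : InD D x := by
  have hc := Finset.card_compl_add_card U
  have e0 : univ.filter (fun v => ¬ ¬ p v) = U := by ext v; simp [hp]
  have e0' : univ.filter (fun v => p v) = U := by ext v; simp [hp]
  have e1 : univ.filter (fun v => ¬ p v) = Uᶜ := by ext v; simp [hp]
  have c1 : Fintype.card {v // p v} = U.card := by rw [Fintype.card_subtype, e0']
  have c2 : Fintype.card {v // ¬ p v} = (Uᶜ).card := by rw [Fintype.card_subtype, e1]
  have hUo := hU.1
  apply glueing D p h.symm h.diag h.nn xD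
  · refine ih _ ?_ _ r (adm_side _ h ?_ ?_) (contr_mem D _ xD)
    · rw [Fintype.card_option]; have := hU.2.1; have := hU.2.2; omega
    · rw [e1]; exact hU'
    · rw [e1, cut_compl h.symm, ht]
  · have := adm_side (fun v => ¬ p v) h (by convert hUo; ext v; simp [hp]) (by convert ht; ext v; simp [hp])
    refine ih _ ?_ _ r (by convert this) (contr_mem D _ xD)
    rw [Fintype.card_option]; have := hU.2.1; have := hU.2.2; omega

theorem reduce (D : Subring ℚ) {x : V → V → ℚ} {r : ℚ} (h : Adm x r) (xD : ∀ a b, x a b ∈ D) (hV : Even (Fintype.card V))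
    (ih : ∀ (W : Type) [Fintype W], Fintype.card W < Fintype.card V → ∀ (y : W → W → ℚ) (s : ℚ), Adm y s →
      (∀ a b, y a b ∈ D) → InD D y) {U : Finset V} (hU : NTr U) (ht : cut x U = r) : InD D x := by
  refine reduce_p D h xD ih (fun v => v ∈ U) (fun v => Iff.rfl) hU ?_ ht
  have hc := Finset.card_compl_add_card U
  obtain ⟨k, hk⟩ := hV; obtain ⟨j, hj⟩ := hU.1; exact ⟨k - j - 1, by omega⟩

end Contraction


section Edmonds
variable {V : Type} [Fintype V]

noncomputable def suppG {x : V → V → ℚ} {r : ℚ} (h : Adm x r) : SimpleGraph V where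
  Adj a b := x a b ≠ 0
  symm := ⟨fun a b hab => by rw [h.symm]; exact hab⟩
  loopless := ⟨fun a ha => ha (h.diag a)⟩

theorem no_violator {x : V → V → ℚ} {r : ℚ} (h : Adm x r) (hr : 0 < r) (u : Set V) : ¬ (suppG h).IsTutteViolator u := by
  unfold SimpleGraph.IsTutteViolator
  rw [not_lt]
  obtain ⟨S, hS⟩ : ∃ S : (suppG h).Subgraph, S = (⊤ : (suppG h).Subgraph).deleteVerts u := ⟨_, rfl⟩
  have hv : ∀ v, v ∈ S.verts ↔ v ∉ u := by intro v; rw [hS]; simp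
  have hadj : ∀ a b, a ∉ u → b ∉ u → x a b ≠ 0 → S.Adj a b := by
    intro a b ha hb hx; rw [hS]; rw [SimpleGraph.Subgraph.deleteVerts_adj]; exact ⟨trivial, ha, trivial, hb, hx⟩
  rw [← hS]
  have : Fintype S.coe.ConnectedComponent := Fintype.ofFinite _
  obtain ⟨O, hO⟩ : ∃ O : Finset S.coe.ConnectedComponent, O = univ.filter (fun c => Odd c.supp.ncard) := ⟨_, rfl⟩
  have e1 : S.coe.oddComponents.ncard = O.card := by
    rw [← Set.ncard_coe_finset]; congr 1; ext c; rw [hO]; simp [SimpleGraph.oddComponents]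
  have e2 : u.ncard = (univ.filter (fun v => v ∈ u)).card := by
    rw [← Set.ncard_coe_finset]; congr 1; ext c; simp
  rw [e1, e2]
  obtain ⟨Uf, hUf⟩ : ∃ Uf : Finset V, Uf = univ.filter (fun v => v ∈ u) := ⟨_, rfl⟩
  rw [← hUf]
  have mU : ∀ v, v ∈ Uf ↔ v ∈ u := fun v => by rw [hUf]; simp
  obtain ⟨l, hl⟩ : ∃ l : V → Option S.coe.ConnectedComponent,
      l = fun v => if h : v ∈ S.verts then some (S.coe.connectedComponentMk ⟨v, h⟩) else none := ⟨_, rfl⟩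
  have lv : ∀ (v : S.verts), l v.1 = some (S.coe.connectedComponentMk v) := by
    intro v; rw [hl]; simp only; rw [dif_pos v.2]
  have ln : ∀ v, v ∉ S.verts → l v = none := by
    intro v hv; rw [hl]; simp only; rw [dif_neg hv]
  have hodd : ∀ c ∈ O, Odd (univ.filter (fun v => l v = some c)).card := by
    intro c hc
    rw [hO, mem_filter] at hc
    have : (univ.filter (fun v => l v = some c)).card = c.supp.ncard := by
      rw [← Set.ncard_coe_finset, ← Set.ncard_image_of_injective c.supp Subtype.val_injective]
      congr 1; ext v
      simp only [coe_filter, mem_univ, true_and, Set.mem_ofPred_eq, Set.mem_image]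
      constructor
      · intro hv'
        by_cases hvv : v ∈ S.verts
        · refine ⟨⟨v, hvv⟩, ?_, rfl⟩
          rw [SimpleGraph.ConnectedComponent.mem_supp_iff]
          rw [lv ⟨v, hvv⟩, Option.some_inj] at hv'; exact hv'
        · rw [ln v hvv] at hv'; cases hv'
      · rintro ⟨w, hw, rfl⟩
        rw [SimpleGraph.ConnectedComponent.mem_supp_iff] at hw
        rw [lv, hw]
    rw [this]; exact hc.2
  have hcut : ∀ c ∈ O, r ≤ ∑ a, (if l a = some c then ∑ b ∈ Uf, x a b else 0) := by
    intro c hc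
    refine (h.cut _ (hodd c hc)).trans ?_
    unfold cut
    rw [← Finset.sum_filter]
    apply Finset.sum_le_sum
    intro a ha
    rw [mem_filter] at ha
    have hav : a ∈ S.verts := by by_contra hn; rw [ln a hn] at ha; cases ha.2
    rw [← Finset.sum_filter_ne_zero]
    refine Finset.sum_le_sum_of_subset_of_nonneg ?_ (fun b _ _ => h.nn a b)
    intro b hb'
    obtain ⟨hb, hx⟩ := mem_filter.1 hb'
    rw [mU]; by_contra hbu
    have hbv := (hv b).2 hbu
    rw [mem_compl, mem_filter] at hb
    apply hb
    refine ⟨mem_univ _, ?_⟩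
    rw [← ha.2, lv ⟨a, hav⟩, lv ⟨b, hbv⟩, Option.some_inj]
    symm
    apply SimpleGraph.ConnectedComponent.sound
    apply SimpleGraph.Adj.reachable
    exact hadj a b ((hv a).1 hav) hbu hx
  have h1 : (O.card : ℚ) * r ≤ ∑ c ∈ O, ∑ a, (if l a = some c then ∑ b ∈ Uf, x a b else 0) := by
    rw [← nsmul_eq_mul]; exact Finset.card_nsmul_le_sum _ _ _ hcut
  have h2 : ∑ c ∈ O, ∑ a, (if l a = some c then ∑ b ∈ Uf, x a b else 0) ≤ ∑ a, ∑ b ∈ Uf, x a b := by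
    rw [Finset.sum_comm]
    apply Finset.sum_le_sum; intro a _
    have g0 : 0 ≤ ∑ b ∈ Uf, x a b := Finset.sum_nonneg fun b _ => h.nn a b
    cases e : l a with
    | none => simp [g0]
    | some c0 =>
      simp only [Option.some_inj]
      rw [Finset.sum_ite_eq O c0]
      split_ifs; exacts [le_rfl, g0]
  have h3 : ∑ a, ∑ b ∈ Uf, x a b = Uf.card * r := by
    rw [Finset.sum_comm, Finset.sum_congr rfl (fun b _ => (Finset.sum_congr rfl (fun a _ => h.symm a b)).trans (h.row b))]
    rw [Finset.sum_const, nsmul_eq_mul]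
  have h4 : (O.card : ℚ) * r ≤ Uf.card * r := by linarith
  have h5 : (O.card : ℚ) ≤ Uf.card := le_of_mul_le_mul_right h4 hr
  exact_mod_cast h5

theorem exists_pm {x : V → V → ℚ} {r : ℚ} (h : Adm x r) (hr : 0 < r) : ∃ σ : V → V, IsPM σ ∧ ∀ a, 0 < x a (σ a) := by
  obtain ⟨M, hM⟩ := SimpleGraph.tutte.2 (no_violator h hr)
  have hM' := SimpleGraph.Subgraph.isPerfectMatching_iff.1 hM
  choose σ hσ hu using hM'
  have hx : ∀ a, x a (σ a) ≠ 0 := fun a => M.adj_sub (hσ a)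
  refine ⟨σ, ⟨fun v => ?_, fun v hv => ?_⟩, fun a => lt_of_le_of_ne (h.nn _ _) (Ne.symm (hx a))⟩
  · exact (hu (σ v) v (hσ v).symm).symm
  · apply hx v; rw [hv]; exact h.diag v

/-- maximal step -/
theorem maxstep {ι : Type} [Finite ι] (α β : ι → ℚ) (hα : ∀ i, 0 < β i → 0 < α i) (h0 : ∀ i, 0 ≤ α i) (hβ : ∃ i, 0 < β i) :
    ∃ t : ℚ, 0 < t ∧ (∀ i, 0 ≤ α i - t * β i) ∧ ∃ i, 0 < β i ∧ α i - t * β i = 0 := by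
  have : Fintype ι := Fintype.ofFinite ι
  obtain ⟨i0, hi0, hm⟩ := Finset.exists_min_image (univ.filter (fun i => 0 < β i)) (fun i => α i / β i)
    (by obtain ⟨i, hi⟩ := hβ; exact ⟨i, by simpa using hi⟩)
  rw [mem_filter] at hi0
  have hb := hi0.2
  have ha := hα i0 hb
  refine ⟨α i0 / β i0, by positivity, ?_, i0, hb, by field_simp; ring⟩
  intro i
  by_cases h : 0 < β i
  · have := hm i (by simpa using h)
    rw [le_div_iff₀ h] at this; linarith
  · have h1 : 0 < α i0 / β i0 := by positivity
    have := h0 i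
    push Not at h
    nlinarith

theorem InD.add {D : Subring ℚ} {x y : V → V → ℚ} (hx : InD D x) (hy : InD D y) : InD D (fun a b => x a b + y a b) := by
  obtain ⟨c, c0, cD, cp, hc⟩ := hx
  obtain ⟨d, d0, dD, dp, hd⟩ := hy
  refine ⟨fun σ => c σ + d σ, fun σ => add_nonneg (c0 σ) (d0 σ), fun σ => D.add_mem (cD σ) (dD σ), ?_, ?_⟩
  · intro σ h
    by_cases h1 : c σ = 0
    · exact dp σ (fun h2 => h (by simp [h1, h2]))
    · exact cp σ h1
  · intro a b; beta_reduce; rw [hc, hd, ← Finset.sum_add_distrib]; apply Finset.sum_congr rfl; intros; ring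

theorem InD.chi {D : Subring ℚ} {σ : V → V} (h : IsPM σ) {t : ℚ} (ht : 0 ≤ t) (hD : t ∈ D) : InD D (fun a b => t * chi σ a b) := by
  apply inD_of_family D (fun _ : Unit => t) (fun _ => σ) (fun _ => ht) (fun _ => hD) (fun _ _ => h)
  intro a b; simp

theorem InD.zero {D : Subring ℚ} {x : V → V → ℚ} (h : ∀ a b, x a b = 0) : InD D x :=
  ⟨fun _ => 0, fun _ => le_rfl, fun _ => D.zero_mem, fun _ h => absurd rfl h, fun a b => by simp [h]⟩

theorem Adm.r0 {x : V → V → ℚ} {r : ℚ} (h : Adm x r) (hr : ¬ 0 < r) (a b : V) : x a b = 0 := by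
  have h1 := h.row a
  have h2 : 0 ≤ ∑ b, x a b := Finset.sum_nonneg fun b _ => h.nn a b
  have h3 : ∑ b, x a b = 0 := by linarith
  exact (Finset.sum_eq_zero_iff_of_nonneg (fun b _ => h.nn a b)).1 h3 b (mem_univ _)

theorem edmonds_aux (n : ℕ) : ∀ (V : Type) [Fintype V], Fintype.card V = n → ∀ (m : ℕ) (x : V → V → ℚ) (r : ℚ), Adm x r →
    (univ.filter (fun i : V × V => x i.1 i.2 ≠ 0)).card = m → InD ⊤ x := by
  induction n using Nat.strong_induction_on with
  | _ n ihn =>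
  intro V _ hV m
  induction m using Nat.strong_induction_on with
  | _ m ihm =>
  intro x r h hm
  have red : ∀ (y : V → V → ℚ) (s : ℚ), Adm y s → 0 < s → ∀ U, NTr U → cut y U = s → InD ⊤ y := by
    intro y s hy hs U hU ht
    exact reduce ⊤ hy (fun a b => Subring.mem_top _) (hy.even hs)
      (fun W _ hW y' s' hy' _ => ihn _ (hV ▸ hW) W rfl _ y' s' hy' rfl) hU ht
  by_cases hr : 0 < r
  swap
  · exact InD.zero (h.r0 hr)
  have hev := h.even hr
  by_cases hnt : ∃ U, NTr U ∧ cut x U = r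
  · obtain ⟨U, hU, ht⟩ := hnt
    exact red x r h hr U hU ht
  push Not at hnt
  obtain ⟨σ, hσ, hpos⟩ := exists_pm h hr
  by_cases hne : Nonempty V
  swap
  · exact InD.zero (fun a => (hne ⟨a⟩).elim)
  obtain ⟨v0⟩ := hne
  obtain ⟨t, tp, hall, i, hi, heq⟩ := maxstep (ι := V ⊕ {U : Finset V // NTr U})
    (fun i => i.elim (fun a => x a (σ a)) (fun U => cut x U.1 - r)) (fun i => i.elim (fun a => 1) (fun U => (cr U.1 σ : ℚ) - 1))
    (by rintro (a | U) _
        · exact hpos a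
        · have := h.cut U.1 U.2.1
          have h2 := hnt U.1 U.2
          simp only [Sum.elim_inr]
          have := lt_of_le_of_ne this (Ne.symm h2)
          linarith)
    (by rintro (a | U)
        · exact h.nn _ _
        · have := h.cut U.1 U.2.1
          simp only [Sum.elim_inr]
          linarith)
    ⟨Sum.inl v0, by simp⟩
  have hcut : ∀ U, cut (fun a b => x a b - t * chi σ a b) U = cut x U - t * cr U σ := by
    intro U
    have := cut_lin x (chi σ) 1 (-t) U
    rw [cut_chi] at this
    rw [one_mul] at this
    rw [sub_eq_add_neg, ← neg_mul, ← this]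
    congr 1; funext a b; ring
  have hadm : Adm (fun a b => x a b - t * chi σ a b) (r - t) := by
    have s1 : ∀ a b, x a b - t * chi σ a b = x b a - t * chi σ b a := fun a b => by rw [h.symm, chi_symm hσ]
    have s2 : ∀ a, x a a - t * chi σ a a = 0 := fun a => by rw [h.diag, chi_diag hσ]; ring
    have s3 : ∀ a, ∑ b, (x a b - t * chi σ a b) = r - t := fun a => by
      rw [Finset.sum_sub_distrib, h.row, ← Finset.mul_sum, chi_row]; ring
    refine ⟨s1, s2, ?_, s3, ?_⟩
    · intro a b
      unfold chi
      by_cases e : σ a = b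
      · have := hall (Sum.inl a); simp only [Sum.elim_inl] at this; rw [if_pos e, ← e]; exact this
      · rw [if_neg e, mul_zero, sub_zero]; exact h.nn _ _
    · intro U hU
      rcases odd_triv hev hU with h1 | h1
      · have := hall (Sum.inr ⟨U, h1⟩)
        simp only [Sum.elim_inr] at this
        rw [hcut]; linarith
      · rw [cut_triv s1 s2 s3 h1]
  have hx : x = fun a b => (x a b - t * chi σ a b) + t * chi σ a b := by funext a b; ring
  rw [hx]
  refine InD.add ?_ (InD.chi hσ tp.le (Subring.mem_top _))
  by_cases hrt : 0 < r - t
  swap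
  · exact InD.zero (hadm.r0 hrt)
  rcases i with a | U
  · simp only [Sum.elim_inl] at heq
    refine ihm _ ?_ _ _ hadm rfl
    rw [← hm]
    apply Finset.card_lt_card
    rw [Finset.ssubset_iff_of_subset]
    · refine ⟨(a, σ a), by simp [(hpos a).ne'], ?_⟩
      simp only [mem_filter, mem_univ, true_and, not_not]
      unfold chi; rw [if_pos rfl]; exact heq
    · intro p
      simp only [mem_filter, mem_univ, true_and]
      intro hp h0
      have := hadm.nn p.1 p.2
      have h2 := chi_nn σ p.1 p.2
      simp only [h0, zero_sub] at this hp
      apply hp; nlinarith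
  · simp only [Sum.elim_inr] at heq
    exact red _ _ hadm hrt U.1 U.2 (by rw [hcut]; linarith)

theorem edmonds {x : V → V → ℚ} {r : ℚ} (h : Adm x r) : InD ⊤ x := edmonds_aux _ V rfl _ x r h rfl

end Edmonds


section Sys
variable {V : Type} [Fintype V]

theorem dec_supp {x : V → V → ℚ} {c : (V → V) → ℚ} (c0 : ∀ σ, 0 ≤ c σ) (hc : ∀ a b, x a b = ∑ σ, c σ * chi σ a b)
    {σ : V → V} (h : c σ ≠ 0) (a : V) : x a (σ a) ≠ 0 := by
  rw [hc]
  have h1 : c σ * chi σ a (σ a) ≤ ∑ τ, c τ * chi τ a (σ a) :=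
    Finset.single_le_sum (f := fun τ => c τ * chi τ a (σ a)) (fun τ _ => mul_nonneg (c0 τ) (chi_nn _ _ _)) (mem_univ σ)
  have h2 : chi σ a (σ a) = 1 := by unfold chi; rw [if_pos rfl]
  rw [h2] at h1
  have := lt_of_le_of_ne (c0 σ) (Ne.symm h)
  linarith

theorem dec_sum [Nonempty V] {x : V → V → ℚ} {r : ℚ} (hr : ∀ a, ∑ b, x a b = r) {c : (V → V) → ℚ} (hc : ∀ a b, x a b = ∑ σ, c σ * chi σ a b) :
    ∑ σ, c σ = r := by
  obtain ⟨a⟩ := ‹Nonempty V›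
  rw [← hr a, Finset.sum_congr rfl (fun b _ => hc a b), Finset.sum_comm]
  apply Finset.sum_congr rfl; intro σ _
  rw [← Finset.mul_sum, chi_row, mul_one]

theorem dec_lin {x : V → V → ℚ} {c : (V → V) → ℚ} (hc : ∀ a b, x a b = ∑ σ, c σ * chi σ a b) (f : V → V → ℚ) :
    ∑ a, ∑ b, f a b * x a b = ∑ σ, c σ * ∑ a, f a (σ a) := by
  have : ∀ a, ∑ b, f a b * x a b = ∑ σ, c σ * f a (σ a) := by
    intro a
    calc _ = ∑ b, ∑ σ, c σ * (f a b * chi σ a b) := by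
          apply Finset.sum_congr rfl; intro b _; rw [hc, Finset.mul_sum]; apply Finset.sum_congr rfl; intros; ring
      _ = _ := by
          rw [Finset.sum_comm]; apply Finset.sum_congr rfl; intro σ _
          rw [← Finset.mul_sum]; congr 1
          unfold chi; simp
  rw [Finset.sum_congr rfl (fun a _ => this a), Finset.sum_comm]
  apply Finset.sum_congr rfl; intro σ _; rw [Finset.mul_sum]

noncomputable def MM (x : V → V → ℚ) : Finset (V → V) := univ.filter (fun σ => IsPM σ ∧ ∀ a, x a (σ a) ≠ 0)

theorem mem_MM {x : V → V → ℚ} {σ : V → V} : σ ∈ MM x ↔ IsPM σ ∧ ∀ a, x a (σ a) ≠ 0 := by simp [MM]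

theorem MM_cover {x : V → V → ℚ} {r : ℚ} (h : Adm x r) {a b : V} (hab : x a b ≠ 0) : ∃ σ ∈ MM x, σ a = b := by
  obtain ⟨c, c0, -, cp, hc⟩ := edmonds h
  have h1 := hc a b
  by_contra hn
  push Not at hn
  apply hab; rw [h1]
  apply Finset.sum_eq_zero; intro σ _
  by_cases h0 : c σ = 0
  · rw [h0, zero_mul]
  · have := hn σ (mem_MM.2 ⟨cp σ h0, dec_supp c0 hc h0⟩)
    unfold chi; rw [if_neg this, mul_zero]

theorem MM_f2 {x : V → V → ℚ} {r : ℚ} (h : Adm x r) [Nonempty V] {U : Finset V} (hU : cut x U ≠ r) : ∃ σ ∈ MM x, cr U σ ≠ 1 := by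
  obtain ⟨c, c0, -, cp, hc⟩ := edmonds h
  by_contra hn
  push Not at hn
  apply hU
  have : x = fun a b => ∑ σ ∈ univ, c σ * chi σ a b := by funext a b; exact hc a b
  rw [this, cut_sum, ← dec_sum h.row hc]
  apply Finset.sum_congr rfl; intro σ _
  by_cases h0 : c σ = 0
  · rw [h0, zero_mul]
  · rw [cut_chi, hn σ (mem_MM.2 ⟨cp σ h0, dec_supp c0 hc h0⟩)]; simp

theorem MM_f3 {x : V → V → ℚ} {r : ℚ} (h : Adm x r) (hr : 0 < r) (hnt : ∀ U, NTr U → cut x U ≠ r)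
    (f : V → V → ℚ) (C : ℚ) (hf : ∀ σ ∈ MM x, ∑ v, f v (σ v) = C) :
    ∃ y : V → ℚ, ∀ σ ∈ MM x, ∀ a, f a (σ a) + f (σ a) a = y a + y (σ a) := by
  by_cases hne : Nonempty V
  swap
  · exact ⟨0, fun σ _ a => (hne ⟨a⟩).elim⟩
  obtain ⟨zz, hzz⟩ : ∃ zz : (V → V → ℚ) → V → V → ℚ, zz = fun w a b => if x a b ≠ 0 then w a b + w b a else 0 := ⟨_, rfl⟩
  have key : ∀ w, (∀ v, ∑ b, zz w v b = 0) → ∑ a, ∑ b, f a b * zz w a b = 0 := by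
    intro w hw
    have zs : ∀ a b, zz w a b = zz w b a := by
      intro a b; rw [hzz]; simp only; rw [h.symm a b, add_comm]
    have zd : ∀ a, zz w a a = 0 := by
      intro a; rw [hzz]; simp only; rw [if_neg (not_not.2 (h.diag a))]
    obtain ⟨e0, p0, he⟩ := perturb h zs zd hw
      (by intro a b e; rw [hzz]; simp only; rw [if_neg (not_not.2 e)])
      (by intro U hU ht
          rcases odd_triv (h.even hr) hU with h1 | h1
          · exact absurd ht (hnt U h1)
          · rw [cut_triv zs zd hw h1])
    have hA := he e0 p0 le_rfl
    have cC : ∀ (x' : V → V → ℚ), Adm x' r → (∀ a b, x' a b ≠ 0 → x a b ≠ 0) → ∑ a, ∑ b, f a b * x' a b = r * C := by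
      intro x' hx' hsup
      obtain ⟨c, c0, -, cp, hc⟩ := edmonds hx'
      rw [dec_lin hc, ← dec_sum hx'.row hc, Finset.sum_mul]
      apply Finset.sum_congr rfl; intro σ _
      by_cases h0 : c σ = 0
      · rw [h0, zero_mul, zero_mul]
      · rw [hf σ (mem_MM.2 ⟨cp σ h0, fun a => hsup _ _ (dec_supp c0 hc h0 a)⟩)]
    rw [mul_zero, add_zero] at hA
    have e1 := cC x h (fun _ _ h => h)
    have e2 := cC _ hA (by
      intro a b hab h0; apply hab; simp only [h0]; rw [hzz]; simp only; rw [if_neg (not_not.2 h0)]; ring)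
    simp only [mul_add, Finset.sum_add_distrib] at e2
    rw [e1] at e2
    have e3 : e0 * ∑ a, ∑ b, f a b * zz w a b = 0 := by
      have : ∑ a, ∑ b, f a b * (e0 * zz w a b) = e0 * ∑ a, ∑ b, f a b * zz w a b := by
        rw [Finset.mul_sum]; apply Finset.sum_congr rfl; intro a _
        rw [Finset.mul_sum]; apply Finset.sum_congr rfl; intros; ring
      rw [← this]; linarith
    rcases mul_eq_zero.1 e3 with h1 | h1
    · exact absurd h1 p0.ne'
    · exact h1
  have zadd : ∀ u w a b, zz (u + w) a b = zz u a b + zz w a b := by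
    intro u w a b; rw [hzz]; simp only [Pi.add_apply]; split_ifs <;> ring
  have zsm : ∀ (t : ℚ) w a b, zz (t • w) a b = t * zz w a b := by
    intro u w a b; rw [hzz]; simp only [Pi.smul_apply, smul_eq_mul]; split_ifs <;> ring
  let L : V → (V → V → ℚ) →ₗ[ℚ] ℚ := fun v =>
    { toFun := fun w => ∑ b, zz w v b
      map_add' := fun u w => by simp only [zadd, Finset.sum_add_distrib]
      map_smul' := fun t w => by simp only [zsm, ← Finset.mul_sum]; rfl }
  let Φ : (V → V → ℚ) →ₗ[ℚ] ℚ :=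
    { toFun := fun w => ∑ a, ∑ b, f a b * zz w a b
      map_add' := fun u w => by simp only [zadd, mul_add, Finset.sum_add_distrib]
      map_smul' := fun t w => by
        simp only [zsm, Finset.mul_sum, RingHom.id_apply, smul_eq_mul]
        apply Finset.sum_congr rfl; intro a _; apply Finset.sum_congr rfl; intros; ring }
  have hsp : Φ ∈ Submodule.span ℚ (Set.range L) := by
    apply mem_span_of_iInf_ker_le_ker
    intro w hw
    rw [Submodule.mem_iInf] at hw
    exact key w (fun v => hw v)
  obtain ⟨y, hy⟩ := (Submodule.mem_span_range_iff_exists_fun ℚ).1 hsp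
  refine ⟨y, fun σ hσ a => ?_⟩
  obtain ⟨hp, hx⟩ := mem_MM.1 hσ
  obtain ⟨b, hb⟩ : ∃ b, b = σ a := ⟨_, rfl⟩
  have hxab := hx a
  have hne' := hp.2 a
  rw [← hb] at hxab hne' ⊢
  obtain ⟨w, hw⟩ : ∃ w : V → V → ℚ, w = fun u v => if u = a ∧ v = b then 1 else 0 := ⟨_, rfl⟩
  have hz : ∀ u v, zz w u v = (if u = a then if v = b then 1 else 0 else 0) + (if u = b then if v = a then 1 else 0 else 0) := by
    intro u v
    rw [hzz, hw]; simp only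
    by_cases hxx : x u v = 0
    · rw [if_neg (not_not.2 hxx)]
      have h1 : ¬ (u = a ∧ v = b) := by rintro ⟨rfl, rfl⟩; exact hxab hxx
      have h2 : ¬ (u = b ∧ v = a) := by rintro ⟨rfl, rfl⟩; rw [h.symm] at hxx; exact hxab hxx
      rw [← ite_and, ← ite_and, if_neg h1, if_neg h2, add_zero]
    · rw [if_pos hxx, ite_and]; congr 1; split_ifs <;> simp_all
  have e := congrArg (fun l => l w) hy
  have e1 : Φ w = f a b + f b a := by
    show ∑ a, ∑ b, f a b * zz w a b = _
    simp [hz, mul_add, Finset.sum_add_distrib]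
  have e2 : ∀ v, L v w = (if v = a then 1 else 0) + (if v = b then 1 else 0) := by
    intro v
    show ∑ b, zz w v b = _
    simp only [hz, Finset.sum_add_distrib]
    congr 1 <;> split_ifs <;> simp
  rw [← e1, ← e]
  simp [LinearMap.sum_apply, e2, mul_add, Finset.sum_add_distrib]

end Sys


section Sys2
variable {V : Type} [Fintype V]

theorem MM_f4_step {x : V → V → ℚ} (f : V → V → ℚ) (hf : ∀ σ ∈ MM x, 0 ≤ ∑ v, f v (σ v)) (hV : Even (Fintype.card V))
    {σ0 : V → V} (h0 : σ0 ∈ MM x) (hpos : 0 < ∑ v, f v (σ0 v)) :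
    (∃ a b, σ0 a = b ∧ ∀ σ ∈ MM x, ∑ v, f v (σ v) = 0 → σ a ≠ b) ∨
    (∃ U, NTr U ∧ cr U σ0 ≠ 1 ∧ ∀ σ ∈ MM x, ∑ v, f v (σ v) = 0 → cr U σ = 1) := by
  by_contra hcon
  push Not at hcon
  obtain ⟨hc1, hc2⟩ := hcon
  obtain ⟨Z, hZ⟩ : ∃ Z : Finset (V → V), Z = (MM x).filter (fun σ => ∑ v, f v (σ v) = 0) := ⟨_, rfl⟩
  have mZ : ∀ σ, σ ∈ Z ↔ σ ∈ MM x ∧ ∑ v, f v (σ v) = 0 := fun σ => by rw [hZ, mem_filter]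
  have hp0 := (mem_MM.1 h0).1
  have hy := adm_sum (s := Z) (fun σ h => (mem_MM.1 ((mZ σ).1 h).1).1) (fun _ => 1) (fun _ _ => zero_le_one)
  have yne : ∀ σ ∈ Z, ∀ a, ∑ τ ∈ Z, (fun _ => (1:ℚ)) τ * chi τ a (σ a) ≠ 0 := by
    intro σ hσ a
    have h1 : (1:ℚ) * chi σ a (σ a) ≤ ∑ τ ∈ Z, (fun _ => (1:ℚ)) τ * chi τ a (σ a) :=
      Finset.single_le_sum (f := fun τ => 1 * chi τ a (σ a)) (fun τ _ => mul_nonneg zero_le_one (chi_nn _ _ _)) hσ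
    have h2 : chi σ a (σ a) = 1 := by unfold chi; rw [if_pos rfl]
    rw [h2] at h1
    linarith
  obtain ⟨e0, p0, he⟩ := perturb (z := fun a b => - chi σ0 a b) (ρ := -1) hy
    (fun a b => by rw [chi_symm hp0]) (fun a => by rw [chi_diag hp0, neg_zero])
    (fun a => by rw [Finset.sum_neg_distrib, chi_row])
    (by
      intro a b hab
      unfold chi
      by_cases e : σ0 a = b
      · obtain ⟨σ, h1, h2, h3⟩ := hc1 a b e
        exfalso; have := yne σ ((mZ σ).2 ⟨h1, h2⟩) a
        rw [h3] at this; exact this hab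
      · rw [if_neg e, neg_zero])
    (by
      intro U hU ht
      have e1 : cut (fun a b => - chi σ0 a b) U = - cr U σ0 := by
        have := cut_lin (chi σ0) (chi σ0) (-1) 0 U
        rw [cut_chi, zero_mul, add_zero, neg_one_mul] at this
        rw [← this]; congr 1; funext a b; ring
      rw [e1]
      rcases odd_triv hV hU with h1 | h1
      · by_cases h2 : cr U σ0 = 1
        · rw [h2]; simp
        · exfalso
          obtain ⟨σ, h3, h4, h5⟩ := hc2 U h1 h2
          rw [cut_sum] at ht
          have h6 : ∑ i ∈ Z, (1 * cut (chi i) U - 1) = 0 := by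
            rw [Finset.sum_sub_distrib]; linarith
          rw [Finset.sum_eq_zero_iff_of_nonneg] at h6
          · have := h6 σ ((mZ σ).2 ⟨h3, h4⟩)
            rw [cut_chi] at this
            apply h5
            have : (cr U σ : ℚ) = 1 := by linarith
            exact_mod_cast this
          · intro τ hτ
            have := (adm_chi (mem_MM.1 ((mZ τ).1 hτ).1).1).cut U hU
            linarith
      · have := cut_triv (chi_symm hp0) (chi_diag hp0) (chi_row σ0) h1
        rw [cut_chi] at this; rw [this])
  have hA := he e0 p0 le_rfl
  obtain ⟨c, c0, -, cp, hc⟩ := edmonds hA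
  have hl := dec_lin hc f
  have hge : 0 ≤ ∑ σ, c σ * ∑ a, f a (σ a) := by
    apply Finset.sum_nonneg; intro σ _
    by_cases h1 : c σ = 0
    · rw [h1, zero_mul]
    · refine mul_nonneg (c0 σ) (hf σ (mem_MM.2 ⟨cp σ h1, fun a => ?_⟩))
      have h2 := dec_supp c0 hc h1 a
      intro h3
      apply h2
      have h4 : ∀ τ ∈ MM x, chi τ a (σ a) = 0 := by
        intro τ hτ; unfold chi; rw [if_neg]; intro e
        apply (mem_MM.1 hτ).2 a; rw [e]; exact h3
      rw [h4 _ h0, Finset.sum_eq_zero]; · ring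
      intro τ hτ; rw [h4 τ ((mZ τ).1 hτ).1, mul_zero]
  have hlt : ∑ a, ∑ b, f a b * (∑ σ ∈ Z, (fun _ => (1:ℚ)) σ * chi σ a b + e0 * - chi σ0 a b) = - e0 * ∑ v, f v (σ0 v) := by
    have g : ∀ a, ∑ b, f a b * (∑ σ ∈ Z, (fun _ => (1:ℚ)) σ * chi σ a b + e0 * - chi σ0 a b) = ∑ σ ∈ Z, f a (σ a) - e0 * f a (σ0 a) := by
      intro a
      have k1 : ∀ σ : V → V, ∑ b, f a b * chi σ a b = f a (σ a) := by intro σ; unfold chi; simp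
      rw [← k1 σ0, ← Finset.sum_congr rfl (fun σ _ => k1 σ), Finset.sum_comm, Finset.mul_sum, ← Finset.sum_sub_distrib]
      apply Finset.sum_congr rfl; intro b _
      simp only [one_mul, mul_add, Finset.mul_sum]; ring
    rw [Finset.sum_congr rfl (fun a _ => g a), Finset.sum_sub_distrib, ← Finset.mul_sum, Finset.sum_comm,
      Finset.sum_eq_zero (fun σ hσ => ((mZ σ).1 hσ).2)]
    ring
  rw [hlt] at hl
  nlinarith

theorem MM_f4 {x : V → V → ℚ} (hV : Even (Fintype.card V)) (n : ℕ) : ∀ (f : V → V → ℚ), (∀ σ ∈ MM x, 0 ≤ ∑ v, f v (σ v)) →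
    ((MM x).filter (fun σ => 0 < ∑ v, f v (σ v))).card = n →
    ∃ (μ : V → V → ℚ) (l : Finset V → ℚ), (∀ a b, 0 ≤ μ a b) ∧ (∀ U, 0 ≤ l U) ∧ (∀ U, l U ≠ 0 → NTr U) ∧
      ∀ σ ∈ MM x, ∑ v, f v (σ v) = ∑ v, μ v (σ v) + ∑ U, l U * ((cr U σ : ℚ) - 1) := by
  induction n using Nat.strong_induction_on with
  | _ n ih =>
  intro f hf hn
  by_cases hex : ∃ σ0 ∈ MM x, 0 < ∑ v, f v (σ0 v)
  swap
  · push Not at hex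
    refine ⟨fun _ _ => 0, fun _ => 0, fun _ _ => le_rfl, fun _ => le_rfl, fun _ h => absurd rfl h, fun σ hσ => ?_⟩
    simp [le_antisymm (hex σ hσ) (hf σ hσ)]
  obtain ⟨σ0, h0, hpos⟩ := hex
  have hne : Nonempty V := by
    by_contra hc
    rw [not_nonempty_iff] at hc
    simp at hpos
  have step : ∀ ψ : V → V → ℚ, (∀ σ ∈ MM x, ∑ v, f v (σ v) = 0 → ∑ v, ψ v (σ v) = 0) → 0 < ∑ v, ψ v (σ0 v) →
      ∃ t : ℚ, 0 < t ∧ ∃ (μ : V → V → ℚ) (l : Finset V → ℚ), (∀ a b, 0 ≤ μ a b) ∧ (∀ U, 0 ≤ l U) ∧ (∀ U, l U ≠ 0 → NTr U) ∧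
      ∀ σ ∈ MM x, ∑ v, f v (σ v) - t * ∑ v, ψ v (σ v) = ∑ v, μ v (σ v) + ∑ U, l U * ((cr U σ : ℚ) - 1) := by
    intro ψ hψ hψ0
    obtain ⟨t, tp, hall, ⟨τ, hτ⟩, hb, heq⟩ := maxstep (ι := {σ // σ ∈ MM x}) (fun σ => ∑ v, f v (σ.1 v)) (fun σ => ∑ v, ψ v (σ.1 v))
      (by rintro ⟨σ, hσ⟩ h1
          simp only at h1 ⊢
          refine lt_of_le_of_ne (hf σ hσ) (fun e => ?_)
          rw [hψ σ hσ e.symm] at h1; exact lt_irrefl _ h1)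
      (fun σ => hf σ.1 σ.2) ⟨⟨σ0, h0⟩, hψ0⟩
    refine ⟨t, tp, ?_⟩
    have eq : ∀ σ : V → V, ∑ v, (fun a b => f a b - t * ψ a b) v (σ v) = ∑ v, f v (σ v) - t * ∑ v, ψ v (σ v) := by
      intro σ; rw [Finset.mul_sum, ← Finset.sum_sub_distrib]
    obtain ⟨μ, l, h1, h2, h3, h4⟩ := ih _ (by
      rw [← hn]
      apply Finset.card_lt_card (t := (MM x).filter (fun σ => 0 < ∑ v, f v (σ v)))
      rw [Finset.ssubset_iff_of_subset]
      · refine ⟨τ, ?_, ?_⟩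
        · rw [mem_filter]; refine ⟨hτ, lt_of_le_of_ne (hf τ hτ) (fun e => ?_)⟩
          simp only [hψ τ hτ e.symm, lt_irrefl] at hb
        · rw [mem_filter, eq]; simp only at heq; rw [heq]; simp
      · intro σ hσ
        rw [mem_filter] at hσ ⊢
        rw [eq] at hσ
        refine ⟨hσ.1, lt_of_le_of_ne (hf σ hσ.1) (fun e => ?_)⟩
        rw [hψ σ hσ.1 e.symm, ← e] at hσ; simp at hσ) (fun a b => f a b - t * ψ a b)
      (fun σ hσ => by rw [eq]; exact hall ⟨σ, hσ⟩) rfl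
    refine ⟨μ, l, h1, h2, h3, fun σ hσ => ?_⟩
    rw [← eq, h4 σ hσ]
  rcases MM_f4_step f hf hV h0 hpos with ⟨a, b, hab, hz⟩ | ⟨U, hU, hne1, hz⟩
  · have hs : ∀ σ : V → V, ∑ v, (fun u w => if u = a then (if w = b then (1:ℚ) else 0) else 0) v (σ v) = if σ a = b then 1 else 0 := by
      intro σ; simp
    obtain ⟨t, tp, μ, l, h1, h2, h3, h4⟩ := step (fun u w => if u = a then (if w = b then (1:ℚ) else 0) else 0)
      (fun σ hσ e => by rw [hs, if_neg (hz σ hσ e)]) (by rw [hs, if_pos hab]; norm_num)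
    refine ⟨fun u w => μ u w + t * (if u = a then (if w = b then (1:ℚ) else 0) else 0), l, ?_, h2, h3, ?_⟩
    · intro u w; have := h1 u w; beta_reduce; split_ifs <;> linarith
    · intro σ hσ
      rw [Finset.sum_add_distrib, ← Finset.mul_sum]
      have := h4 σ hσ
      linarith
  · obtain ⟨n, hnn⟩ : ∃ n : ℚ, n = Fintype.card V := ⟨_, rfl⟩
    have hn0 : n ≠ 0 := by rw [hnn]; exact_mod_cast Fintype.card_ne_zero
    have hs : ∀ σ : V → V, ∑ v, (fun u w => (if u ∈ U then (if w ∈ Uᶜ then (1:ℚ) else 0) else 0) - 1 / n) v (σ v) = (cr U σ : ℚ) - 1 := by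
      intro σ
      rw [Finset.sum_sub_distrib]
      congr 1
      · unfold cr cnt
        rw [Finset.card_filter]; push_cast
        rw [← Finset.sum_filter]; simp
      · rw [Finset.sum_const, nsmul_eq_mul, Finset.card_univ, ← hnn]; field_simp
    have hge := one_le_cr (mem_MM.1 h0).1 hU.1
    obtain ⟨t, tp, μ, l, h1, h2, h3, h4⟩ := step (fun u w => (if u ∈ U then (if w ∈ Uᶜ then (1:ℚ) else 0) else 0) - 1 / n)
      (fun σ hσ e => by rw [hs, hz σ hσ e]; simp) (by
        rw [hs]; have : 1 < cr U σ0 := lt_of_le_of_ne hge (Ne.symm hne1)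
        have : (1:ℚ) < cr U σ0 := by exact_mod_cast this
        linarith)
    refine ⟨μ, fun W => l W + if W = U then t else 0, h1, ?_, ?_, ?_⟩
    · intro W; have := h2 W; beta_reduce; split_ifs <;> linarith
    · intro W; beta_reduce; split_ifs with e
      · rw [e]; exact fun _ => hU
      · rw [add_zero]; exact h3 W
    · intro σ hσ
      have := h4 σ hσ
      rw [hs] at this
      simp only [add_mul, Finset.sum_add_distrib, ite_mul, zero_mul, Finset.sum_ite_eq', mem_univ, if_true]
      linarith

noncomputable def sysOf {x : V → V → ℚ} {r : ℚ} [Nonempty V] (h : Adm x r) (hr : 0 < r) (hnt : ∀ U, NTr U → cut x U ≠ r) : PMSys V where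
  M := MM x
  pm := fun σ hσ => (mem_MM.1 hσ).1
  f2 := fun U hU => MM_f2 h (hnt U hU)
  f3 := MM_f3 h hr hnt
  f4 := fun f hf => MM_f4 (h.even hr) _ f hf rfl

end Sys2


section ThmD
variable {V : Type} [Fintype V]

theorem exists_den {ι : Type} [Fintype ι] (l : ι → ℚ) : ∃ N : ℕ, 0 < N ∧ ∀ i, ∃ k : ℤ, (N : ℚ) * l i = k := by
  refine ⟨∏ i, (l i).den, Finset.prod_pos fun i _ => (l i).pos, fun i => ?_⟩
  obtain ⟨j, hj⟩ := Finset.dvd_prod_of_mem (fun i => (l i).den) (mem_univ i)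
  refine ⟨j * (l i).num, ?_⟩
  rw [hj]; push_cast
  have := Rat.den_mul_eq_num (l i)
  rw [mul_comm ((l i).den : ℚ), mul_assoc, this]

theorem full_supp {x : V → V → ℚ} {r : ℚ} (h : Adm x r) (hr : 0 < r) (hnt : ∀ U, NTr U → cut x U ≠ r) :
    ∃ (l : (V → V) → ℚ) (e : ℚ), 0 < e ∧ (∀ σ ∈ MM x, e ≤ l σ) ∧ (∀ σ, σ ∉ MM x → l σ = 0) ∧
      ∀ a b, x a b = ∑ σ, l σ * chi σ a b := by
  have hM : ∀ σ ∈ MM x, IsPM σ := fun σ h => (mem_MM.1 h).1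
  have hy := adm_sum (s := MM x) hM (fun _ => 1) (fun _ _ => zero_le_one)
  have hxs : ∀ σ ∈ MM x, ∀ a b, x a b = 0 → chi σ a b = 0 := by
    intro σ hσ a b h0; unfold chi; rw [if_neg]; intro e; apply (mem_MM.1 hσ).2 a; rw [e]; exact h0
  have s1 : ∀ a b, (fun a b => - ∑ σ ∈ MM x, (fun _ => (1:ℚ)) σ * chi σ a b) a b = (fun a b => - ∑ σ ∈ MM x, (fun _ => (1:ℚ)) σ * chi σ a b) b a :=
    fun a b => by have := hy.symm a b; beta_reduce at this ⊢; rw [this]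
  have s2 : ∀ a, (fun a b => - ∑ σ ∈ MM x, (fun _ => (1:ℚ)) σ * chi σ a b) a a = 0 :=
    fun a => by have := hy.diag a; beta_reduce at this ⊢; rw [this, neg_zero]
  have s3 : ∀ a, ∑ b, (fun a b => - ∑ σ ∈ MM x, (fun _ => (1:ℚ)) σ * chi σ a b) a b = - ∑ σ ∈ MM x, (fun _ => (1:ℚ)) σ :=
    fun a => by rw [← hy.row a, Finset.sum_neg_distrib]
  obtain ⟨e0, p0, he⟩ := perturb h s1 s2 s3
    (by intro a b h0; beta_reduce; rw [Finset.sum_eq_zero]; · simp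
        intro σ hσ; rw [hxs σ hσ a b h0, mul_zero])
    (by intro U hU ht
        rcases odd_triv (h.even hr) hU with h1 | h1
        · exact absurd ht (hnt U h1)
        · rw [cut_triv s1 s2 s3 h1])
  obtain ⟨c, c0, -, cp, hc⟩ := edmonds (he e0 p0 le_rfl)
  refine ⟨fun σ => c σ + if σ ∈ MM x then e0 else 0, e0, p0, ?_, ?_, ?_⟩
  · intro σ hσ; beta_reduce; rw [if_pos hσ]; have := c0 σ; linarith
  · intro σ hσ; beta_reduce; rw [if_neg hσ, add_zero]
    by_contra h0
    apply hσ
    refine mem_MM.2 ⟨cp σ h0, fun a ha => ?_⟩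
    apply dec_supp c0 hc h0 a
    rw [ha, Finset.sum_eq_zero]; · ring
    intro τ hτ; rw [hxs τ hτ a _ ha, mul_zero]
  · intro a b
    simp only [add_mul, Finset.sum_add_distrib]
    rw [← hc]
    simp only [ite_mul, zero_mul, one_mul, ← Finset.sum_filter, Finset.filter_mem_eq_inter, Finset.univ_inter, ← Finset.mul_sum]
    ring

theorem combine (D : Subring ℚ) (h2 : (1/2 : ℚ) ∈ D) {x : V → V → ℚ} {r : ℚ} (h : Adm x r) (hr : 0 < r) (hnt : ∀ U, NTr U → cut x U ≠ r)
    (m : (V → V) → ℚ) (mD : ∀ σ, m σ ∈ D) (mM : ∀ σ, σ ∉ MM x → m σ = 0) (hm : ∀ a b, x a b = ∑ σ, m σ * chi σ a b) : InD D x := by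
  obtain ⟨l, e, ep, hl, hl0, hlx⟩ := full_supp h hr hnt
  obtain ⟨N, Np, hN⟩ := exists_den l
  obtain ⟨b, hb⟩ := pow_unbounded_of_one_lt ((N : ℚ) + N * (∑ σ, |m σ|) / e) (one_lt_two)
  obtain ⟨q, hq⟩ : ∃ q, q = 2 ^ b / N := ⟨_, rfl⟩
  obtain ⟨s, hs⟩ : ∃ s, s = 2 ^ b % N := ⟨_, rfl⟩
  have hqs : N * q + s = 2 ^ b := by rw [hq, hs]; exact Nat.div_add_mod _ _
  have hsN : s < N := by rw [hs]; exact Nat.mod_lt _ Np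
  have hqs' : (N : ℚ) * q + s = 2 ^ b := by exact_mod_cast hqs
  have hsN' : (s : ℚ) ≤ N := by exact_mod_cast hsN.le
  have pb : (0 : ℚ) < 2 ^ b := by positivity
  have hbD : (1 / 2 ^ b : ℚ) ∈ D := by
    have := D.pow_mem h2 b
    rwa [div_pow, one_pow] at this
  refine ⟨fun σ => (1 / 2 ^ b) * (s * m σ + q * (N * l σ)), ?_, ?_, ?_, ?_⟩
  · intro σ
    apply mul_nonneg (by positivity)
    by_cases hσ : σ ∈ MM x
    · have h3 := hl σ hσ
      have h4 : |m σ| ≤ ∑ σ, |m σ| := Finset.single_le_sum (f := fun σ => |m σ|) (fun _ _ => abs_nonneg _) (mem_univ σ)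
      have h5 : -|m σ| ≤ m σ := neg_abs_le _
      have h6 : (N : ℚ) * e + N * (∑ σ, |m σ|) < 2 ^ b * e := by
        have := mul_lt_mul_of_pos_right hb ep
        rw [add_mul, div_mul_cancel₀ _ ep.ne'] at this; exact this
      have h7 : (s : ℚ) * |m σ| ≤ N * ∑ σ, |m σ| := mul_le_mul hsN' h4 (abs_nonneg _) (by positivity)
      have h8 : - ((s : ℚ) * |m σ|) ≤ s * m σ := by
        have := mul_le_mul_of_nonneg_left h5 (show (0:ℚ) ≤ s by positivity); linarith
      have h9 : (q : ℚ) * (N * e) ≤ q * (N * l σ) := by gcongr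
      have h10 : (q : ℚ) * (N * e) = 2 ^ b * e - s * e := by rw [← hqs']; ring
      have h11 : (s : ℚ) * e ≤ N * e := by gcongr
      linarith
    · rw [hl0 σ hσ, mM σ hσ]; simp
  · intro σ
    obtain ⟨k, hk⟩ := hN σ
    beta_reduce
    rw [hk]
    exact D.mul_mem hbD (D.add_mem (D.mul_mem (natCast_mem D s) (mD σ)) (D.mul_mem (natCast_mem D q) (intCast_mem D k)))
  · intro σ hσ
    by_contra hp
    apply hσ
    have : σ ∉ MM x := fun h => hp (mem_MM.1 h).1
    beta_reduce
    rw [hl0 σ this, mM σ this]; simp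
  · intro a c
    have e1 : ∑ σ, (1 / 2 ^ b) * (s * m σ + q * (N * l σ)) * chi σ a c = (1 / 2 ^ b) * (s * x a c + (N * q) * x a c) := by
      nth_rw 1 [hm a c]; rw [hlx a c, Finset.mul_sum, Finset.mul_sum, ← Finset.sum_add_distrib, Finset.mul_sum]
      apply Finset.sum_congr rfl; intros; ring
    rw [e1, ← add_mul, add_comm (s : ℚ), hqs']; field_simp

theorem signed_finish (D : Subring ℚ) (h2 : (1/2 : ℚ) ∈ D) {x : V → V → ℚ} {r : ℚ} (h : Adm x r) (hr : 0 < r) (hnt : ∀ U, NTr U → cut x U ≠ r)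
    {σ0 : V → V} (h0 : σ0 ∈ MM x) {P : Finset (V → V)} (hP : P ⊆ MM x) {β : ℚ} (hβ : β ∈ D) {K : ℕ}
    (hx' : InD D (fun a b => x a b - β * chi σ0 a b + K * ∑ τ ∈ P, chi τ a b)) : InD D x := by
  obtain ⟨c, c0, cD, cp, hc⟩ := hx'
  have hxs : ∀ σ ∈ MM x, ∀ a b, x a b = 0 → chi σ a b = 0 := by
    intro σ hσ a b h0; unfold chi; rw [if_neg]; intro e; apply (mem_MM.1 hσ).2 a; rw [e]; exact h0
  refine combine D h2 h hr hnt (fun σ => c σ + (if σ = σ0 then β else 0) - (if σ ∈ P then (K : ℚ) else 0)) ?_ ?_ ?_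
  · intro σ
    refine D.sub_mem (D.add_mem (cD σ) ?_) ?_
    · split_ifs; exacts [hβ, D.zero_mem]
    · split_ifs; exacts [natCast_mem D K, D.zero_mem]
  · intro σ hσ
    beta_reduce
    rw [if_neg (fun e : σ = σ0 => hσ (e ▸ h0)), if_neg (fun e => hσ (hP e))]
    by_contra hn
    have hn : c σ ≠ 0 := fun h => hn (by rw [h]; ring)
    apply hσ
    refine mem_MM.2 ⟨cp σ hn, fun a ha => ?_⟩
    apply dec_supp c0 hc hn a
    rw [ha, hxs σ0 h0 _ _ ha, Finset.sum_eq_zero (fun τ hτ => hxs τ (hP hτ) _ _ ha)]; ring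
  · intro a b
    simp only [sub_mul, add_mul, Finset.sum_add_distrib, Finset.sum_sub_distrib]
    rw [← hc]
    simp only [ite_mul, zero_mul, ← Finset.sum_filter, Finset.filter_mem_eq_inter, Finset.univ_inter, ← Finset.mul_sum]
    rw [Finset.sum_filter, Finset.sum_ite_eq']
    simp
    ring

theorem lift_adm {x : V → V → ℚ} {r : ℚ} (h : Adm x r) (hr : 0 < r)
    {σ0 : V → V} (h0 : σ0 ∈ MM x) {P : Finset (V → V)} (hP : P ⊆ MM x) {β : ℚ}
    (h1 : ∀ a b, σ0 a = b → (∀ τ ∈ P, τ a ≠ b) → β ≤ x a b)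
    (h2 : ∀ U, NTr U → (∀ τ ∈ P, cr U τ = 1) → r - β ≤ cut x U - β * cr U σ0) :
    ∃ K : ℕ, Adm (fun a b => x a b - β * chi σ0 a b + K * ∑ τ ∈ P, chi τ a b) (r - β + K * P.card) := by
  have hM : ∀ σ ∈ P, IsPM σ := fun σ h => (mem_MM.1 (hP h)).1
  have hy := adm_sum (s := P) hM (fun _ => 1) (fun _ _ => zero_le_one)
  have hp0 := (mem_MM.1 h0).1
  have zs : ∀ a b, (fun a b => x a b - β * chi σ0 a b) a b = (fun a b => x a b - β * chi σ0 a b) b a := fun a b => by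
    beta_reduce; rw [h.symm, chi_symm hp0]
  have zd : ∀ a, (fun a b => x a b - β * chi σ0 a b) a a = 0 := fun a => by
    beta_reduce; rw [h.diag, chi_diag hp0]; ring
  have zr : ∀ a, ∑ b, (fun a b => x a b - β * chi σ0 a b) a b = r - β := fun a => by
    rw [Finset.sum_sub_distrib, ← Finset.mul_sum, chi_row, h.row]; ring
  have yne : ∀ σ ∈ P, ∀ a, ∑ τ ∈ P, (fun _ => (1:ℚ)) τ * chi τ a (σ a) ≠ 0 := by
    intro σ hσ a
    have h1 : (1:ℚ) * chi σ a (σ a) ≤ ∑ τ ∈ P, (fun _ => (1:ℚ)) τ * chi τ a (σ a) :=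
      Finset.single_le_sum (f := fun τ => 1 * chi τ a (σ a)) (fun τ _ => mul_nonneg zero_le_one (chi_nn _ _ _)) hσ
    have h2 : chi σ a (σ a) = 1 := by unfold chi; rw [if_pos rfl]
    rw [h2] at h1
    linarith
  obtain ⟨e0, p0, he⟩ := perturb hy zs zd zr
    (by
      intro a b hab
      beta_reduce
      by_cases e : σ0 a = b
      · have := h1 a b e (fun τ hτ e' => yne τ hτ a (by rw [e']; exact hab))
        unfold chi; rw [if_pos e]; linarith
      · unfold chi; rw [if_neg e, mul_zero, sub_zero]; exact h.nn _ _)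
    (by
      intro U hU ht
      rcases odd_triv (h.even hr) hU with hn | hn
      · have e1 : cut (fun a b => x a b - β * chi σ0 a b) U = cut x U - β * cr U σ0 := by
          have := cut_lin x (chi σ0) 1 (-β) U
          rw [cut_chi, one_mul] at this
          rw [sub_eq_add_neg, ← neg_mul, ← this]; congr 1; funext a b; ring
        rw [e1]
        apply h2 U hn
        rw [cut_sum] at ht
        have h6 : ∑ i ∈ P, (1 * cut (chi i) U - 1) = 0 := by
          rw [Finset.sum_sub_distrib]; linarith
        rw [Finset.sum_eq_zero_iff_of_nonneg] at h6
        · intro τ hτ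
          have := h6 τ hτ
          rw [cut_chi] at this
          have : (cr U τ : ℚ) = 1 := by linarith
          exact_mod_cast this
        · intro τ hτ
          have := (adm_chi (hM τ hτ)).cut U hU
          linarith
      · rw [cut_triv zs zd zr hn])
  obtain ⟨K, hK⟩ := exists_nat_gt (1 / e0)
  have pK : (0 : ℚ) < K := lt_trans (by positivity) hK
  have hA := (he (1 / K) (by positivity) (by rw [div_le_iff₀ pK]; rw [div_lt_iff₀ p0] at hK; linarith)).smul pK.le
  refine ⟨K, ?_⟩
  convert hA using 1
  · funext a b
    simp only [one_mul]; field_simp; ring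
  · simp only [Finset.sum_const, nsmul_eq_mul, mul_one]; field_simp; ring

end ThmD


section ThmD2

theorem chi_mem {V : Type} (D : Subring ℚ) (σ : V → V) (a b : V) : chi σ a b ∈ D := by
  unfold chi; split_ifs; exacts [D.one_mem, D.zero_mem]

theorem cut_MM {V : Type} [Fintype V] {x : V → V → ℚ} {c : (V → V) → ℚ} (hc : ∀ a b, x a b = ∑ σ, c σ * chi σ a b) (U : Finset V) :
    cut x U = ∑ σ, c σ * cr U σ := by
  have : x = fun a b => ∑ σ ∈ univ, c σ * chi σ a b := by funext a b; exact hc a b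
  rw [this, cut_sum]; simp only [cut_chi]

theorem thmD_aux (D : Subring ℚ) (h2 : (1/2 : ℚ) ∈ D) (n : ℕ) : ∀ (V : Type) [Fintype V], Fintype.card V = n → ∀ (m : ℕ) (x : V → V → ℚ) (r : ℚ), Adm x r →
    (∀ a b, x a b ∈ D) → (univ.filter (fun i : V × V => x i.1 i.2 ≠ 0)).card = m → InD D x := by
  induction n using Nat.strong_induction_on with
  | _ n ihn =>
  intro V _ hV m
  induction m using Nat.strong_induction_on with
  | _ m ihm =>
  intro x r h xD hm
  have red : ∀ (y : V → V → ℚ) (s : ℚ), Adm y s → (∀ a b, y a b ∈ D) → ∀ U, NTr U → cut y U = s → InD D y := by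
    intro y s hy yD U hU ht
    by_cases hs : 0 < s
    · exact reduce D hy yD (hy.even hs)
        (fun W _ hW y' s' hy' yD' => ihn _ (hV ▸ hW) W rfl _ y' s' hy' yD' rfl) hU ht
    · exact InD.zero (hy.r0 hs)
  by_cases hr : 0 < r
  swap
  · exact InD.zero (h.r0 hr)
  by_cases hnt : ∃ U, NTr U ∧ cut x U = r
  · obtain ⟨U, hU, ht⟩ := hnt
    exact red x r h xD U hU ht
  replace hnt : ∀ U, NTr U → cut x U ≠ r := fun U h1 h2 => hnt ⟨U, h1, h2⟩
  by_cases hne : Nonempty V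
  swap
  · exact InD.zero (fun a => (hne ⟨a⟩).elim)
  obtain ⟨σ1, hσ1, hpos⟩ := exists_pm h hr
  have hMne : (MM x).Nonempty := ⟨σ1, mem_MM.2 ⟨hσ1, fun a => (hpos a).ne'⟩⟩
  obtain ⟨c, c0, -, cp, hc⟩ := edmonds h
  have cM : ∀ σ, c σ ≠ 0 → σ ∈ MM x := fun σ h0 => mem_MM.2 ⟨cp σ h0, dec_supp c0 hc h0⟩
  have csum := dec_sum h.row hc
  have hxs : ∀ σ ∈ MM x, ∀ a b, x a b = 0 → chi σ a b = 0 := by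
    intro σ hσ a b h0; unfold chi; rw [if_neg]; intro e; apply (mem_MM.1 hσ).2 a; rw [e]; exact h0
  have mem' : ∀ (β : ℚ), β ∈ D → ∀ (K : ℕ) (σ0 : V → V) (P : Finset (V → V)) (a b : V), x a b - β * chi σ0 a b + K * ∑ τ ∈ P, chi τ a b ∈ D := by
    intro β hβ K σ0 P a b
    exact D.add_mem (D.sub_mem (xD a b) (D.mul_mem hβ (chi_mem D _ _ _))) (D.mul_mem (natCast_mem D K) (D.sum_mem fun τ _ => chi_mem D _ _ _))
  rcases PMSys.core (K := sysOf h hr hnt) hMne with ⟨p, q, ⟨σ0, h0, h0p⟩, hE, hU⟩ | ⟨W, hW, ⟨σ0, h0, h0W⟩, hcov, hU⟩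
  · have h0 : σ0 ∈ MM x := h0
    have hE : ∀ σ ∈ MM x, ∀ a, (∀ τ ∈ MM x, τ p ≠ q → τ a ≠ σ a) → ∀ τ ∈ MM x, τ p = q → τ a = σ a := hE
    have hU : ∀ U, NTr U → (∀ τ ∈ MM x, τ p ≠ q → cr U τ = 1) → ∃ k : ℤ, ∀ σ ∈ MM x, σ p = q → cr U σ = k := hU
    have hPM : (MM x).filter (fun τ => τ p ≠ q) ⊆ MM x := Finset.filter_subset _ _
    have hxpq : x p q = ∑ σ, if σ p = q then c σ else 0 := by
      rw [hc]; apply Finset.sum_congr rfl; intro σ _; unfold chi; split_ifs <;> simp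
    have hpq : x p q ≠ 0 := by rw [← h0p]; exact (mem_MM.1 h0).2 p
    obtain ⟨K, hK⟩ := lift_adm (β := x p q) h hr h0 hPM
      (by
        intro a b hab hP
        have h3 := hE σ0 h0 a (fun τ hτ hp => by rw [hab]; exact hP τ (mem_filter.2 ⟨hτ, hp⟩))
        rw [hxpq, hc a b]
        apply Finset.sum_le_sum; intro σ _
        split_ifs with e
        · by_cases hz : c σ = 0
          · rw [hz]; simp
          · unfold chi; rw [if_pos ((h3 σ (cM σ hz) e).trans hab), mul_one]
        · exact mul_nonneg (c0 σ) (chi_nn _ _ _))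
      (by
        intro U hUn hP
        obtain ⟨k, hk⟩ := hU U hUn (fun τ hτ hp => hP τ (mem_filter.2 ⟨hτ, hp⟩))
        rw [hk σ0 h0 h0p, cut_MM hc, hxpq, ← csum, Finset.sum_mul, ← Finset.sum_sub_distrib, ← Finset.sum_sub_distrib]
        apply Finset.sum_le_sum; intro σ _
        by_cases hz : c σ = 0
        · rw [hz]; simp
        · split_ifs with e
          · rw [hk σ (cM σ hz) e]; simp
          · rw [hP σ (mem_filter.2 ⟨cM σ hz, e⟩)]; simp)
    refine signed_finish D h2 h hr hnt h0 hPM (xD p q) (K := K) ?_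
    refine ihm _ ?_ _ _ hK (mem' _ (xD p q) K σ0 _) rfl
    rw [← hm]
    apply Finset.card_lt_card
    rw [Finset.ssubset_iff_of_subset]
    · refine ⟨(p, q), by simp [hpq], ?_⟩
      simp only [mem_filter, mem_univ, true_and, not_not]
      rw [Finset.sum_eq_zero]
      · unfold chi; rw [if_pos h0p]; ring
      · intro τ hτ; unfold chi; rw [if_neg (mem_filter.1 hτ).2]
    · intro i
      simp only [mem_filter, mem_univ, true_and]
      intro hp hz
      apply hp
      rw [hz, hxs σ0 h0 _ _ hz, Finset.sum_eq_zero (fun τ hτ => hxs τ (hPM hτ) _ _ hz)]; ring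
  · have h0 : σ0 ∈ MM x := h0
    have hcov : ∀ σ ∈ MM x, ∀ a, ∃ τ ∈ MM x, cr W τ = 1 ∧ τ a = σ a := hcov
    have hU : ∀ U, NTr U → (∀ τ ∈ MM x, cr W τ = 1 → cr U τ = 1) → ∃ k : ℚ, ∀ σ ∈ MM x, (cr U σ : ℚ) - 1 = k * ((cr W σ : ℚ) - 1) := hU
    have hPM : (MM x).filter (fun τ => cr W τ = 1) ⊆ MM x := Finset.filter_subset _ _
    obtain ⟨β, hβ⟩ : ∃ β : ℚ, β = (cut x W - r) / ((cr W σ0 : ℚ) - 1) := ⟨_, rfl⟩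
    have hne0 : (cr W σ0 : ℚ) - 1 ≠ 0 := by rcases h0W with e | e <;> rw [e] <;> norm_num
    have hβ' : β * ((cr W σ0 : ℚ) - 1) = cut x W - r := by rw [hβ]; field_simp
    have rD : r ∈ D := by rw [← h.row hne.some]; exact D.sum_mem fun b _ => xD _ b
    have cD : cut x W ∈ D := D.sum_mem fun a _ => D.sum_mem fun b _ => xD a b
    have βD : β ∈ D := by
      rcases h0W with e | e
      · have : β = (1/2) * (cut x W - r) := by rw [hβ, e]; norm_num; ring
        rw [this]; exact D.mul_mem h2 (D.sub_mem cD rD)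
      · have : β = (1/2) * ((1/2) * (cut x W - r)) := by rw [hβ, e]; norm_num; ring
        rw [this]; exact D.mul_mem h2 (D.mul_mem h2 (D.sub_mem cD rD))
    have cutr : ∀ U, cut x U - r = ∑ σ, c σ * ((cr U σ : ℚ) - 1) := by
      intro U; rw [cut_MM hc, ← csum, ← Finset.sum_sub_distrib]; apply Finset.sum_congr rfl; intros; ring
    obtain ⟨K, hK⟩ := lift_adm (β := β) h hr h0 hPM
      (by
        intro a b hab hP
        obtain ⟨τ, h3, h4, h5⟩ := hcov σ0 h0 a
        exact absurd (h5.trans hab) (hP τ (mem_filter.2 ⟨h3, h4⟩)))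
      (by
        intro U hUn hP
        obtain ⟨k, hk⟩ := hU U hUn (fun τ hτ hp => hP τ (mem_filter.2 ⟨hτ, hp⟩))
        have e1 : cut x U - r = k * (cut x W - r) := by
          rw [cutr, cutr, Finset.mul_sum]; apply Finset.sum_congr rfl; intro σ _
          by_cases hz : c σ = 0
          · rw [hz]; simp
          · rw [hk σ (cM σ hz)]; ring
        have e2 := hk σ0 h0
        rw [← hβ'] at e1
        have e3 : cut x U - r = β * ((cr U σ0 : ℚ) - 1) := by rw [e1, e2]; ring
        linarith)
    refine signed_finish D h2 h hr hnt h0 hPM βD (K := K) ?_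
    refine red _ _ hK (mem' _ βD K σ0 _) W hW ?_
    have e1 := cut_lin (fun a b => 1 * x a b + (-β) * chi σ0 a b) (fun a b => ∑ τ ∈ (MM x).filter (fun τ => cr W τ = 1), 1 * chi τ a b) 1 K W
    rw [cut_sum, cut_lin x (chi σ0), cut_chi] at e1
    have e2 : ∑ τ ∈ (MM x).filter (fun τ => cr W τ = 1), 1 * cut (chi τ) W = ((MM x).filter (fun τ => cr W τ = 1)).card := by
      rw [Finset.sum_congr rfl (g := fun _ => (1:ℚ)), Finset.sum_const, nsmul_eq_mul, mul_one]
      intro τ hτ; rw [cut_chi, (mem_filter.1 hτ).2]; simp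
    rw [e2] at e1
    trans (1 * (1 * cut x W + (-β) * cr W σ0) + K * ((MM x).filter (fun τ => cr W τ = 1)).card : ℚ)
    · rw [← e1]; congr 1; funext a b; simp only [one_mul]; ring
    · linarith

theorem thmD (D : Subring ℚ) (h2 : (1/2 : ℚ) ∈ D) {V : Type} [Fintype V] {x : V → V → ℚ} {r : ℚ} (h : Adm x r)
    (xD : ∀ a b, x a b ∈ D) : InD D x := thmD_aux D h2 _ V rfl _ x r h xD rfl

end ThmD2


section PartR

theorem mc {V : Type} [Fintype V] {U : Finset V} {a : V} : a ∈ Uᶜ ↔ a ∉ U := mem_compl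

/-- separation by `X` -/
def SepX {V E : Type} (en : E × Bool → V) (X : V → Bool) (e : E) : Prop := X (en (e, true)) ≠ X (en (e, false))

/-- cut condition -/
def CutC {V E : Type} [Fintype E] (en : E × Bool → V) (w : E → ℤ) : Prop :=
  ∀ (X : V → Bool) (g : E), SepX en X g → 2 * w g ≤ ∑ e, if SepX en X e then w e else 0

def IsCyc {V E : Type} (en : E × Bool → V) (C : Finset E) : Prop :=
  ∀ X : V → Bool, Even (C.filter (fun e => SepX en X e)).card

def InCyc {V E : Type} (D : Subring ℚ) (en : E × Bool → V) (w : E → ℤ) : Prop :=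
  ∃ (ι : Type) (_ : Fintype ι) (c : ι → ℚ) (C : ι → Finset E), (∀ i, 0 ≤ c i) ∧ (∀ i, c i ∈ D) ∧
    (∀ i, c i ≠ 0 → IsCyc en (C i)) ∧ ∀ e, (w e : ℚ) = ∑ i, if e ∈ C i then c i else 0

variable {V E : Type} [Fintype V] [Fintype E]

theorem sum_half (f : E × Bool → ℚ) : ∑ h, f h = ∑ e, (f (e, true) + f (e, false)) := by
  rw [Fintype.sum_prod_type]; apply Finset.sum_congr rfl; intro e _; simp

noncomputable def DD (en : E × Bool → V) (w : E → ℤ) (v : V) : ℚ := ∑ h : E × Bool, if en h = v then (w h.1 : ℚ) else 0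

theorem DD_ge {en : E × Bool → V} {w : E → ℤ} (hl : ∀ e, en (e, true) ≠ en (e, false)) (hc : CutC en w) (h : E × Bool) :
    2 * (w h.1 : ℚ) ≤ DD en w (en h) := by
  have hsep : ∀ e, SepX en (fun v => decide (v = en h)) e ↔ (en (e, true) = en h ∨ en (e, false) = en h) := by
    intro e
    unfold SepX
    have := hl e
    by_cases h1 : en (e, true) = en h <;> by_cases h2 : en (e, false) = en h
    · exact absurd (h1.trans h2.symm) this
    all_goals simp [h1, h2]
  have h1 := hc (fun v => decide (v = en h)) h.1 ((hsep _).2 (by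
    rcases h with ⟨e, b⟩; cases b
    · right; rfl
    · left; rfl))
  have h2 : DD en w (en h) = ((∑ e, if SepX en (fun v => decide (v = en h)) e then w e else 0 : ℤ) : ℚ) := by
    unfold DD
    rw [sum_half]; push_cast
    apply Finset.sum_congr rfl; intro e _
    simp only [hsep]
    have := hl e
    by_cases h1 : en (e, true) = en h <;> by_cases h2 : en (e, false) = en h
    · exact absurd (h1.trans h2.symm) this
    all_goals simp [h1, h2]
  rw [h2]; exact_mod_cast h1

noncomputable def x2 (en : E × Bool → V) (w : E → ℤ) (h k : E × Bool) : ℚ :=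
  if h.1 ≠ k.1 ∧ en h = en k then (w h.1 : ℚ) + w k.1 - DD en w (en h) / 2 else 0

noncomputable def x1 (r : ℚ) (w : E → ℤ) (h k : E × Bool) : ℚ :=
  if h.1 = k.1 ∧ h ≠ k then r - w h.1 else 0

theorem x2_symm (en : E × Bool → V) (w : E → ℤ) (h k : E × Bool) : x2 en w h k = x2 en w k h := by
  unfold x2
  by_cases h1 : h.1 ≠ k.1 ∧ en h = en k
  · rw [if_pos h1, if_pos ⟨h1.1.symm, h1.2.symm⟩, h1.2]; ring
  · rw [if_neg h1, if_neg (fun h2 => h1 ⟨h2.1.symm, h2.2.symm⟩)]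

theorem x1_symm (r : ℚ) (w : E → ℤ) (h k : E × Bool) : x1 r w h k = x1 r w k h := by
  unfold x1
  by_cases h1 : h.1 = k.1 ∧ h ≠ k
  · rw [if_pos h1, if_pos ⟨h1.1.symm, h1.2.symm⟩, h1.1]
  · rw [if_neg h1, if_neg (fun h2 => h1 ⟨h2.1.symm, h2.2.symm⟩)]

theorem ne_iff_edge {en : E × Bool → V} (hl : ∀ e, en (e, true) ≠ en (e, false)) {h k : E × Bool} (e : en h = en k) : h.1 ≠ k.1 ↔ h ≠ k := by
  constructor
  · rintro h1 rfl; exact h1 rfl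
  · intro h1 h2
    rcases h with ⟨a, b⟩; rcases k with ⟨c, d⟩
    simp only at h2; subst h2
    have := hl a
    cases b <;> cases d
    · exact h1 rfl
    · exact this e.symm
    · exact this e
    · exact h1 rfl

theorem x2_row {en : E × Bool → V} {w : E → ℤ} (hl : ∀ e, en (e, true) ≠ en (e, false)) (hc : CutC en w)
    (hd : ∀ v, (univ.filter (fun h => en h = v)).card ≤ 3) (hw : ∀ e, 0 ≤ w e) (h : E × Bool) : ∑ k, x2 en w h k = w h.1 := by
  obtain ⟨S, hS⟩ : ∃ S : Finset (E × Bool), S = (univ.filter (fun k => en k = en h)).erase h := ⟨_, rfl⟩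
  have hh : h ∈ univ.filter (fun k => en k = en h) := by simp
  have e1 : ∑ k, x2 en w h k = ∑ k ∈ S, ((w h.1 : ℚ) + w k.1 - DD en w (en h) / 2) := by
    unfold x2
    rw [← Finset.sum_filter]
    apply Finset.sum_congr _ (fun _ _ => rfl)
    ext k
    rw [hS, mem_filter, mem_erase, mem_filter]
    constructor
    · rintro ⟨-, h1, h2⟩
      exact ⟨((ne_iff_edge hl h2).1 h1).symm, mem_univ _, h2.symm⟩
    · rintro ⟨h1, -, h2⟩
      exact ⟨mem_univ _, (ne_iff_edge hl h2.symm).2 h1.symm, h2.symm⟩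
  have e2 : DD en w (en h) = w h.1 + ∑ k ∈ S, (w k.1 : ℚ) := by
    unfold DD
    rw [← Finset.sum_filter, hS, Finset.add_sum_erase _ (fun k => (w k.1 : ℚ)) hh]
  have hcard : S.card ≤ 2 := by
    rw [hS, Finset.card_erase_of_mem hh]; have := hd (en h); omega
  have hge := DD_ge hl hc h
  have hk : ∀ k ∈ S, 2 * (w k.1 : ℚ) ≤ DD en w (en h) := by
    intro k hk
    rw [hS, mem_erase, mem_filter] at hk
    rw [← hk.2.2]; exact DD_ge hl hc k
  rw [e1, Finset.sum_sub_distrib, Finset.sum_add_distrib, Finset.sum_const, Finset.sum_const, nsmul_eq_mul, nsmul_eq_mul]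
  interval_cases hcs : S.card
  · rw [Finset.card_eq_zero] at hcs
    rw [hcs] at e2 ⊢
    have : (0 : ℚ) ≤ w h.1 := by exact_mod_cast hw h.1
    simp at e2 ⊢; linarith
  · obtain ⟨k, hk'⟩ := Finset.card_eq_one.1 hcs
    have := hk k (by rw [hk']; simp)
    rw [hk'] at e2 ⊢
    simp at e2 ⊢; linarith
  · push_cast; linarith

theorem x2_nn {en : E × Bool → V} {w : E → ℤ} (hl : ∀ e, en (e, true) ≠ en (e, false)) (hc : CutC en w)
    (hd : ∀ v, (univ.filter (fun h => en h = v)).card ≤ 3) (hw : ∀ e, 0 ≤ w e) (h k : E × Bool) : 0 ≤ x2 en w h k := by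
  unfold x2
  split_ifs with h1
  swap; · exact le_rfl
  have hne := (ne_iff_edge hl h1.2).1 h1.1
  obtain ⟨S, hS⟩ : ∃ S : Finset (E × Bool), S = ((univ.filter (fun k => en k = en h)).erase h).erase k := ⟨_, rfl⟩
  have hh : h ∈ univ.filter (fun k => en k = en h) := by simp
  have hk : k ∈ (univ.filter (fun k => en k = en h)).erase h := by simp [h1.2, hne.symm]
  have hcard : S.card ≤ 1 := by
    rw [hS, Finset.card_erase_of_mem hk, Finset.card_erase_of_mem hh]; have := hd (en h); omega
  have e2 : DD en w (en h) = w h.1 + (w k.1 + ∑ k ∈ S, (w k.1 : ℚ)) := by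
    unfold DD
    rw [← Finset.sum_filter, hS, Finset.add_sum_erase _ (fun k => (w k.1 : ℚ)) hk, Finset.add_sum_erase _ (fun k => (w k.1 : ℚ)) hh]
  have p1 : (0 : ℚ) ≤ w h.1 := by exact_mod_cast hw h.1
  have p2 : (0 : ℚ) ≤ w k.1 := by exact_mod_cast hw k.1
  interval_cases hcs : S.card
  · rw [Finset.card_eq_zero] at hcs
    rw [hcs] at e2
    simp at e2; linarith
  · obtain ⟨j, hj⟩ := Finset.card_eq_one.1 hcs
    have hjS : j ∈ S := by rw [hj]; simp
    rw [hS, mem_erase, mem_erase, mem_filter] at hjS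
    have := DD_ge hl hc j
    rw [hjS.2.2.2] at this
    rw [hj] at e2
    simp at e2; linarith

theorem x1_row (r : ℚ) (w : E → ℤ) (h : E × Bool) : ∑ k, x1 r w h k = r - w h.1 := by
  rw [Finset.sum_eq_single (h.1, !h.2)]
  · unfold x1; rw [if_pos]; refine ⟨rfl, fun e => ?_⟩
    have := congrArg Prod.snd e; simp at this
  · intro k _ hk
    unfold x1; rw [if_neg]; rintro ⟨h1, h2⟩
    rcases h with ⟨a, b⟩; rcases k with ⟨c, d⟩
    simp only at h1; subst h1
    cases b <;> cases d <;> simp_all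
  · intro h; exact absurd (mem_univ _) h

theorem x1_cut (r : ℚ) (w : E → ℤ) (U : Finset (E × Bool)) :
    cut (x1 r w) U = ∑ e, if ((e, true) ∈ U ↔ (e, false) ∈ U) then 0 else r - (w e : ℚ) := by
  have : cut (x1 r w) U = ∑ h : E × Bool, if h ∈ U ∧ (h.1, !h.2) ∉ U then r - (w h.1 : ℚ) else 0 := by
    unfold cut
    rw [← Finset.sum_filter, ← Finset.sum_filter_add_sum_filter_not U (fun h => (h.1, !h.2) ∉ U)]
    have z : ∀ h k : E × Bool, k ≠ (h.1, !h.2) → x1 r w h k = 0 := by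
      intro h k hk
      unfold x1; rw [if_neg]; rintro ⟨h1, h2⟩
      rcases h with ⟨a, b⟩; rcases k with ⟨c, d⟩
      simp only at h1; subst h1
      cases b <;> cases d <;> simp_all
    rw [Finset.sum_eq_zero (s := U.filter (fun h => ¬ (h.1, !h.2) ∉ U)), add_zero]
    · rw [show univ.filter (fun h : E × Bool => h ∈ U ∧ (h.1, !h.2) ∉ U) = U.filter (fun h => (h.1, !h.2) ∉ U) by ext h; simp]
      apply Finset.sum_congr rfl
      intro h hh
      rw [mem_filter] at hh
      rw [← x1_row r w h]
      apply Finset.sum_subset (subset_univ _)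
      intro k _ hk
      apply z; rintro rfl; exact hk (mc.2 hh.2)
    · intro h hh
      rw [mem_filter] at hh
      apply Finset.sum_eq_zero; intro k hk
      apply z; rintro rfl; exact hh.2 (mc.1 hk)
  rw [this, sum_half]
  apply Finset.sum_congr rfl; intro e _
  simp only [Bool.not_true, Bool.not_false]
  by_cases h1 : (e, true) ∈ U <;> by_cases h2 : (e, false) ∈ U <;> simp [h1, h2]

end PartR


section PartR2
variable {V E : Type} [Fintype V] [Fintype E]

theorem cut_fil {V : Type} [Fintype V] (x g : V → V → ℚ) (U : Finset V) (h1 : ∀ a b, a ∈ U → b ∉ U → x a b = g a b)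
    (h2 : ∀ a b, ¬ (a ∈ U ∧ b ∉ U) → g a b = 0) :
    cut x U = ∑ a, ∑ b, g a b := by
  unfold cut
  rw [← Finset.sum_subset (subset_univ U) (f := fun a => ∑ b, g a b)]
  · apply Finset.sum_congr rfl; intro a ha
    rw [← Finset.sum_subset (subset_univ Uᶜ)]
    · apply Finset.sum_congr rfl; intro b hb; exact h1 a b ha (mem_compl.1 hb)
    · intro b _ hb; exact h2 a b (fun h => hb (mem_compl.2 h.2))
  · intro a _ ha; apply Finset.sum_eq_zero; intro b _; exact h2 a b (fun h => ha h.1)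

theorem sep_parity (en : E × Bool → V) (X : V → Bool) (C : Finset E) :
    Even (∑ e ∈ C, ((if X (en (e, true)) = true then 1 else 0) + (if X (en (e, false)) = true then 1 else 0))) ↔
    Even (C.filter (fun e => SepX en X e)).card := by
  rw [Finset.card_filter, ← Nat.even_add, ← Finset.sum_add_distrib]
  apply Finset.even_sum
  intro e _
  unfold SepX
  cases X (en (e, true)) <;> cases X (en (e, false)) <;> simp <;> decide

theorem sig_iff {σ : E × Bool → E × Bool} (hp : IsPM σ) (h : E × Bool) : σ (h.1, true) ≠ (h.1, false) ↔ (σ h).1 ≠ h.1 := by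
  rcases h with ⟨e, b⟩
  simp only
  rw [not_iff_not]
  have q : ∀ a b, σ a = b → σ b = a := fun a b h => by rw [← h]; exact hp.1 a
  constructor
  · intro h; cases b
    · rw [q _ _ h]
    · rw [h]
  · intro h
    have hne := hp.2 (e, b)
    cases b
    · cases hd' : (σ (e, false)).2
      · exact absurd (Prod.ext h hd') hne
      · exact q _ _ (Prod.ext h hd')
    · cases hd' : (σ (e, true)).2
      · exact Prod.ext h hd'
      · exact absurd (Prod.ext h hd') hne

theorem sig_cyc {en : E × Bool → V} {σ : E × Bool → E × Bool} (hp : IsPM σ) (hen : ∀ h : E × Bool, (σ h).1 ≠ h.1 → en (σ h) = en h) :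
    IsCyc en (univ.filter (fun e => σ (e, true) ≠ (e, false))) := by
  intro X
  have hev : Even (univ.filter (fun h : E × Bool => (σ h).1 ≠ h.1 ∧ X (en h) = true)).card := by
    apply even_card_invol _ σ
    · intro h hh
      simp only [mem_filter, mem_univ, true_and] at hh ⊢
      rw [hp.1, hen h hh.1]; exact ⟨hh.1.symm, hh.2⟩
    · intro h _; exact hp.1 h
    · intro h _; exact hp.2 h
  rw [← sep_parity]
  convert hev using 1
  rw [Finset.card_filter, Fintype.sum_prod_type, Finset.sum_filter]
  apply Finset.sum_congr rfl; intro e _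
  rw [Fintype.sum_bool]
  have a1 := sig_iff hp (e, true)
  have a2 := sig_iff hp (e, false)
  by_cases hh : σ (e, true) ≠ (e, false)
  · have b1 := a1.1 hh
    have b2 := a2.1 hh
    rw [if_pos hh]
    simp only [b1, b2, ne_eq, not_false_eq_true, true_and]
  · have b1 := fun h => hh (a1.2 h)
    have b2 := fun h => hh (a2.2 h)
    rw [if_neg hh, if_neg (fun h => b1 h.1), if_neg (fun h => b2 h.1)]
    rfl

theorem x2_cut {en : E × Bool → V} {w : E → ℤ} (hl : ∀ e, en (e, true) ≠ en (e, false)) (hc : CutC en w)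
    (hd : ∀ v, (univ.filter (fun h => en h = v)).card ≤ 3) (hw : ∀ e, 0 ≤ w e) (U : Finset (E × Bool)) :
    ∃ X : V → Bool, ∑ h : E × Bool, (if (decide (h ∈ U)) = X (en h) then 0 else (w h.1 : ℚ)) ≤ cut (x2 en w) U := by
  obtain ⟨X, hX⟩ : ∃ X : V → Bool, X = fun v => decide ((univ.filter (fun h => en h = v ∧ h ∉ U)).card ≤ (univ.filter (fun h => en h = v ∧ h ∈ U)).card) := ⟨_, rfl⟩
  refine ⟨X, ?_⟩
  have hsum : ∀ v, (univ.filter (fun h => en h = v ∧ h ∉ U)).card + (univ.filter (fun h => en h = v ∧ h ∈ U)).card ≤ 3 := by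
    intro v
    refine le_trans (le_of_eq ?_) (hd v)
    rw [← Finset.card_filter_add_card_filter_not (s := univ.filter (fun h => en h = v)) (fun h => h ∉ U), Finset.filter_filter, Finset.filter_filter]
    simp only [not_not]
  have z : ∀ a b, x2 en w a b ≠ 0 → en a = en b ∧ a ≠ b := by
    intro a b h
    unfold x2 at h
    by_cases h1 : a.1 ≠ b.1 ∧ en a = en b
    · exact ⟨h1.2, (ne_iff_edge hl h1.2).1 h1.1⟩
    · rw [if_neg h1] at h; exact absurd rfl h
  have k1 : ∀ h, X (en h) = false → h ∈ U → ∀ b, x2 en w h b ≠ 0 → b ∉ U := by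
    intro h h1 h2 b hb hbU
    rw [hX] at h1; simp only [decide_eq_false_iff_not, not_le] at h1
    have h3 := hsum (en h)
    have h4 : (univ.filter (fun k => en k = en h ∧ k ∈ U)).card ≤ 1 := by omega
    rw [Finset.card_le_one] at h4
    obtain ⟨e1, e2⟩ := z h b hb
    exact e2 (h4 h (by simp [h2]) b (by simp [hbU, e1]))
  have k2 : ∀ h, X (en h) = true → h ∉ U → ∀ b, x2 en w h b ≠ 0 → b ∈ U := by
    intro h h1 h2 b hb
    by_contra hbU
    rw [hX] at h1; simp only [decide_eq_true_eq] at h1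
    have h3 := hsum (en h)
    have h4 : (univ.filter (fun k => en k = en h ∧ k ∉ U)).card ≤ 1 := by omega
    rw [Finset.card_le_one] at h4
    obtain ⟨e1, e2⟩ := z h b hb
    exact e2 (h4 h (by simp [h2]) b (by simp [hbU, e1]))
  have e1 : ∀ a b, (if a ∈ U ∧ b ∉ U then x2 en w a b else 0) =
      (if X (en a) = false ∧ a ∈ U then x2 en w a b else 0) + (if X (en b) = true ∧ b ∉ U then x2 en w b a else 0) := by
    intro a b
    by_cases h0 : x2 en w a b = 0
    · rw [x2_symm en w b a, h0]; simp
    · have ⟨e, _⟩ := z a b h0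
      have h0' : x2 en w b a ≠ 0 := by rw [x2_symm]; exact h0
      have q1 := k1 a
      have q2 := k2 b
      rw [x2_symm en w b a, ← e]
      cases hXa : X (en a)
      · by_cases ha : a ∈ U
        · have := k1 a hXa ha b h0
          simp [ha, this]
        · simp [ha]
      · by_cases hb : b ∈ U
        · simp [hb]
        · have := k2 b (by rw [← e]; exact hXa) hb a h0'
          simp [hb, this]
  rw [cut_fil (x2 en w) _ U (fun a b ha hb => (if_pos ⟨ha, hb⟩).symm.trans (e1 a b)) (fun a b h => (e1 a b).symm.trans (if_neg h))]
  simp only [Finset.sum_add_distrib]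
  rw [Finset.sum_comm (f := fun a b => if X (en b) = true ∧ b ∉ U then x2 en w b a else 0), ← Finset.sum_add_distrib]
  apply le_of_eq
  apply Finset.sum_congr rfl; intro h _
  have hrow := x2_row hl hc hd hw h
  cases hXh : X (en h) <;> by_cases hU : h ∈ U <;> simp [hU, hrow]

theorem trans_ge {en : E × Bool → V} {w : E → ℤ} (hc : CutC en w) (hw : ∀ e, 0 ≤ w e) (U : Finset (E × Bool)) (X : V → Bool) (g : E)
    (hg : ¬ ((g, true) ∈ U ↔ (g, false) ∈ U)) (ho : ∀ e, e ≠ g → ((e, true) ∈ U ↔ (e, false) ∈ U)) :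
    (w g : ℚ) ≤ ∑ h : E × Bool, (if (decide (h ∈ U)) = X (en h) then 0 else (w h.1 : ℚ)) := by
  rw [sum_half]
  have nn : ∀ e, (0:ℚ) ≤ w e := fun e => by exact_mod_cast hw e
  by_cases hs : SepX en X g
  · have h1 := hc X g hs
    have h2 : (w g : ℚ) ≤ ∑ e ∈ univ.erase g, if SepX en X e then (w e : ℚ) else 0 := by
      have h3 : (2 * w g : ℚ) ≤ ∑ e, if SepX en X e then (w e : ℚ) else 0 := by exact_mod_cast h1
      rw [← Finset.add_sum_erase _ _ (mem_univ g), if_pos hs] at h3; linarith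
    refine h2.trans ?_
    refine le_trans ?_ (Finset.sum_le_sum_of_subset_of_nonneg (Finset.erase_subset g univ) ?_)
    · apply Finset.sum_le_sum; intro e he
      have he' := ho e (Finset.ne_of_mem_erase he)
      have := nn e
      unfold SepX
      by_cases hU : (e, true) ∈ U
      · have hU' := he'.1 hU
        simp only [hU, hU', decide_true]
        cases X (en (e, true)) <;> cases X (en (e, false)) <;> simp [this]
      · have hU' : (e, false) ∉ U := fun h => hU (he'.2 h)
        simp only [hU, hU', decide_false]
        cases X (en (e, true)) <;> cases X (en (e, false)) <;> simp [this]
    · intro e _ _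
      have := nn e
      refine add_nonneg ?_ ?_ <;> split_ifs <;> simp [this]
  · refine le_trans ?_ (Finset.single_le_sum (f := fun e => ((if (decide ((e, true) ∈ U)) = X (en (e, true)) then 0 else (w e : ℚ)) + (if (decide ((e, false) ∈ U)) = X (en (e, false)) then 0 else (w e : ℚ)))) ?_ (mem_univ g))
    · beta_reduce
      unfold SepX at hs; rw [not_not] at hs
      rw [hs]
      have := nn g
      by_cases hU : (g, true) ∈ U <;> by_cases hU' : (g, false) ∈ U
      · exact absurd (by simp [hU, hU']) hg
      · simp only [hU, hU', decide_true, decide_false]; cases X (en (g, false)) <;> simp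
      · simp only [hU, hU', decide_true, decide_false]; cases X (en (g, false)) <;> simp
      · exact absurd (by simp [hU, hU']) hg
    · intro e _
      have := nn e
      refine add_nonneg ?_ ?_ <;> split_ifs <;> simp [this]

theorem adm_x {en : E × Bool → V} {w : E → ℤ} (hl : ∀ e, en (e, true) ≠ en (e, false)) (hc : CutC en w)
    (hd : ∀ v, (univ.filter (fun h => en h = v)).card ≤ 3) (hw : ∀ e, 0 ≤ w e) :
    Adm (fun a b => x1 (∑ e, (w e : ℚ)) w a b + x2 en w a b) (∑ e, (w e : ℚ)) := by
  have nn : ∀ e, (0:ℚ) ≤ w e := fun e => by exact_mod_cast hw e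
  have hle : ∀ e, (w e : ℚ) ≤ ∑ e, (w e : ℚ) := fun e => Finset.single_le_sum (f := fun e => (w e : ℚ)) (fun e _ => nn e) (mem_univ e)
  have x2nn := x2_nn hl hc hd hw
  refine ⟨fun a b => ?_, fun a => ?_, fun a b => ?_, fun a => ?_, fun U hU => ?_⟩
  · rw [x1_symm, x2_symm]
  · unfold x1 x2; rw [if_neg (fun h => h.2 rfl), if_neg (fun h => h.1 rfl), add_zero]
  · refine add_nonneg ?_ (x2nn a b)
    unfold x1; split_ifs
    · linarith [hle a.1]
    · exact le_rfl
  · rw [Finset.sum_add_distrib, x1_row, x2_row hl hc hd hw]; ring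
  · have e0 : cut (fun a b => x1 (∑ e, (w e : ℚ)) w a b + x2 en w a b) U = cut (x1 (∑ e, (w e : ℚ)) w) U + cut (x2 en w) U := by
      have := cut_lin (x1 (∑ e, (w e : ℚ)) w) (x2 en w) 1 1 U
      simp only [one_mul] at this; exact this
    rw [e0, x1_cut]
    have hsplit : ∃ g, ¬ ((g, true) ∈ U ↔ (g, false) ∈ U) := by
      by_contra hn
      push Not at hn
      rw [← Nat.not_even_iff_odd] at hU
      apply hU
      apply even_card_invol U (fun h => (h.1, !h.2))
      · rintro ⟨e, b⟩ h; cases b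
        · exact (hn e).2 h
        · exact (hn e).1 h
      · rintro ⟨e, b⟩ h; simp
      · rintro ⟨e, b⟩ h; simp
    obtain ⟨g, hg⟩ := hsplit
    have hnn : ∀ e, 0 ≤ (if ((e, true) ∈ U ↔ (e, false) ∈ U) then 0 else (∑ e, (w e : ℚ)) - (w e : ℚ)) := by
      intro e; split_ifs
      · exact le_rfl
      · linarith [hle e]
    by_cases ho : ∀ e, e ≠ g → ((e, true) ∈ U ↔ (e, false) ∈ U)
    · obtain ⟨X, hX⟩ := x2_cut hl hc hd hw U
      have h1 := trans_ge hc hw U X g hg ho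
      have h2 := Finset.single_le_sum (fun e _ => hnn e) (mem_univ g)
      rw [if_neg hg] at h2
      linarith
    · push Not at ho
      obtain ⟨f, hfg, hf⟩ := ho
      have h0 : 0 ≤ cut (x2 en w) U := Finset.sum_nonneg fun a _ => Finset.sum_nonneg fun b _ => x2nn a b
      have h3 : (∑ e ∈ ({g, f} : Finset E), if ((e, true) ∈ U ↔ (e, false) ∈ U) then 0 else (∑ e, (w e : ℚ)) - (w e : ℚ)) ≤
        ∑ e, if ((e, true) ∈ U ↔ (e, false) ∈ U) then 0 else (∑ e, (w e : ℚ)) - (w e : ℚ) :=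
        Finset.sum_le_sum_of_subset_of_nonneg (subset_univ _) (fun e _ _ => hnn e)
      rw [Finset.sum_pair hfg.symm, if_neg hg, if_neg (by tauto)] at h3
      have h4 : (w g : ℚ) + w f ≤ ∑ e, (w e : ℚ) := by
        rw [← Finset.sum_pair hfg.symm (f := fun e => (w e : ℚ))]
        exact Finset.sum_le_sum_of_subset_of_nonneg (subset_univ _) (fun e _ _ => nn e)
      linarith

theorem cubic (D : Subring ℚ) (h2 : (1/2 : ℚ) ∈ D) {en : E × Bool → V} {w : E → ℤ} (hl : ∀ e, en (e, true) ≠ en (e, false)) (hc : CutC en w)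
    (hd : ∀ v, (univ.filter (fun h => en h = v)).card ≤ 3) (hw : ∀ e, 0 ≤ w e) : InCyc D en w := by
  have h := adm_x hl hc hd hw
  have rD : (∑ e, (w e : ℚ)) ∈ D := D.sum_mem fun e _ => intCast_mem D _
  have DDD : ∀ v, DD en w v ∈ D := fun v => D.sum_mem fun h _ => by split_ifs; exacts [intCast_mem D _, D.zero_mem]
  obtain ⟨c, c0, cD, cp, hcx⟩ := thmD D h2 h (fun a b => by
    refine D.add_mem ?_ ?_
    · unfold x1; split_ifs; exacts [D.sub_mem rD (intCast_mem D _), D.zero_mem]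
    · unfold x2; split_ifs
      · refine D.sub_mem (D.add_mem (intCast_mem D _) (intCast_mem D _)) ?_
        rw [div_eq_mul_one_div]; exact D.mul_mem (DDD _) h2
      · exact D.zero_mem)
  refine ⟨E × Bool → E × Bool, inferInstance, c, fun σ => univ.filter (fun e => σ (e, true) ≠ (e, false)), c0, cD, ?_, ?_⟩
  · intro σ hσ X
    have hp := cp σ hσ
    have hs := dec_supp c0 hcx hσ
    have hen : ∀ h : E × Bool, (σ h).1 ≠ h.1 → en (σ h) = en h := by
      intro h hne
      have := hs h
      by_contra hn
      apply this
      unfold x1 x2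
      rw [if_neg (fun h => hne h.1.symm), if_neg (fun h => hn h.2.symm), add_zero]
    exact sig_cyc hp hen X
  · intro e
    have hne : Nonempty (E × Bool) := ⟨(e, true)⟩
    have h1 := dec_sum h.row hcx
    have h3 := hcx (e, true) (e, false)
    have h4 : x1 (∑ e, (w e : ℚ)) w (e, true) (e, false) + x2 en w (e, true) (e, false) = (∑ e, (w e : ℚ)) - w e := by
      unfold x1 x2; rw [if_pos ⟨rfl, by simp⟩, if_neg (fun h => h.1 rfl), add_zero]
    beta_reduce at h3
    rw [h4, ← h1] at h3
    have h5 := eq_sub_iff_add_eq'.2 (sub_eq_iff_eq_add.1 h3).symm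
    have h6 : (∑ σ, if e ∈ (univ.filter (fun e => σ (e, true) ≠ (e, false))) then c σ else 0) = ∑ σ, c σ - ∑ σ, c σ * chi σ (e, true) (e, false) := by
      rw [← Finset.sum_sub_distrib]
      apply Finset.sum_congr rfl; intro σ _
      unfold chi
      by_cases e1 : σ (e, true) = (e, false) <;> simp [e1]
    refine h5.trans ?_
    refine Eq.trans ?_ (h6.symm.trans ?_)
    · convert rfl
    · convert rfl

end PartR2



section PartR3
variable {V E : Type} [Fintype V] [Fintype E]

theorem exists_l {S : Type} (T : Finset S) (f : S → ℤ) :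
    ∃ l : ℤ, 0 ≤ l ∧ (∀ s ∈ T, f s ≤ l) ∧ (l = 0 ∨ ∃ s ∈ T, l = f s) := by
  induction T using Finset.induction_on with
  | empty => exact ⟨0, le_refl _, by simp, Or.inl rfl⟩
  | insert a T ha ih =>
    obtain ⟨l, h0, h1, h2⟩ := ih
    by_cases h : f a ≤ l
    · refine ⟨l, h0, ?_, ?_⟩
      · intro s hs
        rcases Finset.mem_insert.1 hs with rfl | hs
        · exact h
        · exact h1 s hs
      · rcases h2 with h2 | ⟨s, hs, h2⟩
        · exact Or.inl h2
        · exact Or.inr ⟨s, Finset.mem_insert_of_mem hs, h2⟩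
    · push Not at h
      refine ⟨f a, by omega, ?_, Or.inr ⟨a, Finset.mem_insert_self _ _, rfl⟩⟩
      intro s hs
      rcases Finset.mem_insert.1 hs with rfl | hs
      · exact le_refl _
      · exact (h1 s hs).trans h.le

/-- weight of the old edges separated -/
noncomputable def AA (en' : Option E × Bool → Option V) (w : E → ℤ) (X : Option V → Bool) : ℤ :=
  ∑ e, if SepX en' X (some e) then w e else 0

theorem AA_nonneg (en' : Option E × Bool → Option V) {w : E → ℤ} (hw : ∀ e, 0 ≤ w e) (X : Option V → Bool) :
    0 ≤ AA en' w X := by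
  unfold AA
  apply Finset.sum_nonneg; intro e _
  split_ifs
  · exact hw e
  · exact le_refl _

theorem AA_ge (en' : Option E × Bool → Option V) {w : E → ℤ} (hw : ∀ e, 0 ≤ w e) (X : Option V → Bool)
    {g : E} (hg : SepX en' X (some g)) : w g ≤ AA en' w X := by
  unfold AA
  have := Finset.single_le_sum (s := univ) (f := fun e => if SepX en' X (some e) then w e else 0) (fun e _ => by
    beta_reduce
    split_ifs
    · exact hw e
    · exact le_refl _) (Finset.mem_univ g)
  beta_reduce at this
  rwa [if_pos hg] at this

theorem sep_xor (en' : Option E × Bool → Option V) (X Y : Option V → Bool) (o : Option E) :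
    SepX en' (fun z => xor (X z) (Y z)) o ↔ ((SepX en' X o ∧ ¬ SepX en' Y o) ∨ (¬ SepX en' X o ∧ SepX en' Y o)) := by
  unfold SepX
  beta_reduce
  generalize X (en' (o, true)) = a
  generalize X (en' (o, false)) = b
  generalize Y (en' (o, true)) = c
  generalize Y (en' (o, false)) = d
  revert a b c d
  simp

theorem AA_xor (en' : Option E × Bool → Option V) {w : E → ℤ} (hw : ∀ e, 0 ≤ w e) (X Y : Option V → Bool) :
    AA en' w (fun z => xor (X z) (Y z)) ≤ AA en' w X + AA en' w Y := by
  unfold AA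
  rw [← Finset.sum_add_distrib]
  apply Finset.sum_le_sum; intro e _
  have := sep_xor en' X Y (some e)
  have := hw e
  by_cases h1 : SepX en' X (some e) <;> by_cases h2 : SepX en' Y (some e) <;>
    simp only [sep_xor, h1, h2, not_true, not_false_iff, true_and, and_true, false_and, and_false, or_self, or_true, true_or, or_false, false_or, if_true, if_false] <;> omega

theorem AA_eq {en : E × Bool → V} {w : E → ℤ} {v : V} {en' : Option E × Bool → Option V}
    (hπ : ∀ e b, (en' (some e, b)).getD v = en (e, b)) {X : Option V → Bool} (hX : X none = X (some v)) (e : E) :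
    SepX en' X (some e) ↔ SepX en (fun u => X (some u)) e := by
  have : ∀ o : Option V, X o = X (some (o.getD v)) := by
    intro o; cases o
    · exact hX
    · rfl
  unfold SepX
  rw [this (en' (some e, true)), this (en' (some e, false)), hπ, hπ]

theorem split_l {en : E × Bool → V} {w : E → ℤ} (hc : CutC en w) (hw : ∀ e, 0 ≤ w e) (v : V)
    (en' : Option E × Bool → Option V) (hπ : ∀ e b, (en' (some e, b)).getD v = en (e, b))
    (hT : en' (none, true) = none) (hF : en' (none, false) = some v) :
    ∃ l : ℤ, 0 ≤ l ∧ CutC en' (fun o : Option E => o.elim l w) := by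
  obtain ⟨l, l0, l1, l2⟩ := exists_l ((univ : Finset ((Option V → Bool) × E)).filter (fun p => p.1 none ≠ p.1 (some v) ∧ SepX en' p.1 (some p.2)))
    (fun p => 2 * w p.2 - AA en' w p.1)
  have hflat : ∀ X : Option V → Bool, X none = X (some v) → ∀ g, SepX en' X (some g) → 2 * w g ≤ AA en' w X := by
    intro X hX g hg
    have := hc (fun u => X (some u)) g ((AA_eq (w := w) hπ hX g).1 hg)
    refine this.trans (le_of_eq ?_)
    unfold AA
    apply Finset.sum_congr rfl; intro e _
    simp only [AA_eq (w := w) hπ hX e]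
  have hnone : ∀ X : Option V → Bool, SepX en' X none ↔ X none ≠ X (some v) := by
    intro X; unfold SepX; rw [hT, hF]
  refine ⟨l, l0, ?_⟩
  intro X g hg
  have hs : (∑ o : Option E, if SepX en' X o then (o.elim l w) else 0) = (if X none ≠ X (some v) then l else 0) + AA en' w X := by
    rw [Fintype.sum_option]
    unfold AA
    simp only [hnone]
    rfl
  rw [hs]
  by_cases hX : X none = X (some v)
  · rw [if_neg (not_not.2 hX), zero_add]
    cases g with
    | none => exact absurd hX ((hnone X).1 hg)
    | some g => exact hflat X hX g hg
  · rw [if_pos hX]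
    cases g with
    | some g =>
      have := l1 (X, g) (Finset.mem_filter.2 ⟨Finset.mem_univ _, hX, hg⟩)
      change 2 * w g ≤ _
      beta_reduce at this
      dsimp only at this
      omega
    | none =>
      change 2 * l ≤ _
      suffices l ≤ AA en' w X by omega
      rcases l2 with l2 | ⟨⟨Y, h⟩, hp, l2⟩
      · rw [l2]; exact AA_nonneg en' hw X
      · have hp := (Finset.mem_filter.1 hp).2
        dsimp only at hp l2
        obtain ⟨hY, hh⟩ := hp
        have a1 := AA_ge en' hw Y hh
        by_cases hx : SepX en' X (some h)
        · have a2 := AA_ge en' hw X hx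
          omega
        · have a3 := AA_xor en' hw X Y
          have a4 := hflat (fun z => xor (X z) (Y z)) (by
            beta_reduce
            revert hX hY
            generalize X none = a
            generalize X (some v) = b
            generalize Y none = c
            generalize Y (some v) = d
            revert a b c d
            simp) h ((sep_xor _ _ _ _).2 (Or.inr ⟨hx, hh⟩))
          omega

theorem restrict {en : E × Bool → V} {w : E → ℤ} {l : ℤ} {v : V} {D : Subring ℚ}
    {en' : Option E × Bool → Option V} (hπ : ∀ e b, (en' (some e, b)).getD v = en (e, b))
    (hT : en' (none, true) = none) (hF : en' (none, false) = some v)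
    (h : InCyc D en' (fun o : Option E => o.elim l w)) : InCyc D en w := by
  obtain ⟨ι, _, c, C, c0, cD, hC, hw⟩ := h
  refine ⟨ι, inferInstance, c, fun i => univ.filter (fun e => some e ∈ C i), c0, cD, ?_, ?_⟩
  · intro i hi X
    have := hC i hi (fun o => X (o.getD v))
    convert this using 1
    apply Finset.card_bij (fun e _ => some e)
    · intro e he
      simp only [Finset.mem_filter, Finset.mem_univ, true_and] at he ⊢
      refine ⟨he.1, ?_⟩
      have := he.2
      unfold SepX at this ⊢
      beta_reduce
      rwa [hπ, hπ]
    · intro a _ b _ h; exact Option.some.inj h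
    · intro o ho
      simp only [Finset.mem_filter, Finset.mem_univ, true_and] at ho ⊢
      cases o with
      | none =>
        exfalso
        have := ho.2
        unfold SepX at this
        rw [hT, hF] at this
        exact this rfl
      | some e =>
        refine ⟨e, ⟨ho.1, ?_⟩, rfl⟩
        have := ho.2
        unfold SepX at this ⊢
        beta_reduce at this
        rwa [hπ, hπ] at this
  · intro e
    rw [show (w e : ℚ) = _ from hw (some e)]
    apply Finset.sum_congr rfl; intro i _
    simp

end PartR3



section PartR3b

noncomputable def dg {V E : Type} [Fintype E] (en : E × Bool → V) (u : V) : ℕ := ∑ e, ((if en (e, true) = u then 1 else 0) + (if en (e, false) = u then 1 else 0))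

theorem dg_card {V E : Type} [Fintype E] (en : E × Bool → V) (u : V) :
    (univ.filter (fun h => en h = u)).card = dg en u := by
  unfold dg
  rw [Finset.card_filter, Fintype.sum_prod_type]
  apply Finset.sum_congr rfl; intro e _
  rw [Fintype.sum_bool]

noncomputable def enS {V E : Type} (en : E × Bool → V) (v : V) (h1 h2 : E × Bool) : Option E × Bool → Option V := fun p =>
  match p with
  | (none, true) => none
  | (none, false) => some v
  | (some e, b) => if (e, b) = h1 ∨ (e, b) = h2 then none else some (en (e, b))

theorem dg_enS {V E : Type} [Fintype E] (en : E × Bool → V) (v : V) (h1 h2 : E × Bool) (u : Option V) :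
    dg (enS en v h1 h2) u = ((if none = u then 1 else 0) + (if some v = u then 1 else 0)) +
      (univ.filter (fun h : E × Bool => (if h = h1 ∨ h = h2 then none else some (en h)) = u)).card := by
  unfold dg
  rw [Fintype.sum_option]
  congr 1
  · convert rfl <;> rfl
  rw [Finset.card_filter, Fintype.sum_prod_type]
  apply Finset.sum_congr rfl; intro e _
  rw [Fintype.sum_bool]
  unfold enS
  congr 1 <;> congr

theorem dg_none {V E : Type} [Fintype E] (en : E × Bool → V) (v : V) (h1 h2 : E × Bool) :
    dg (enS en v h1 h2) none ≤ 3 := by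
  rw [dg_enS, if_pos rfl, if_neg (by simp)]
  have : (univ.filter (fun h : E × Bool => (if h = h1 ∨ h = h2 then none else some (en h)) = none)).card ≤ 2 := by
    refine le_trans (Finset.card_le_card ?_) (Finset.card_le_two (a := h1) (b := h2))
    intro h hh
    have := (Finset.mem_filter.1 hh).2
    by_contra hn
    rw [if_neg (fun h => hn (by simpa using h))] at this
    exact absurd this (by simp)
  omega

theorem dg_some_le {V E : Type} [Fintype E] (en : E × Bool → V) (v : V) (h1 h2 : E × Bool) (u : V) (hu : u ≠ v) :
    dg (enS en v h1 h2) (some u) ≤ dg en u := by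
  rw [dg_enS, if_neg (by simp), if_neg (fun h => hu (Option.some.inj h).symm), ← dg_card, zero_add, zero_add]
  apply Finset.card_le_card
  intro h hh
  have := (Finset.mem_filter.1 hh).2
  refine Finset.mem_filter.2 ⟨Finset.mem_univ _, ?_⟩
  split_ifs at this
  exact Option.some.inj this

theorem dg_some_lt {V E : Type} [Fintype E] (en : E × Bool → V) (v : V) (h1 h2 : E × Bool) (h12 : h1 ≠ h2) (e1 : en h1 = v) (e2 : en h2 = v) :
    dg (enS en v h1 h2) (some v) + 1 ≤ dg en v := by
  rw [dg_enS, if_neg (by simp), if_pos rfl, ← dg_card]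
  have : (insert h1 (insert h2 (univ.filter (fun h : E × Bool => (if h = h1 ∨ h = h2 then none else some (en h)) = some v)))).card ≤ (univ.filter (fun h => en h = v)).card := by
    apply Finset.card_le_card
    intro h hh
    refine Finset.mem_filter.2 ⟨Finset.mem_univ _, ?_⟩
    rcases Finset.mem_insert.1 hh with rfl | hh
    · exact e1
    rcases Finset.mem_insert.1 hh with rfl | hh
    · exact e2
    have := (Finset.mem_filter.1 hh).2
    split_ifs at this
    exact Option.some.inj this
  rw [Finset.card_insert_of_notMem (by simp [h12]), Finset.card_insert_of_notMem (by simp)] at this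
  omega

theorem all_cyc (D : Subring ℚ) (h2 : (1/2:ℚ) ∈ D) (n : ℕ) : ∀ {V E : Type} [Fintype V] [Fintype E] (en : E × Bool → V) (w : E → ℤ)
    (hn : ∑ u, (dg en u - 3) ≤ n)
    (hl : ∀ e, en (e, true) ≠ en (e, false)) (hc : CutC en w) (hw : ∀ e, 0 ≤ w e), InCyc D en w := by
  induction n with
  | zero =>
    intro V E _ _ en w hn hl hc hw
    refine cubic D h2 hl hc ?_ hw
    intro v
    rw [dg_card]
    have := Finset.single_le_sum (s := univ) (f := fun u => dg en u - 3) (fun _ _ => Nat.zero_le _) (Finset.mem_univ v)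
    beta_reduce at this
    omega
  | succ n ih =>
    intro V E _ _ en w hn hl hc hw
    by_cases hd : ∀ v, dg en v ≤ 3
    · refine cubic D h2 hl hc ?_ hw
      intro v
      rw [dg_card]; exact hd v
    push Not at hd
    obtain ⟨v, hv⟩ := hd
    obtain ⟨a, ha, b, hb, hab⟩ := Finset.one_lt_card.1 (show 1 < (univ.filter (fun h => en h = v)).card by rw [dg_card]; omega)
    have ea := (Finset.mem_filter.1 ha).2
    have eb := (Finset.mem_filter.1 hb).2
    have hπ : ∀ e c, (enS en v a b (some e, c)).getD v = en (e, c) := by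
      intro e c
      change (if (e, c) = a ∨ (e, c) = b then none else some (en (e, c))).getD v = _
      by_cases h : (e, c) = a ∨ (e, c) = b
      · rw [if_pos h]
        rcases h with h | h
        · rw [h, ea]; rfl
        · rw [h, eb]; rfl
      · rw [if_neg h]; rfl
    obtain ⟨l, l0, hc'⟩ := split_l hc hw v (enS en v a b) hπ rfl rfl
    refine restrict hπ rfl rfl (ih (enS en v a b) (fun o : Option E => o.elim l w) ?_ ?_ hc' ?_)
    · rw [Fintype.sum_option]
      have h0 := dg_none en v a b
      have : ∑ u, (dg (enS en v a b) (some u) - 3) < ∑ u, (dg en u - 3) := by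
        have hlt := dg_some_lt en v a b hab ea eb
        apply Finset.sum_lt_sum
        · intro u _
          by_cases hu : u = v
          · subst hu; omega
          · have := dg_some_le en v a b u hu; omega
        · exact ⟨v, Finset.mem_univ _, by omega⟩
      omega
    · intro o
      cases o with
      | none => change (none : Option V) ≠ some v; simp
      | some e =>
        intro h
        apply hl e
        rw [← hπ, ← hπ, h]
    · intro o
      cases o with
      | none => exact l0
      | some e => exact hw e

end PartR3b

section PartR4

def Dy : Subring ℚ where
  carrier := {q | ∃ (a : ℤ) (k : ℕ), q = a / 2 ^ k}
  mul_mem' := by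
    rintro _ _ ⟨a, k, rfl⟩ ⟨b, l, rfl⟩
    exact ⟨a * b, k + l, by push_cast; rw [pow_add, div_mul_div_comm]⟩
  one_mem' := ⟨1, 0, by simp⟩
  add_mem' := by
    rintro _ _ ⟨a, k, rfl⟩ ⟨b, l, rfl⟩
    refine ⟨a * 2 ^ l + b * 2 ^ k, k + l, ?_⟩
    push_cast; rw [pow_add]; field_simp
  zero_mem' := ⟨0, 0, by simp⟩
  neg_mem' := by
    rintro _ ⟨a, k, rfl⟩
    exact ⟨-a, k, by push_cast; rw [neg_div]⟩

theorem half_Dy : (1/2 : ℚ) ∈ Dy := ⟨1, 1, by norm_num⟩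

variable {V E : Type} [Fintype V] [Fintype E]

theorem cyc_of_set {ends : E → Sym2 V} {en : E × Bool → V} (hen : ∀ e, ends e = s(en (e, true), en (e, false)))
    (hl : ∀ e, en (e, true) ≠ en (e, false)) {C : Finset E} (h : IsCycleSet ends C) : IsCyc en C := by
  intro X
  rw [← sep_parity]
  have : (∑ e ∈ C, ((if X (en (e, true)) = true then 1 else 0) + (if X (en (e, false)) = true then 1 else 0))) =
      ∑ v, if X v = true then (univ.filter (fun e => e ∈ C ∧ v ∈ ends e)).card else 0 := by
    have e1 : ∀ v, (if X v = true then (univ.filter (fun e => e ∈ C ∧ v ∈ ends e)).card else 0) = ∑ e ∈ C, if X v = true ∧ v ∈ ends e then 1 else 0 := by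
      intro v
      by_cases hv : X v = true
      · rw [if_pos hv, ← Finset.card_filter]
        congr 1
        ext e; simp [hv]
      · rw [if_neg hv]; simp [hv]
    rw [Finset.sum_congr rfl (fun v _ => e1 v), Finset.sum_comm]
    apply Finset.sum_congr rfl; intro e _
    have e2 : ∀ v, (if X v = true ∧ v ∈ ends e then 1 else 0) = (if en (e, true) = v then (if X v = true then 1 else 0) else 0) + (if en (e, false) = v then (if X v = true then 1 else 0) else 0) := by
      intro v
      have hm : v ∈ ends e ↔ en (e, true) = v ∨ en (e, false) = v := by rw [hen e, Sym2.mem_iff, eq_comm, @eq_comm _ v]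
      simp only [hm]
      have := hl e
      by_cases h1 : en (e, true) = v <;> by_cases h2 : en (e, false) = v
      · exact absurd (h1.trans h2.symm) this
      · simp [h1, h2]
      · simp [h1, h2]
      · simp [h1, h2]
    rw [Finset.sum_congr rfl (fun v _ => e2 v), Finset.sum_add_distrib]
    simp only [Finset.sum_ite_eq, Finset.mem_univ, if_true]
  rw [this]
  apply Finset.even_sum
  intro v _
  split_ifs
  · exact h v
  · exact Even.zero

theorem set_of_cyc {ends : E → Sym2 V} {en : E × Bool → V} (hen : ∀ e, ends e = s(en (e, true), en (e, false)))
    (hl : ∀ e, en (e, true) ≠ en (e, false)) {C : Finset E} (h : IsCyc en C) : IsCycleSet ends C := by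
  intro v
  have := h (fun u => decide (u = v))
  convert this using 2
  ext e
  simp only [Finset.mem_filter, Finset.mem_univ, true_and]
  refine and_congr_right (fun _ => ?_)
  unfold SepX
  rw [hen e, Sym2.mem_iff, eq_comm, @eq_comm _ v]
  have := hl e
  by_cases h1 : en (e, true) = v <;> by_cases h2 : en (e, false) = v
  · exact absurd (h1.trans h2.symm) this
  · simp [h1, h2]
  · simp [h1, h2]
  · simp [h1, h2]

theorem cyc_sdiff {ends : E → Sym2 V} {C M : Finset E} (hC : IsCycleSet ends C) (hM : IsCycleSet ends M) (hs : M ⊆ C) :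
    IsCycleSet ends (C \ M) := by
  intro v
  have h1 := hC v
  have h2 := hM v
  have : (univ.filter (fun e => e ∈ C ∧ v ∈ ends e)).card = (univ.filter (fun e => e ∈ M ∧ v ∈ ends e)).card + (univ.filter (fun e => e ∈ C \ M ∧ v ∈ ends e)).card := by
    rw [← Finset.card_union_of_disjoint]
    · congr 1
      ext e
      simp only [Finset.mem_filter, Finset.mem_univ, true_and, Finset.mem_union, Finset.mem_sdiff]
      have := @hs e
      by_cases hm : e ∈ M
      · simp [hm, this hm]
      · simp [hm]
    · rw [Finset.disjoint_left]
      intro e he hf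
      exact (Finset.mem_sdiff.1 (Finset.mem_filter.1 hf).2.1).2 (Finset.mem_filter.1 he).2.1
  rw [this] at h1
  exact (Nat.even_add.1 h1).1 h2

theorem cyc_decomp (ends : E → Sym2 V) (C : Finset E) : IsCycleSet ends C →
    ∃ n : {C : Finset E // IsCircuit ends C} → ℕ, ∀ e, (if e ∈ C then 1 else 0) = ∑ i, n i * (if e ∈ i.1 then 1 else 0) := by
  induction C using Finset.strongInduction with
  | H C ih =>
    intro hC
    by_cases hne : C = ∅
    · refine ⟨fun _ => 0, fun e => ?_⟩
      simp [hne]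
    obtain ⟨M, hM, hmin⟩ := Finset.exists_min_image (C.powerset.filter (fun M => M.Nonempty ∧ IsCycleSet ends M)) (fun M => M.card)
      ⟨C, Finset.mem_filter.2 ⟨Finset.mem_powerset_self C, Finset.nonempty_iff_ne_empty.2 hne, hC⟩⟩
    obtain ⟨hMC, hMn, hMc⟩ := Finset.mem_filter.1 hM
    have hMC := Finset.mem_powerset.1 hMC
    have circ : IsCircuit ends M := by
      refine ⟨hMn, hMc, ?_⟩
      intro C' h1 h2 h3
      exact Finset.eq_of_subset_of_card_le h1 (hmin C' (Finset.mem_filter.2 ⟨Finset.mem_powerset.2 (h1.trans hMC), h2, h3⟩))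
    obtain ⟨n, hn⟩ := ih (C \ M) (Finset.sdiff_ssubset hMC hMn) (cyc_sdiff hC hMc hMC)
    refine ⟨fun i => n i + if i = ⟨M, circ⟩ then 1 else 0, fun e => ?_⟩
    simp only [add_mul, Finset.sum_add_distrib]
    rw [← hn e]
    have : (∑ i : {C : Finset E // IsCircuit ends C}, (if i = ⟨M, circ⟩ then 1 else 0) * (if e ∈ i.1 then 1 else 0)) = if e ∈ M then 1 else 0 := by
      rw [Finset.sum_eq_single ⟨M, circ⟩]
      · simp
      · intro b _ hb; rw [if_neg hb, zero_mul]
      · intro h; exact absurd (Finset.mem_univ _) h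
    rw [this]
    have := @hMC e
    by_cases hm : e ∈ M
    · simp [hm, this hm]
    · simp [hm]

theorem cutC_of_comb {en : E × Bool → V} {w : E → ℤ} {ι : Type} [Fintype ι] (C : ι → Finset E) (hC : ∀ i, IsCyc en (C i))
    (lam : ι → ℝ) (h0 : ∀ i, 0 ≤ lam i) (hw : ∀ e, ∑ i, lam i * (if e ∈ C i then 1 else 0) = (w e : ℝ)) : CutC en w := by
  intro X g hg
  have : (2 * (w g : ℝ)) ≤ ∑ e, if SepX en X e then (w e : ℝ) else 0 := by
    have e1 : (∑ e, if SepX en X e then (w e : ℝ) else 0) = ∑ i, lam i * ((C i).filter (fun e => SepX en X e)).card := by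
      have : ∀ e, (if SepX en X e then (w e : ℝ) else 0) = ∑ i, lam i * (if e ∈ C i ∧ SepX en X e then 1 else 0) := by
        intro e
        by_cases h : SepX en X e
        · simp only [h, if_true, and_true]; exact (hw e).symm
        · simp [h]
      rw [Finset.sum_congr rfl (fun e _ => this e), Finset.sum_comm]
      apply Finset.sum_congr rfl; intro i _
      rw [← Finset.mul_sum, Finset.card_filter]
      congr 1
      push_cast
      rw [← Finset.sum_filter, ← Finset.sum_filter]
      apply Finset.sum_congr _ (fun _ _ => rfl)
      ext e; simp
    rw [e1, ← hw g, Finset.mul_sum]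
    apply Finset.sum_le_sum; intro i _
    by_cases hi : g ∈ C i
    · rw [if_pos hi]
      have h1 : 0 < ((C i).filter (fun e => SepX en X e)).card := Finset.card_pos.2 ⟨g, Finset.mem_filter.2 ⟨hi, hg⟩⟩
      have h2 : 2 ≤ ((C i).filter (fun e => SepX en X e)).card := by
        obtain ⟨k, hk⟩ := hC i X
        omega
      have h3 : (2 : ℝ) ≤ ((C i).filter (fun e => SepX en X e)).card := by exact_mod_cast h2
      nlinarith [h0 i]
    · rw [if_neg hi, mul_zero, mul_zero]
      exact mul_nonneg (h0 i) (Nat.cast_nonneg _)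
  exact_mod_cast this

end PartR4

/-- For a finite (loopless) graph `G = (V, E)`, the characteristic vectors
of the circuits of `G` form a dyadic generating set for a cone. -/
theorem circuits_form_DGSC {V E : Type} [Fintype V] [Fintype E]
    (ends : E → Sym2 V) (hloopless : ∀ e, ¬ (ends e).IsDiag) :
    IsPGSC 2 (fun C : {C : Finset E // IsCircuit ends C} => fun e : E =>
      if e ∈ C.1 then (1 : ℤ) else 0) := by
  have hp : ∀ e, ∃ p : V × V, ends e = s(p.1, p.2) := by
    intro e
    induction ends e using Sym2.inductionOn with
    | hf a b => exact ⟨(a, b), rfl⟩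
  choose p hp using hp
  obtain ⟨en, hen'⟩ : ∃ en : E × Bool → V, en = fun h => if h.2 = true then (p h.1).1 else (p h.1).2 := ⟨_, rfl⟩
  have hen : ∀ e, ends e = s(en (e, true), en (e, false)) := by
    intro e; rw [hp e, hen']; rfl
  have hl : ∀ e, en (e, true) ≠ en (e, false) := by
    intro e h
    apply hloopless e
    rw [hen e, h]
    exact Sym2.mk_isDiag_iff.2 rfl
  rintro w ⟨lam, l0, hw⟩
  push_cast at hw
  have hcut : CutC en w := cutC_of_comb (fun i : {C : Finset E // IsCircuit ends C} => i.1)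
    (fun i => cyc_of_set hen hl i.2.2.1) lam l0 hw
  have w0 : ∀ e, 0 ≤ w e := by
    intro e
    have : (0 : ℝ) ≤ w e := by
      rw [← hw e]
      apply Finset.sum_nonneg; intro i _
      refine mul_nonneg (l0 i) ?_
      split_ifs <;> norm_num
    exact_mod_cast this
  obtain ⟨ι, _, c, C, c0, cD, hC, hcw⟩ := all_cyc Dy half_Dy _ en w (le_refl _) hl hcut w0
  have hn : ∀ j, ∃ n : {C : Finset E // IsCircuit ends C} → ℕ, c j ≠ 0 → ∀ e, (if e ∈ C j then 1 else 0) = ∑ i, n i * (if e ∈ i.1 then 1 else 0) := by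
    intro j
    by_cases h : c j = 0
    · exact ⟨fun _ => 0, fun h' => absurd h h'⟩
    · obtain ⟨n, hn⟩ := cyc_decomp ends (C j) (set_of_cyc hen hl (hC j h))
      exact ⟨n, fun _ => hn⟩
  choose n hn using hn
  refine ⟨fun i => ((∑ j, c j * n j i : ℚ) : ℝ), ?_, ?_, ?_⟩
  · intro i
    have : (0 : ℚ) ≤ ∑ j, c j * n j i := Finset.sum_nonneg (fun j _ => mul_nonneg (c0 j) (Nat.cast_nonneg _))
    beta_reduce
    exact Rat.cast_nonneg.2 this
  · intro i
    have : (∑ j, c j * n j i : ℚ) ∈ Dy := Dy.sum_mem (fun j _ => Dy.mul_mem (cD j) (natCast_mem Dy _))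
    obtain ⟨a, k, h⟩ := this
    exact ⟨a, k, by beta_reduce; rw [h]; push_cast; rfl⟩
  · intro e
    have : (∑ i : {C : Finset E // IsCircuit ends C}, (∑ j, c j * n j i) * (if e ∈ i.1 then 1 else 0)) = (w e : ℚ) := by
      rw [hcw e]
      simp only [Finset.sum_mul]
      rw [Finset.sum_comm]
      apply Finset.sum_congr rfl; intro j _
      by_cases h : c j = 0
      · simp [h]
      · have h1 : ((if e ∈ C j then 1 else 0 : ℕ) : ℚ) = ((∑ i, n j i * (if e ∈ i.1 then 1 else 0) : ℕ) : ℚ) := by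
          exact_mod_cast hn j h e
        push_cast at h1
        simp only [mul_assoc]
        rw [← Finset.mul_sum, ← h1]
        simp
    have h2 : (((∑ i : {C : Finset E // IsCircuit ends C}, (∑ j, c j * n j i) * (if e ∈ i.1 then 1 else 0)) : ℚ) : ℝ) = ((w e : ℚ) : ℝ) := by
      rw [this]
    push_cast [apply_ite] at h2 ⊢
    convert h2 using 3
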